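/- arXiv:1603.04539 — 2 statements merged into one kernel-verified Lean document; each statement's English description precedes it below -/
import Mathlib

section
/- Let f : 𝕋 → ℝ be a continuous real-valued function on the circle 𝕋 = ℝ/2πℤ. Then there exist a strictly increasing homeomorphism h of the interval [0, 2π] onto itself (with h(0) = 0, h(2π) = 2π) and a constant c ∈ ℝ such that, denoting by g the 2π-periodic function induced by t ↦ f(h(t)) and by v the 2π-periodic function induced by t ↦ h(t) − t + c on [0, 2π), the Fourier coefficients satisfy v̂(k) = -i·sgn(k)·ĝ(k) for every k ∈ ℤ; that is, the conjugate of f∘h is exactly t ↦ h(t) − t + c. -/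
open scoped Real

namespace JW

structure Config (N : ℕ) (z : ℤ → ℝ) : Prop where
  mono : Monotone z
  per : ∀ j, z (j + N) = z j + 2 * π

noncomputable def PP (N : ℕ) (z : ℤ → ℝ) (t : ℝ) : ℝ :=
  ∏ k ∈ Finset.Ioc (0:ℤ) N, |2 * Real.sin ((t - z k) / 2)|

lemma abs_sin_shift (x : ℝ) (m : ℤ) :
    |2 * Real.sin ((x + m * (2 * π)) / 2)| = |2 * Real.sin (x / 2)| := by
  have : (x + m * (2 * π)) / 2 = x / 2 + m * π := by ring
  rw [this, Real.sin_add_int_mul_pi]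
  rw [abs_mul, abs_mul, abs_mul, abs_zpow]
  simp

lemma Config.per_mul {N : ℕ} {z : ℤ → ℝ} (h : Config N z) (j m : ℤ) :
    z (j + m * N) = z j + m * (2 * π) := by
  induction m using Int.induction_on with
  | zero => simp
  | succ i ih =>
    have := h.per (j + i * N)
    rw [show j + ((i:ℤ) + 1) * N = j + i * N + N by ring, this, ih]
    push_cast; ring
  | pred i ih =>
    have := h.per (j + (-(i:ℤ) - 1) * N)
    rw [show j + (-(i:ℤ) - 1) * N + N = j + -(i:ℤ) * N by ring, ih] at this
    push_cast at this ⊢; linarith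

lemma exists_rep {N : ℕ} (hN : 0 < N) (j : ℤ) :
    ∃ r ∈ Finset.Ioc (0:ℤ) N, ∃ m : ℤ, j = r + m * N := by
  refine ⟨(j - 1) % N + 1, ?_, (j - 1) / N, ?_⟩
  · have h1 := Int.emod_nonneg (j - 1) (b := (N:ℤ)) (by omega)
    have h2 := Int.emod_lt_of_pos (j - 1) (b := (N:ℤ)) (by omega)
    simp only [Finset.mem_Ioc]; omega
  · have := Int.emod_add_mul_ediv (j - 1) N
    linarith

/-- representatives in a window -/
lemma exists_rep_from {N : ℕ} (hN : 0 < N) (a j : ℤ) :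
    ∃ r, a ≤ r ∧ r < a + N ∧ ∃ m : ℤ, j = r + m * N := by
  obtain ⟨r, hr, m, hm⟩ := exists_rep hN (j - a + 1)
  simp only [Finset.mem_Ioc] at hr
  exact ⟨r + a - 1, by omega, by omega, m, by linarith⟩

lemma Config.factor {N : ℕ} {z : ℤ → ℝ} (h : Config N z) (t : ℝ) (j m : ℤ) :
    |2 * Real.sin ((t - z (j + m * N)) / 2)| = |2 * Real.sin ((t - z j) / 2)| := by
  rw [h.per_mul, show t - (z j + m * (2 * π)) = (t - z j) + ((-m : ℤ) : ℝ) * (2 * π) by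
    push_cast; ring, abs_sin_shift]

lemma PP_nonneg (N : ℕ) (z : ℤ → ℝ) (t : ℝ) : 0 ≤ PP N z t :=
  Finset.prod_nonneg fun _ _ => abs_nonneg _

lemma PP_add_int (N : ℕ) (z : ℤ → ℝ) (t : ℝ) (m : ℤ) :
    PP N z (t + m * (2 * π)) = PP N z t := by
  unfold PP
  refine Finset.prod_congr rfl fun k _ => ?_
  rw [show t + m * (2 * π) - z k = (t - z k) + m * (2 * π) by ring, abs_sin_shift]

lemma PP_translate (N : ℕ) (z : ℤ → ℝ) (t c : ℝ) :
    PP N (fun j => z j + c) (t + c) = PP N z t := by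
  unfold PP
  refine Finset.prod_congr rfl fun k _ => ?_
  simp

lemma Config.PP_self {N : ℕ} (hN : 0 < N) {z : ℤ → ℝ} (h : Config N z) (j : ℤ) :
    PP N z (z j) = 0 := by
  obtain ⟨r, hr, m, hm⟩ := exists_rep hN j
  refine Finset.prod_eq_zero hr ?_
  rw [← h.factor _ r m, ← hm]; simp

lemma Config.PP_eq_zero {N : ℕ} {z : ℤ → ℝ} (h : Config N z) {t : ℝ}
    (ht : PP N z t = 0) : ∃ j, t = z j := by
  obtain ⟨k, hk, hk2⟩ := Finset.prod_eq_zero_iff.1 ht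
  have : Real.sin ((t - z k) / 2) = 0 := by simpa using hk2
  obtain ⟨n, hn⟩ := Real.sin_eq_zero_iff.1 this
  exact ⟨k + n * N, by rw [h.per_mul]; linarith⟩

lemma Config.PP_pos {N : ℕ} {z : ℤ → ℝ} (h : Config N z) {t : ℝ} {j : ℤ}
    (ht : t ∈ Set.Ioo (z j) (z (j + 1))) : 0 < PP N z t := by
  refine lt_of_le_of_ne (PP_nonneg _ _ _) fun h0 => ?_
  obtain ⟨i, hi⟩ := h.PP_eq_zero h0.symm
  rcases le_or_gt i j with hij | hij
  · have := h.mono hij; linarith [ht.1]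
  · have := h.mono (show j + 1 ≤ i by omega); linarith [ht.2]

lemma continuous_PP (N : ℕ) : Continuous (fun p : (ℤ → ℝ) × ℝ => PP N p.1 p.2) := by
  unfold PP; fun_prop

/-- maximum over arc -/
noncomputable def TT (N : ℕ) (j : ℤ) (z : ℤ → ℝ) : ℝ :=
  sSup ((fun s : ℝ => PP N z (z j + s * (z (j + 1) - z j))) '' Set.Icc 0 1)

lemma continuous_TT (N : ℕ) (j : ℤ) : Continuous (TT N j) := by
  unfold TT
  refine IsCompact.continuous_sSup
    (f := fun (z : ℤ → ℝ) (s : ℝ) => PP N z (z j + s * (z (j + 1) - z j))) isCompact_Icc ?_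
  have h2 : Continuous (fun p : (ℤ → ℝ) × ℝ =>
      PP N p.1 (p.1 j + p.2 * (p.1 (j + 1) - p.1 j))) := by
    unfold PP; fun_prop
  exact h2

lemma continuous_PP_right (N : ℕ) (z : ℤ → ℝ) : Continuous (PP N z) := by
  unfold PP; fun_prop

lemma TT_bdd (N : ℕ) (j : ℤ) (z : ℤ → ℝ) :
    BddAbove ((fun s : ℝ => PP N z (z j + s * (z (j + 1) - z j))) '' Set.Icc 0 1) := by
  refine (isCompact_Icc.image ?_).bddAbove
  exact (continuous_PP_right N z).comp (by fun_prop)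

lemma le_TT {N : ℕ} {j : ℤ} {z : ℤ → ℝ} {t : ℝ} (ht : t ∈ Set.Icc (z j) (z (j + 1))) :
    PP N z t ≤ TT N j z := by
  refine le_csSup (TT_bdd N j z) ?_
  rcases eq_or_lt_of_le (ht.1.trans ht.2) with h | h
  · exact ⟨0, by simp, by simp; congr 1; linarith [ht.1, ht.2]⟩
  · refine ⟨(t - z j) / (z (j+1) - z j), ⟨?_, ?_⟩, ?_⟩
    · exact div_nonneg (by linarith [ht.1]) (by linarith)
    · rw [div_le_one (by linarith)]; linarith [ht.2]
    · have : z (j+1) - z j ≠ 0 := by linarith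
      simp only; rw [div_mul_cancel₀ _ this]; congr 1; ring

lemma TT_attained {N : ℕ} {j : ℤ} {z : ℤ → ℝ} (h : z j ≤ z (j + 1)) :
    ∃ t ∈ Set.Icc (z j) (z (j + 1)), PP N z t = TT N j z := by
  obtain ⟨s, hs, h2⟩ := isCompact_Icc.exists_sSup_image_eq (s := Set.Icc (0:ℝ) 1)
    ⟨0, by simp⟩ (f := fun s : ℝ => PP N z (z j + s * (z (j + 1) - z j)))
    ((continuous_PP_right N z).comp (by fun_prop)).continuousOn
  refine ⟨_, ⟨?_, ?_⟩, h2.symm⟩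
  · nlinarith [hs.1, hs.2]
  · nlinarith [hs.1, hs.2]

lemma Config.TT_shift {N : ℕ} {z : ℤ → ℝ} (h : Config N z) (j m : ℤ) :
    TT N (j + m * N) z = TT N j z := by
  unfold TT
  congr 1
  refine Set.image_congr fun s _ => ?_
  rw [show j + m * N + 1 = (j + 1) + m * N by ring, h.per_mul, h.per_mul]
  rw [← PP_add_int N z (z j + s * (z (j + 1) - z j)) m]
  congr 1; ring

lemma TT_translate {N : ℕ} {z : ℤ → ℝ} (c : ℝ) (j : ℤ) :
    TT N j (fun i => z i + c) = TT N j z := by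
  unfold TT
  congr 1
  refine Set.image_congr fun s _ => ?_
  rw [← PP_translate N z _ c]
  congr 1; ring

lemma Config.translate {N : ℕ} {z : ℤ → ℝ} (h : Config N z) (c : ℝ) :
    Config N (fun i => z i + c) :=
  ⟨fun _ _ hij => by simpa using h.mono hij, fun j => by simp only [h.per]; ring⟩

lemma pair_lt {x y e : ℝ} (hy : e ≤ y) (hx : x + e ≤ 2 * π) (he : 0 < e) (hxy : y ≤ x) :
    |2 * Real.sin ((x + e) / 2)| * |2 * Real.sin ((y - e) / 2)|
      < |2 * Real.sin (x / 2)| * |2 * Real.sin (y / 2)| := by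
  have hs : ∀ u, 0 ≤ u → u ≤ 2 * π → |2 * Real.sin (u / 2)| = 2 * Real.sin (u / 2) := by
    intro u h0 h1
    rw [abs_of_nonneg]
    have := Real.sin_nonneg_of_nonneg_of_le_pi (x := u / 2) (by linarith) (by linarith)
    linarith
  rw [hs _ (by linarith) hx, hs _ (by linarith) (by linarith), hs _ (by linarith) (by linarith),
    hs _ (by linarith) (by linarith)]
  have key : ∀ u v : ℝ, 2 * Real.sin (u / 2) * (2 * Real.sin (v / 2))
      = 2 * (Real.cos ((u - v) / 2) - Real.cos ((u + v) / 2)) := by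
    intro u v
    rw [show (u - v) / 2 = u / 2 - v / 2 by ring, show (u + v) / 2 = u / 2 + v / 2 by ring,
      Real.cos_sub, Real.cos_add]; ring
  rw [key, key]
  have := Real.cos_lt_cos_of_nonneg_of_le_pi (x := (x - y) / 2) (y := (x + e - (y - e)) / 2)
    (by linarith) (by linarith) (by linarith)
  rw [show x + e + (y - e) = x + y by ring]
  linarith

open Classical in
/-- perturbed configuration -/
noncomputable def pert (N : ℕ) (a b : ℤ) (z : ℤ → ℝ) (e : ℝ) (j : ℤ) : ℝ :=
  z j - (if (N:ℤ) ∣ j - a then e else 0) + (if (N:ℤ) ∣ j - b then e else 0)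

lemma continuous_pert (N : ℕ) (a b : ℤ) (z : ℤ → ℝ) : Continuous (pert N a b z) := by
  refine continuous_pi fun j => ?_
  unfold pert
  split_ifs <;> fun_prop

lemma pert_zero (N : ℕ) (a b : ℤ) (z : ℤ → ℝ) : pert N a b z 0 = z := by
  funext j; simp [pert]

lemma dvd_sub_of_rep {N : ℕ} {r a m : ℤ} (h : a = r + m * N) (j : ℤ) :
    (N:ℤ) ∣ j - a ↔ (N:ℤ) ∣ j - r := by
  rw [h, show j - (r + m * N) = (j - r) - m * N by ring]
  exact dvd_sub_left (Dvd.intro_left m rfl)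

lemma eq_of_dvd_window {N : ℕ} {i j : ℤ} (h : (N:ℤ) ∣ i - j) (h1 : i - j < N) (h2 : j - i < N) :
    i = j := by
  have := Int.eq_zero_of_abs_lt_dvd h (abs_lt.2 ⟨by omega, h1⟩)
  omega

lemma Config.pert_config {N : ℕ} {z : ℤ → ℝ} (h : Config N z) {a b : ℤ}
    {e : ℝ} (he : 0 < e) (h1 : 2 * e ≤ z a - z (a - 1))
    (h2 : 2 * e ≤ z (b + 1) - z b) : Config N (pert N a b z e) := by
  constructor
  · refine monotone_int_of_le_succ fun j => ?_
    have hj := h.mono (show j ≤ j + 1 by omega)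
    have hA : (N:ℤ) ∣ j + 1 - a → 2 * e ≤ z (j + 1) - z j := by
      rintro ⟨m, hm⟩
      rw [show j + 1 = a + m * N by linarith, show j = (a - 1) + m * N by linarith,
        h.per_mul, h.per_mul]; linarith
    have hB : (N:ℤ) ∣ j - b → 2 * e ≤ z (j + 1) - z j := by
      rintro ⟨m, hm⟩
      rw [show j + 1 = (b + 1) + m * N by linarith, show j = b + m * N by linarith,
        h.per_mul, h.per_mul]; linarith
    unfold pert
    split_ifs <;> simp_all <;> linarith
  · intro j
    unfold pert
    have e1 : ∀ c : ℤ, (N:ℤ) ∣ j + N - c ↔ (N:ℤ) ∣ j - c := fun c => by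
      rw [show j + N - c = (j - c) + N by ring]; simp
    simp only [e1, h.per]; ring

lemma Config.PP_pert {N : ℕ} (hN : 0 < N) {z : ℤ → ℝ} (h : Config N z) {a b : ℤ} (hab : a < b)
    (hba : b < a + N) {e : ℝ} (he : 0 < e) 
    (hz' : Config N (pert N a b z e)) {t : ℝ} (ht1 : z b + e ≤ t) (ht2 : t ≤ z a + 2 * π - e) :
    PP N (pert N a b z e) t = 0 ∨ PP N (pert N a b z e) t < PP N z t := by
  obtain ⟨r, hr, m, hm⟩ := exists_rep hN a
  obtain ⟨q, hq, n, hn⟩ := exists_rep hN b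
  have hnab : ¬ (N:ℤ) ∣ a - b := fun hd => by
    have := eq_of_dvd_window hd (by omega) (by omega); omega
  have hrq : q ≠ r := by
    rintro rfl
    apply hnab
    exact ⟨m - n, by rw [hm, hn]; ring⟩
  have hq' : q ∈ (Finset.Ioc (0:ℤ) N).erase r := Finset.mem_erase.2 ⟨hrq, hq⟩
  have split : ∀ w : ℤ → ℝ, Config N w → PP N w t =
      (|2 * Real.sin ((t - w a) / 2)| * |2 * Real.sin ((t - w b) / 2)|) *
      ∏ k ∈ ((Finset.Ioc (0:ℤ) N).erase r).erase q, |2 * Real.sin ((t - w k) / 2)| := by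
    intro w hw
    unfold PP
    rw [← Finset.mul_prod_erase _ _ hr, ← Finset.mul_prod_erase _ _ hq', mul_assoc]
    rw [hm, hn, hw.factor, hw.factor]
  have rest : ∏ k ∈ ((Finset.Ioc (0:ℤ) N).erase r).erase q,
        |2 * Real.sin ((t - pert N a b z e k) / 2)|
      = ∏ k ∈ ((Finset.Ioc (0:ℤ) N).erase r).erase q, |2 * Real.sin ((t - z k) / 2)| := by
    refine Finset.prod_congr rfl fun k hk => ?_
    simp only [Finset.mem_erase, Finset.mem_Ioc] at hk hr hq
    have n1 : ¬ (N:ℤ) ∣ k - a := fun hd => by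
      rw [dvd_sub_of_rep hm] at hd
      exact hk.2.1 (eq_of_dvd_window hd (by omega) (by omega))
    have n2 : ¬ (N:ℤ) ∣ k - b := fun hd => by
      rw [dvd_sub_of_rep hn] at hd
      exact hk.1 (eq_of_dvd_window hd (by omega) (by omega))
    simp [pert, n1, n2]
  have pa : pert N a b z e a = z a - e := by simp [pert, hnab]
  have pb : pert N a b z e b = z b + e := by
    have : ¬ (N:ℤ) ∣ b - a := fun hd => hnab (by rw [← neg_sub]; exact hd.neg_right)
    simp [pert, this]
  rw [split _ hz', split _ h, rest, pa, pb]
  set R := ∏ k ∈ ((Finset.Ioc (0:ℤ) N).erase r).erase q, |2 * Real.sin ((t - z k) / 2)|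
  have hR : 0 ≤ R := Finset.prod_nonneg fun _ _ => abs_nonneg _
  rcases hR.eq_or_lt with h0 | h0
  · left; rw [← h0, mul_zero]
  · right
    refine mul_lt_mul_of_pos_right ?_ h0
    have := h.mono hab.le
    have := pair_lt (x := t - z a) (y := t - z b) (e := e) (by linarith) (by linarith) he
      (by linarith)
    rw [show t - (z a - e) = t - z a + e by ring, show t - (z b + e) = t - z b - e by ring]
    exact this

end JW

namespace JW

lemma Config.arc_pos {N : ℕ} (hN : 0 < N) {z : ℤ → ℝ} (h : Config N z) {j : ℤ}
    (hT : 0 < TT N j z) : z j < z (j + 1) := by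
  have h1 := h.mono (show j ≤ j + 1 by omega)
  obtain ⟨t, ht, h2⟩ := TT_attained (N := N) h1
  refine lt_of_le_of_ne h1 fun h3 => ?_
  have : t = z j := by linarith [ht.1, ht.2]
  rw [this, h.PP_self hN] at h2
  linarith

lemma Config.exists_TT_pos {N : ℕ} {z : ℤ → ℝ} (h : Config N z) :
    ∃ j : ℤ, 0 < TT N j z := by
  by_contra! hcon
  have hle : ∀ j, z (j + 1) ≤ z j := by
    intro j
    by_contra! hlt
    have := h.PP_pos (t := (z j + z (j + 1)) / 2) (j := j) ⟨by linarith, by linarith⟩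
    have h2 := le_TT (N := N) (j := j) (z := z) (t := (z j + z (j + 1)) / 2)
      ⟨by linarith, by linarith⟩
    linarith [hcon j]
  have hanti : Antitone z := antitone_int_of_succ_le hle
  have h1 := h.per 0
  have h2 := hanti (show (0:ℤ) ≤ 0 + N by omega)
  linarith [Real.pi_pos]

/-- the compact set of normalised configurations -/
def CS (N : ℕ) : Set (ℤ → ℝ) := {z | Config N z ∧ z 0 = 0}

lemma isCompact_CS {N : ℕ} (hN : 0 < N) : IsCompact (CS N) := by
  have hsub : CS N ⊆ Set.univ.pi (fun j : ℤ => Set.Icc (-(|j| : ℝ) * (2 * π)) ((|j| : ℝ) * (2 * π))) := by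
    rintro z ⟨hz, h0⟩ j -
    have e1 := hz.per_mul 0 |j|
    have e2 := hz.per_mul 0 (-|j|)
    have hN' : (1:ℤ) ≤ N := by omega
    have b1 : |j| ≤ |j| * N := le_mul_of_one_le_right (abs_nonneg j) hN'
    have m1 := hz.mono (show j ≤ 0 + |j| * N by linarith [le_abs_self j])
    have m2 := hz.mono (show 0 + -|j| * N ≤ j by linarith [neg_abs_le j])
    rw [e1, h0] at m1
    rw [e2, h0] at m2
    push_cast at m1 m2
    exact ⟨by linarith, by linarith⟩
  refine (isCompact_univ_pi fun j => isCompact_Icc).of_isClosed_subset ?_ hsub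
  have : CS N = {z | ∀ i j : ℤ, i ≤ j → z i ≤ z j} ∩ {z | ∀ j : ℤ, z (j + N) = z j + 2 * π}
      ∩ {z | z 0 = 0} := by
    ext z; constructor
    · rintro ⟨hz, h0⟩; exact ⟨⟨fun i j hij => hz.mono hij, hz.per⟩, h0⟩
    · rintro ⟨⟨h1, h2⟩, h0⟩; exact ⟨⟨fun i j hij => h1 i j hij, h2⟩, h0⟩
  rw [this]
  refine (IsClosed.inter ?_ ?_).inter ?_
  · simp only [Set.ofPred_forall]
    exact isClosed_iInter fun i => isClosed_iInter fun j => isClosed_iInter fun _ =>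
      isClosed_le (continuous_apply i) (continuous_apply j)
  · simp only [Set.ofPred_forall]
    exact isClosed_iInter fun j => 
      isClosed_eq (continuous_apply _) ((continuous_apply j).add continuous_const)
  · exact isClosed_eq (continuous_apply _) continuous_const

lemma CS_nonempty {N : ℕ} (hN : 0 < N) : (CS N).Nonempty := by
  have : (0:ℝ) < N := by exact_mod_cast hN
  refine ⟨fun j => j * (2 * π / N), ⟨fun i j hij => ?_, fun j => ?_⟩, by simp⟩
  · have : (i:ℝ) ≤ j := by exact_mod_cast hij
    have h2 : 0 ≤ 2 * π / N := by positivity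
    exact mul_le_mul_of_nonneg_right this h2
  · push_cast; field_simp

theorem finite_main {N : ℕ} (hN : 0 < N) (w : ℤ → ℝ) (hw : ∀ j, 0 < w j)
    (hwp : ∀ j m : ℤ, w (j + m * N) = w j) :
    ∃ z : ℤ → ℝ, Config N z ∧ z 0 = 0 ∧ ∃ S > 0, ∀ j, w j * TT N j z = S := by
  have hne : (Finset.Ioc (0:ℤ) N).Nonempty := ⟨1, by simp; omega⟩
  let F : (ℤ → ℝ) → ℝ := fun z => (Finset.Ioc (0:ℤ) N).sup' hne (fun j => w j * TT N j z)
  have hF : Continuous F := Continuous.finset_sup'_apply hne fun j _ =>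
    continuous_const.mul (continuous_TT N j)
  have hsh : ∀ {z : ℤ → ℝ}, Config N z → ∀ j m : ℤ, w (j + m * N) * TT N (j + m * N) z
      = w j * TT N j z := fun hz j m => by rw [hwp, hz.TT_shift]
  have hleF : ∀ {z : ℤ → ℝ}, Config N z → ∀ j : ℤ, w j * TT N j z ≤ F z := by
    intro z hz j
    obtain ⟨r, hr, m, hm⟩ := exists_rep hN j
    rw [hm, hsh hz]
    exact Finset.le_sup' (fun j => w j * TT N j z) hr
  obtain ⟨z, hzC, hmin⟩ := (isCompact_CS hN).exists_isMinOn (CS_nonempty hN) hF.continuousOn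
  obtain ⟨hz, hz0⟩ := hzC
  have hminall : ∀ z', Config N z' → F z ≤ F z' := by
    intro z' hz'
    have : F z' = F (fun j => z' j + (- z' 0)) := by
      simp only [F, TT_translate]
    rw [this]
    exact hmin ⟨hz'.translate _, by simp⟩
  set S := F z with hS
  have hSpos : 0 < S := by
    obtain ⟨j, hj⟩ := hz.exists_TT_pos
    exact lt_of_lt_of_le (mul_pos (hw j) hj) (hleF hz j)
  refine ⟨z, hz, hz0, S, hSpos, ?_⟩
  by_contra! hcon
  obtain ⟨j0, hj0⟩ := hcon
  have hj0 : w j0 * TT N j0 z < S := lt_of_le_of_ne (hleF hz j0) hj0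
  obtain ⟨i0, hi0, hi0S⟩ := Finset.exists_mem_eq_sup' hne (fun j => w j * TT N j z)
  have hi0S : w i0 * TT N i0 z = S := hi0S.symm
  -- good index just below / above j0
  have hN' : (0:ℤ) < N := by omega
  obtain ⟨a', ⟨ha1, ha2⟩, ha3⟩ := Int.exists_greatest_of_bdd
    (P := fun k => k < j0 ∧ w k * TT N k z = S) ⟨j0, fun k hk => hk.1.le⟩
    (by
      obtain ⟨r, h1, h2, m, hm⟩ := exists_rep_from hN (j0 - N) i0
      exact ⟨r, by omega, by rw [← hsh hz r m, ← hm]; exact hi0S⟩)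
  obtain ⟨b, ⟨hb1, hb2⟩, hb3⟩ := Int.exists_least_of_bdd
    (P := fun k => j0 < k ∧ w k * TT N k z = S) ⟨j0, fun k hk => hk.1.le⟩
    (by
      obtain ⟨r, h1, h2, m, hm⟩ := exists_rep_from hN (j0 + 1) i0
      exact ⟨r, by omega, by rw [← hsh hz r m, ← hm]; exact hi0S⟩)
  have hja : j0 < a' + N := by
    by_contra! hc
    rcases hc.eq_or_lt with hc | hc
    · have := hsh hz a' 1
      rw [one_mul, hc, ha2] at this; linarith
    · have := ha3 (a' + N) ⟨hc, by have := hsh hz a' 1; rw [one_mul] at this; rw [this, ha2]⟩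
      omega
  have hba : b ≤ a' + N := hb3 _ ⟨hja, by have := hsh hz a' 1; rw [one_mul] at this; rw [this, ha2]⟩
  obtain ⟨a, rfl⟩ : ∃ a, a' = a - 1 := ⟨a' + 1, by ring⟩
  have hTpos : ∀ k, w k * TT N k z = S → 0 < TT N k z := fun k hk => by
    by_contra! h
    have := mul_nonpos_of_nonneg_of_nonpos (hw k).le h
    linarith
  have gA : z (a - 1) < z a := by
    have := hz.arc_pos hN (hTpos _ ha2)
    rwa [sub_add_cancel] at this
  have gB : z b < z (b + 1) := hz.arc_pos hN (hTpos _ hb2)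
  have hrun : ∀ k, a ≤ k → k < b → w k * TT N k z < S := by
    intro k hk1 hk2
    refine lt_of_le_of_ne (hleF hz k) fun hk => ?_
    rcases lt_trichotomy k j0 with h | h | h
    · have := ha3 k ⟨h, hk⟩; omega
    · rw [h] at hk; linarith
    · have := hb3 k ⟨h, hk⟩; omega
  -- small epsilon
  have hev : ∀ᶠ e in nhdsWithin (0:ℝ) (Set.Ioi 0), ∀ k ∈ Finset.Ico a b,
      w k * TT N k (pert N a b z e) < S := by
    rw [Filter.eventually_all_finset]
    intro k hk
    rw [Finset.mem_Ico] at hk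
    have hc : Continuous (fun e => w k * TT N k (pert N a b z e)) :=
      continuous_const.mul ((continuous_TT N k).comp (continuous_pert N a b z))
    have : ∀ᶠ e in nhds (0:ℝ), w k * TT N k (pert N a b z e) < S := by
      refine hc.continuousAt.eventually_lt continuousAt_const ?_
      simp only [pert_zero]; exact hrun k hk.1 hk.2
    exact this.filter_mono nhdsWithin_le_nhds
  have hev2 : ∀ᶠ e in nhdsWithin (0:ℝ) (Set.Ioi 0), 2 * e < min (z a - z (a - 1)) (z (b + 1) - z b) := by
    have : ∀ᶠ e in nhds (0:ℝ), 2 * e < min (z a - z (a - 1)) (z (b + 1) - z b) := by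
      refine ContinuousAt.eventually_lt (by fun_prop) continuousAt_const ?_
      simp only [mul_zero, lt_min_iff]; constructor <;> linarith
    exact this.filter_mono nhdsWithin_le_nhds
  obtain ⟨e, ⟨he1, he2⟩, he⟩ := ((hev.and hev2).and self_mem_nhdsWithin).exists
  have he : 0 < e := he
  rw [lt_min_iff] at he2
  have hab : a < b := by omega
  have hbaN : b < a + N := by omega
  have hz' : Config N (pert N a b z e) := hz.pert_config he he2.1.le he2.2.le
  refine absurd (hminall _ hz') (not_le.2 ?_)
  refine (Finset.sup'_lt_iff hne).2 fun j _ => ?_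
  obtain ⟨r, hr1, hr2, m, hm⟩ := exists_rep_from hN a j
  rw [hm, hsh hz']
  rcases lt_or_ge r b with hrb | hrb
  · exact he1 r (Finset.mem_Ico.2 ⟨hr1, hrb⟩)
  obtain ⟨t, ht, hT⟩ := TT_attained (N := N) (hz'.mono (show r ≤ r + 1 by omega))
  have nd : ∀ i j : ℤ, i - j < N → j - i < N → i ≠ j → ¬ (N:ℤ) ∣ i - j :=
    fun i j h1 h2 h3 hd => h3 (eq_of_dvd_window hd h1 h2)
  have pb : pert N a b z e b = z b + e := by
    simp [pert, nd b a (by omega) (by omega) (by omega)]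
  have pa : pert N a b z e (a + N) = z a + 2 * π - e := by
    have h1 : ¬ (N:ℤ) ∣ a + N - b := nd _ _ (by omega) (by omega) (by omega)
    simp [pert, h1, hz.per]
  have l1 := hz'.mono hrb
  have l2 := hz'.mono (show r + 1 ≤ a + N by omega)
  rw [pb] at l1
  rw [pa] at l2
  have l3 : z r ≤ pert N a b z e r := by
    have h1 : ¬ (N:ℤ) ∣ r - a := nd _ _ (by omega) (by omega) (by omega)
    simp only [pert, h1, if_false]
    split_ifs <;> linarith
  have l4 : pert N a b z e (r + 1) ≤ z (r + 1) := by
    have h1 : ¬ (N:ℤ) ∣ r + 1 - b := nd _ _ (by omega) (by omega) (by omega)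
    simp only [pert, h1, if_false]
    split_ifs <;> linarith
  have hle : PP N z t ≤ TT N r z := le_TT ⟨by linarith [ht.1], by linarith [ht.2]⟩
  rw [← hT]
  rcases hz.PP_pert hN hab hbaN he hz' (t := t) (by linarith [ht.1]) (by linarith [ht.2]) with h | h
  · rw [h, mul_zero]; exact hSpos
  · calc w r * PP N (pert N a b z e) t < w r * TT N r z :=
          mul_lt_mul_of_pos_left (h.trans_le hle) (hw r)
      _ ≤ S := hleF hz r

end JW

namespace JW
open MeasureTheory

noncomputable def K (x : ℝ) : ℝ := -Real.log |2 * Real.sin (x / 2)|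

lemma K_shift (x : ℝ) (m : ℤ) : K (x + m * (2 * π)) = K x := by
  unfold K; rw [abs_sin_shift]

lemma K_periodic : Function.Periodic K (2 * π) := fun x => by
  have := K_shift x 1
  simpa using this

lemma K_lower (x : ℝ) : -Real.log 2 ≤ K x := by
  unfold K
  rw [neg_le_neg_iff]
  rcases eq_or_ne |2 * Real.sin (x / 2)| 0 with h | h
  · rw [h, Real.log_zero]; exact Real.log_nonneg (by norm_num)
  · refine Real.log_le_log (lt_of_le_of_ne (abs_nonneg _) h.symm) ?_
    rw [abs_mul]
    have := Real.abs_sin_le_one (x / 2)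
    norm_num; linarith

lemma K_integrable (a b : ℝ) : IntervalIntegrable K volume a b := by
  have h : IntervalIntegrable (fun x : ℝ => Real.log ‖2 * Real.sin (x / 2)‖) volume a b := by
    refine MeromorphicOn.intervalIntegrable_log_norm ?_
    intro x _
    have : AnalyticAt ℝ (fun x : ℝ => 2 * Real.sin (x / 2)) x := by fun_prop
    exact this.meromorphicAt
  exact h.neg

lemma sin_half_pos {x : ℝ} (h : x ∈ Set.Ioo 0 (2 * π)) : 0 < Real.sin (x / 2) :=
  Real.sin_pos_of_pos_of_lt_pi (by linarith [h.1]) (by linarith [h.2])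

lemma K_eq {x : ℝ} (_ : x ∈ Set.Ioo 0 (2 * π)) : K x = -Real.log (2 * Real.sin (x / 2)) := by
  unfold K; rw [Real.log_abs]

lemma K_convex : ConvexOn ℝ (Set.Ioo 0 (2 * π)) K := by
  refine ⟨convex_Ioo _ _, ?_⟩
  intro x hx y hy a b ha hb hab
  have hm : a • x + b • y ∈ Set.Ioo 0 (2 * π) := convex_Ioo _ _ hx hy ha hb hab
  rw [K_eq hx, K_eq hy, K_eq hm]
  have px := sin_half_pos hx
  have py := sin_half_pos hy
  have hs := strictConcaveOn_sin_Icc.concaveOn.2 (x := x / 2) ⟨by linarith [hx.1], by linarith [hx.2]⟩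
    (y := y / 2) ⟨by linarith [hy.1], by linarith [hy.2]⟩ ha hb hab
  have hl := strictConcaveOn_log_Ioi.concaveOn.2 (x := 2 * Real.sin (x / 2))
    (by simpa using px) (y := 2 * Real.sin (y / 2)) (by simpa using py) ha hb hab
  simp only [smul_eq_mul] at *
  have hpos : 0 < a * (2 * Real.sin (x / 2)) + b * (2 * Real.sin (y / 2)) := by
    rcases ha.eq_or_lt with h | h
    · have : b = 1 := by linarith
      rw [← h, this]; linarith
    · have := mul_pos h px
      have := mul_nonneg hb py.le
      linarith
  have : Real.log (a * (2 * Real.sin (x / 2)) + b * (2 * Real.sin (y / 2)))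
      ≤ Real.log (2 * Real.sin ((a * x + b * y) / 2)) := by
    refine Real.log_le_log hpos ?_
    rw [show (a * x + b * y) / 2 = a * (x / 2) + b * (y / 2) by ring]
    linarith
  linarith

/-- near the singularity `K` is large -/
lemma K_near {x d : ℝ} (hx0 : x ≠ 0) (hx : |x| ≤ d) (hd : d ≤ π) : K d ≤ K x := by
  have hxp : 0 < |x| := abs_pos.2 hx0
  have e : |2 * Real.sin (x / 2)| = 2 * Real.sin (|x| / 2) := by
    have h := sin_half_pos (x := |x|) ⟨hxp, by linarith [Real.pi_pos]⟩
    rcases abs_cases x with ⟨h1, _⟩ | ⟨h1, _⟩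
    · rw [h1] at h ⊢; rw [abs_of_pos (by linarith)]
    · rw [h1] at h ⊢
      rw [show -x / 2 = -(x / 2) by ring, Real.sin_neg] at h ⊢
      rw [abs_of_neg (by linarith)]; ring
  have h1 := sin_half_pos (x := |x|) ⟨hxp, by linarith [Real.pi_pos]⟩
  rw [K_eq (x := d) ⟨by linarith, by linarith [Real.pi_pos]⟩]
  unfold K
  rw [e, neg_le_neg_iff]
  refine Real.log_le_log (by linarith) ?_
  have := Real.sin_le_sin_of_le_of_le_pi_div_two (x := |x| / 2) (y := d / 2) (by linarith)
    (by linarith) (by linarith)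
  linarith

lemma second_diff {x s : ℝ} (hs : 0 < s) (h1 : s < x) (h2 : x < 2 * π - s) :
    -Real.log (1 - Real.sin (s / 2) ^ 2) ≤ K (x + s) + K (x - s) - 2 * K x := by
  have hx : x ∈ Set.Ioo 0 (2 * π) := ⟨by linarith, by linarith⟩
  have hp : x + s ∈ Set.Ioo 0 (2 * π) := ⟨by linarith, by linarith⟩
  have hm : x - s ∈ Set.Ioo 0 (2 * π) := ⟨by linarith, by linarith⟩
  have px := sin_half_pos hx
  have pp := sin_half_pos hp
  have pm := sin_half_pos hm
  rw [K_eq hx, K_eq hp, K_eq hm]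
  rw [Real.log_mul (by norm_num) px.ne', Real.log_mul (by norm_num) pp.ne',
    Real.log_mul (by norm_num) pm.ne']
  have id : Real.sin ((x + s) / 2) * Real.sin ((x - s) / 2)
      = Real.sin (x / 2) ^ 2 - Real.sin (s / 2) ^ 2 := by
    rw [show (x + s) / 2 = x / 2 + s / 2 by ring, show (x - s) / 2 = x / 2 - s / 2 by ring,
      Real.sin_add, Real.sin_sub]
    have h1 := Real.sin_sq_add_cos_sq (x / 2)
    have h2 := Real.sin_sq_add_cos_sq (s / 2)
    have h3 : Real.cos (x / 2) ^ 2 = 1 - Real.sin (x / 2) ^ 2 := by linarith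
    have h4 : Real.cos (s / 2) ^ 2 = 1 - Real.sin (s / 2) ^ 2 := by linarith
    calc _ = Real.sin (x / 2) ^ 2 * Real.cos (s / 2) ^ 2
          - Real.cos (x / 2) ^ 2 * Real.sin (s / 2) ^ 2 := by ring
      _ = _ := by rw [h3, h4]; ring
  have hprod := mul_pos pp pm
  have hlog : Real.log (Real.sin ((x + s) / 2)) + Real.log (Real.sin ((x - s) / 2))
      = Real.log (Real.sin (x / 2) ^ 2 - Real.sin (s / 2) ^ 2) := by
    rw [← Real.log_mul pp.ne' pm.ne', id]
  have hx2 : 0 < Real.sin (x / 2) ^ 2 := by positivity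
  have hq : Real.sin (x / 2) ^ 2 ≤ 1 := Real.sin_sq_le_one _
  have hle : Real.log (Real.sin (x / 2) ^ 2 - Real.sin (s / 2) ^ 2)
      ≤ Real.log (Real.sin (x / 2) ^ 2 * (1 - Real.sin (s / 2) ^ 2)) := by
    rw [id] at hprod
    refine Real.log_le_log hprod ?_
    nlinarith [sq_nonneg (Real.sin (s / 2))]
  have h1s : 0 < 1 - Real.sin (s / 2) ^ 2 := by
    rw [id] at hprod; linarith
  rw [Real.log_mul hx2.ne' h1s.ne', Real.log_pow] at hle
  push_cast at hle
  linarith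

lemma second_diff_pos {s : ℝ} (hs : 0 < s) (h2 : s < π) :
    0 < -Real.log (1 - Real.sin (s / 2) ^ 2) := by
  have := sin_half_pos (x := s) ⟨hs, by linarith⟩
  have h1 : Real.sin (s / 2) ^ 2 > 0 := by positivity
  have hc : 0 < Real.cos (s / 2) := Real.cos_pos_of_mem_Ioo ⟨by linarith, by linarith⟩
  have h3 := Real.sin_sq_add_cos_sq (s / 2)
  have h4 : 0 < Real.cos (s / 2) ^ 2 := by positivity
  have := Real.log_neg (x := 1 - Real.sin (s / 2) ^ 2) (by linarith) (by linarith)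
  linarith

lemma K_tendsto : Filter.Tendsto K (nhdsWithin 0 (Set.Ioi 0)) Filter.atTop := by
  unfold K
  refine Filter.tendsto_neg_atBot_atTop.comp ?_
  refine Real.tendsto_log_nhdsNE_zero.comp ?_
  refine tendsto_nhdsWithin_iff.2 ⟨?_, ?_⟩
  · have : Continuous (fun x : ℝ => |2 * Real.sin (x / 2)|) := by fun_prop
    have := this.tendsto 0
    simp only [zero_div, Real.sin_zero, mul_zero, abs_zero] at this
    exact this.mono_left nhdsWithin_le_nhds
  · filter_upwards [Ioo_mem_nhdsGT (show (0:ℝ) < 2 * π by positivity)] with x hx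
    have := sin_half_pos hx
    simp; exact this.ne'

/-- truncated kernel -/
noncomputable def Kt (A x : ℝ) : ℝ := max (K x + Real.log 2 - A) 0

lemma K_measurable : Measurable K := by unfold K; fun_prop

lemma Kt_integrable (A a b : ℝ) : IntervalIntegrable (Kt A) volume a b := by
  have h : IntervalIntegrable (fun x => K x + Real.log 2 - A) volume a b :=
    ((K_integrable a b).add intervalIntegrable_const).sub intervalIntegrable_const
  unfold Kt
  exact ⟨h.1.pos_part, h.2.pos_part⟩

lemma Kt_periodic (A : ℝ) : Function.Periodic (Kt A) (2 * π) := fun x => by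
  unfold Kt; rw [K_periodic x]

lemma Kt_tendsto : Filter.Tendsto (fun n : ℕ => ∫ x in (0:ℝ)..(2 * π), Kt n x)
    Filter.atTop (nhds 0) := by
  have : (0:ℝ) = ∫ x in (0:ℝ)..(2 * π), (0:ℝ) := by simp
  suffices h : Filter.Tendsto (fun n : ℕ => ∫ x in (0:ℝ)..(2 * π), Kt n x)
    Filter.atTop (nhds (∫ x in (0:ℝ)..(2 * π), (0:ℝ))) by rwa [← this] at h
  refine intervalIntegral.tendsto_integral_filter_of_dominated_convergence (l := Filter.atTop)
    (F := fun (n : ℕ) x => Kt n x) (fun x => |K x + Real.log 2|) ?_ ?_ ?_ ?_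
  · refine Filter.Eventually.of_forall fun n => ?_
    have := K_measurable
    unfold Kt
    exact Measurable.aestronglyMeasurable (by fun_prop)
  · refine Filter.Eventually.of_forall fun n => Filter.Eventually.of_forall fun x _ => ?_
    unfold Kt
    rw [Real.norm_eq_abs, abs_of_nonneg (le_max_right _ _)]
    refine max_le ?_ (abs_nonneg _)
    have : (0:ℝ) ≤ n := by positivity
    linarith [le_abs_self (K x + Real.log 2)]
  · exact ((K_integrable _ _).add intervalIntegrable_const).abs
  · refine Filter.Eventually.of_forall fun x _ => ?_
    refine tendsto_const_nhds.congr' ?_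
    obtain ⟨n0, hn0⟩ := exists_nat_ge (K x + Real.log 2)
    filter_upwards [Filter.eventually_ge_atTop n0] with n hn
    have : (n0:ℝ) ≤ n := by exact_mod_cast hn
    unfold Kt
    rw [max_eq_right]; linarith

lemma integral_exp (j : ℕ) : ∫ t in (0:ℝ)..(2 * π), Complex.exp (-(j:ℂ) * Complex.I * t)
    = if j = 0 then 2 * π else 0 := by
  split_ifs with h
  · subst h; simp
  · have hj : -(j:ℂ) * Complex.I ≠ 0 := by simp [h]
    rw [integral_exp_mul_complex hj]
    have : Complex.exp (-(j:ℂ) * Complex.I * ((2 * π : ℝ) : ℂ)) = 1 := by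
      rw [Complex.exp_eq_one_iff]; exact ⟨-j, by push_cast; ring⟩
    rw [this]; simp

lemma exp_sub_one (t : ℝ) : Complex.exp (-Complex.I * t) - 1
    = -2 * Complex.I * Complex.exp (-Complex.I * (t / 2)) * (Real.sin (t / 2) : ℂ) := by
  have e1 : Complex.exp (-Complex.I * t) = Complex.exp (-Complex.I * (t / 2)) ^ 2 := by
    rw [← Complex.exp_nat_mul]; congr 1; push_cast; ring
  have e2 : ((Real.sin (t / 2) : ℝ) : ℂ) = (Complex.exp (-Complex.I * (t/2)) - 
      (Complex.exp (-Complex.I * (t/2)))⁻¹) * Complex.I / 2 := by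
    rw [← Complex.exp_neg]
    push_cast
    rw [Complex.sin]
    congr 4 <;> ring
  rw [e1, e2]
  have := Complex.exp_ne_zero (-Complex.I * (t / 2))
  field_simp
  rw [Complex.I_sq]; ring

lemma exp_add_one (t : ℝ) : 1 + Complex.exp (-Complex.I * t)
    = 2 * Complex.exp (-Complex.I * (t / 2)) * (Real.cos (t / 2) : ℂ) := by
  have e1 : Complex.exp (-Complex.I * t) = Complex.exp (-Complex.I * (t / 2)) ^ 2 := by
    rw [← Complex.exp_nat_mul]; congr 1; push_cast; ring
  have e2 : ((Real.cos (t / 2) : ℝ) : ℂ) = (Complex.exp (-Complex.I * (t/2)) + 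
      (Complex.exp (-Complex.I * (t/2)))⁻¹) / 2 := by
    rw [← Complex.exp_neg]
    push_cast
    rw [Complex.cos, add_comm]
    congr 3 <;> ring
  rw [e1, e2]
  have := Complex.exp_ne_zero (-Complex.I * (t / 2))
  field_simp
  ring

lemma K_fourier (k : ℕ) (hk : 0 < k) :
    ∫ t in (0:ℝ)..(2 * π), (K t : ℂ) * Complex.exp (-(k:ℂ) * Complex.I * t) = π / k := by
  set Sg : ℝ → ℂ := fun t => ∑ j ∈ Finset.range k, Complex.exp (-(j:ℂ) * Complex.I * t) with hSg
  have hgeom : ∀ t : ℝ, Complex.exp (-(k:ℂ) * Complex.I * t) - 1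
      = (Complex.exp (-Complex.I * t) - 1) * Sg t := by
    intro t
    have : ∀ j : ℕ, Complex.exp (-(j:ℂ) * Complex.I * t) = Complex.exp (-Complex.I * t) ^ j := by
      intro j; rw [← Complex.exp_nat_mul]; congr 1; ring
    simp only [hSg, this]
    rw [mul_comm (Complex.exp (-Complex.I * t) - 1), geom_sum_mul]
  set G : ℝ → ℂ := fun t => (K t : ℂ) * (Complex.exp (-(k:ℂ) * Complex.I * t) - 1) with hG
  set D : ℝ → ℂ := fun t => Complex.I / 2 * ((1 + Complex.exp (-Complex.I * t)) * Sg t)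
    - k * Complex.I * ((K t : ℂ) * Complex.exp (-(k:ℂ) * Complex.I * t)) with hD
  have hSgc : Continuous Sg := by simp only [hSg]; fun_prop
  have hGc : Continuous G := by
    have : G = fun t => (((2 * Real.sin (t / 2)) * Real.log (2 * Real.sin (t / 2)) : ℝ) : ℂ) *
        (Complex.I * Complex.exp (-Complex.I * (t / 2)) * Sg t) := by
      funext t
      simp only [hG]
      rw [hgeom, exp_sub_one]
      unfold K
      rw [Real.log_abs]
      push_cast; ring
    rw [this]
    have h1 : Continuous (fun t : ℝ => (2 * Real.sin (t / 2)) * Real.log (2 * Real.sin (t / 2))) :=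
      Real.continuous_mul_log.comp (by fun_prop : Continuous fun t : ℝ => 2 * Real.sin (t / 2))
    have h2 := Complex.continuous_ofReal.comp h1
    refine Continuous.mul h2 ?_
    fun_prop
  have hKe : IntervalIntegrable (fun t : ℝ => (K t : ℂ) * Complex.exp (-(k:ℂ) * Complex.I * t))
      volume 0 (2 * π) := by
    refine IntervalIntegrable.mul_continuousOn ?_ (by fun_prop)
    have h := K_integrable 0 (2 * π)
    exact ⟨h.1.ofReal, h.2.ofReal⟩
  have hfirst : Continuous (fun t : ℝ => Complex.I / 2 * ((1 + Complex.exp (-Complex.I * t)) * Sg t)) := by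
    fun_prop
  have hder : ∀ t ∈ Set.Ioo (0:ℝ) (2 * π), HasDerivAt G (D t) t := by
    intro t ht
    have hs := sin_half_pos ht
    have h1 : HasDerivAt (fun x : ℝ => -Real.log (2 * Real.sin (x / 2)))
        (-((2 * (Real.cos (t / 2) * (1 / 2))) / (2 * Real.sin (t / 2)))) t := by
      have a1 : HasDerivAt (fun x : ℝ => x / 2) (1 / 2) t := (hasDerivAt_id t).div_const 2
      exact ((a1.sin.const_mul 2).log (by positivity)).neg
    have h1' : HasDerivAt K (-((2 * (Real.cos (t / 2) * (1 / 2))) / (2 * Real.sin (t / 2)))) t := by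
      have : K = fun x : ℝ => -Real.log (2 * Real.sin (x / 2)) := by
        funext x; unfold K; rw [Real.log_abs]
      rw [this]; exact h1
    have h2 : HasDerivAt (fun x : ℝ => Complex.exp (-(k:ℂ) * Complex.I * x) - 1)
        (Complex.exp (-(k:ℂ) * Complex.I * t) * (-(k:ℂ) * Complex.I * 1)) t := by
      have a0 : HasDerivAt (fun x : ℝ => (x : ℂ)) 1 t := Complex.ofRealCLM.hasDerivAt
      have a1 : HasDerivAt (fun x : ℝ => -(k:ℂ) * Complex.I * x) (-(k:ℂ) * Complex.I * 1) t := 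
        a0.const_mul _
      exact a1.cexp.sub_const 1
    have h3 := h1'.ofReal_comp.mul h2
    refine h3.congr_deriv ?_
    simp only [hD]
    rw [hgeom, exp_sub_one, exp_add_one]
    have hs' : ((Real.sin (t / 2) : ℝ) : ℂ) ≠ 0 := by exact_mod_cast hs.ne'
    push_cast at hs' ⊢
    field_simp
    ring
  have hint := intervalIntegral.integral_eq_sub_of_hasDerivAt_of_le (by positivity) hGc.continuousOn hder
    ((hfirst.intervalIntegrable _ _).sub (hKe.const_mul _))
  have hG0 : G 0 = 0 := by simp [hG]
  have hG1 : G (2 * π) = 0 := by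
    simp only [hG]
    have : Complex.exp (-(k:ℂ) * Complex.I * ((2 * π : ℝ) : ℂ)) = 1 := by
      rw [Complex.exp_eq_one_iff]; exact ⟨-k, by push_cast; ring⟩
    rw [this]; simp
  rw [hG0, hG1] at hint
  simp only [hD] at hint
  rw [intervalIntegral.integral_sub (hfirst.intervalIntegrable _ _) (hKe.const_mul _),
    intervalIntegral.integral_const_mul, intervalIntegral.integral_const_mul] at hint
  have hsum : ∫ t in (0:ℝ)..(2 * π), (1 + Complex.exp (-Complex.I * t)) * Sg t = 2 * π := by
    have : (fun t : ℝ => (1 + Complex.exp (-Complex.I * t)) * Sg t) = fun t : ℝ =>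
        ∑ j ∈ Finset.range k, (Complex.exp (-(j:ℂ) * Complex.I * t)
          + Complex.exp (-((j + 1 : ℕ):ℂ) * Complex.I * t)) := by
      funext t
      simp only [hSg]
      rw [Finset.mul_sum]
      refine Finset.sum_congr rfl fun j _ => ?_
      rw [add_mul, one_mul, ← Complex.exp_add]
      congr 2; push_cast; ring
    rw [this, intervalIntegral.integral_finsetSum]
    · have : ∀ j ∈ Finset.range k, ∫ t in (0:ℝ)..(2 * π), (Complex.exp (-(j:ℂ) * Complex.I * t)
          + Complex.exp (-((j + 1 : ℕ):ℂ) * Complex.I * t)) = if j = 0 then 2 * π else 0 := by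
        intro j _
        rw [intervalIntegral.integral_add, integral_exp, integral_exp]
        · simp
        · exact Continuous.intervalIntegrable (by fun_prop) _ _
        · exact Continuous.intervalIntegrable (by fun_prop) _ _
      rw [Finset.sum_congr rfl this]
      rw [← Complex.ofReal_sum, Finset.sum_ite_eq']; simp [hk]
    · intro j _
      exact Continuous.intervalIntegrable (by fun_prop) _ _
  rw [hsum] at hint
  have hk' : (k:ℂ) ≠ 0 := by exact_mod_cast hk.ne'
  rw [eq_div_iff hk']
  have hI := Complex.I_ne_zero
  have : Complex.I * ((∫ t in (0:ℝ)..(2 * π), (K t : ℂ) * Complex.exp (-(k:ℂ) * Complex.I * t)) * k)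
      = Complex.I * π := by linear_combination -hint
  exact mul_left_cancel₀ hI this

end JW

namespace JW
open MeasureTheory

noncomputable def UU (N : ℕ) (z : ℤ → ℝ) (t : ℝ) : ℝ :=
  (2 / N : ℝ) * ∑ k ∈ Finset.Ioc (0:ℤ) N, K (t - z k)

noncomputable def nn (N : ℕ) (z : ℤ → ℝ) (t : ℝ) : ℕ :=
  ((Finset.Ioc (0:ℤ) N).filter (fun k => z k ≤ t)).card

noncomputable def hs (N : ℕ) (z : ℤ → ℝ) (t : ℝ) : ℝ := (2 * π / N : ℝ) * nn N z t

lemma UU_eq {N : ℕ} {z : ℤ → ℝ} {t : ℝ} (h : PP N z t ≠ 0) :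
    UU N z t = -(2 / N : ℝ) * Real.log (PP N z t) := by
  unfold UU PP K
  rw [Real.log_prod]
  · rw [Finset.sum_neg_distrib]; ring
  · intro k hk; exact (Finset.prod_ne_zero_iff.1 h) k hk

structure Good (N : ℕ) (φ : ℝ → ℝ) (z : ℤ → ℝ) (κ : ℝ) : Prop where
  cfg : Config N z
  zero : z 0 = 0
  lt : ∀ j, z j < z (j + 1)
  lower : ∀ j : ℤ, ∀ t ∈ Set.Ioo (z j) (z (j + 1)), φ (2 * π * j / N) + κ ≤ UU N z t
  touch : ∀ j : ℤ, ∃ t ∈ Set.Ioo (z j) (z (j + 1)), UU N z t = φ (2 * π * j / N) + κ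

theorem exists_good {N : ℕ} (hN : 0 < N) (φ : ℝ → ℝ) (hp : Function.Periodic φ (2 * π)) :
    ∃ z κ, Good N φ z κ := by
  have hN' : (0:ℝ) < N := by exact_mod_cast hN
  obtain ⟨z, hz, hz0, S, hS, hall⟩ := finite_main hN (fun j => Real.exp (N / 2 * φ (2 * π * j / N)))
    (fun j => Real.exp_pos _) (by
      intro j m
      have : 2 * π * ((j + m * N : ℤ) : ℝ) / N = 2 * π * j / N + m * (2 * π) := by
        push_cast; field_simp
      simp only [this]
      rw [hp.int_mul m])
  have hTpos : ∀ j, 0 < TT N j z := fun j => by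
    have := hall j
    by_contra! h
    have h2 := mul_nonpos_of_nonneg_of_nonpos (Real.exp_pos (N / 2 * φ (2 * π * j / N))).le h
    linarith
  have hTlog : ∀ j, -(2 / N : ℝ) * Real.log (TT N j z)
      = φ (2 * π * j / N) + -(2 / N : ℝ) * Real.log S := by
    intro j
    rw [← hall j, Real.log_mul (Real.exp_pos _).ne' (hTpos j).ne', Real.log_exp]
    field_simp; ring
  have hlt : ∀ j, z j < z (j + 1) := fun j => hz.arc_pos hN (hTpos j)
  refine ⟨z, -(2 / N : ℝ) * Real.log S, hz, hz0, hlt, ?_, ?_⟩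
  · intro j t ht
    have hpos := hz.PP_pos ht
    rw [UU_eq hpos.ne', ← hTlog]
    have := Real.log_le_log hpos (le_TT (N := N) ⟨ht.1.le, ht.2.le⟩)
    have h2 : (0:ℝ) < 2 / N := by positivity
    nlinarith
  · intro j
    obtain ⟨t, ht, hT⟩ := TT_attained (N := N) (hlt j).le
    have hpos : PP N z t ≠ 0 := by rw [hT]; exact (hTpos j).ne'
    refine ⟨t, ⟨lt_of_le_of_ne ht.1 ?_, lt_of_le_of_ne ht.2 ?_⟩, ?_⟩
    · rintro rfl; exact hpos (hz.PP_self hN _)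
    · rintro rfl; exact hpos (hz.PP_self hN _)
    · rw [UU_eq hpos, hT, hTlog]

lemma Config.K_rep {N : ℕ} {z : ℤ → ℝ} (h : Config N z) (t : ℝ) (j m : ℤ) :
    K (t - z (j + m * N)) = K (t - z j) := by
  unfold K; rw [h.factor]

lemma UU_integrable (N : ℕ) (z : ℤ → ℝ) (a b : ℝ) : IntervalIntegrable (UU N z) volume a b := by
  unfold UU
  refine IntervalIntegrable.const_mul ?_ _
  have : (fun t => ∑ k ∈ Finset.Ioc (0:ℤ) N, K (t - z k))
      = ∑ k ∈ Finset.Ioc (0:ℤ) N, fun t => K (t - z k) := by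
    funext t; simp
  rw [this]
  refine IntervalIntegrable.sum _ fun k _ => ?_
  have := (K_integrable (a - z k) (b - z k)).comp_sub_right (z k)
  simpa using this

lemma convexOn_finsum {ι : Type*} (s : Finset ι) (f : ι → ℝ → ℝ) {c : Set ℝ} (hc : Convex ℝ c)
    (h : ∀ i ∈ s, ConvexOn ℝ c (f i)) : ConvexOn ℝ c (fun t => ∑ i ∈ s, f i t) := by
  classical
  induction s using Finset.induction_on with
  | empty => simpa using convexOn_const (0:ℝ) hc
  | insert a s ha ih =>
    have h1 := (h a (Finset.mem_insert_self a s)).add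
      (ih fun i hi => h i (Finset.mem_insert_of_mem hi))
    refine h1.congr ?_
    intro t _
    simp [Finset.sum_insert ha]

lemma Config.upper {N : ℕ} (hN : 0 < N) {z : ℤ → ℝ} (h : Config N z) {i : ℤ} {q p t : ℝ}
    (hq : q ∈ Set.Ioo (z (i - 1)) (z i)) (hp : p ∈ Set.Ioo (z i) (z (i + 1)))
    (ht : t ∈ Set.Icc q p) :
    UU N z t ≤ max (UU N z q) (UU N z p) + 2 / N * (K (t - z i) + Real.log 2) := by
  obtain ⟨r, hr, m, hm⟩ := exists_rep hN i
  set V : ℝ → ℝ := fun t => ∑ k ∈ (Finset.Ioc (0:ℤ) N).erase r, K (t - z k) with hV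
  have hU : ∀ t, UU N z t = 2 / N * (K (t - z i) + V t) := by
    intro t
    unfold UU
    rw [← Finset.add_sum_erase _ _ hr, hm, h.K_rep]
  have hconv : ConvexOn ℝ (Set.Ioo (z (i - 1)) (z (i + 1))) V := by
    refine convexOn_finsum _ _ (convex_Ioo _ _) fun k hk => ?_
    obtain ⟨u, hu1, hu2, n, hn⟩ := exists_rep_from hN (i - N) k
    have hne : u ≠ i - N := by
      rintro rfl
      simp only [Finset.mem_erase, Finset.mem_Ioc] at hk hr
      apply hk.1
      refine eq_of_dvd_window (N := N) ⟨n - 1 + m, ?_⟩ (by omega) (by omega)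
      rw [hn, hm]; ring
    have e : (fun t => K (t - z k)) = fun t => K (t - z u) := by
      funext t; rw [hn, h.K_rep]
    have b1 := h.mono (show u ≤ i - 1 by omega)
    have b2 := h.mono (show i + 1 ≤ u + N by omega)
    rw [h.per] at b2
    rw [e]
    refine ⟨convex_Ioo _ _, ?_⟩
    intro x hx y hy a b ha hb hab
    have := K_convex.2 (x := x - z u) ⟨by linarith [hx.1], by linarith [hx.2]⟩
      (y := y - z u) ⟨by linarith [hy.1], by linarith [hy.2]⟩ ha hb hab
    simp only [smul_eq_mul] at *
    convert this using 2
    have : z u = (a + b) * z u := by rw [hab, one_mul]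
    linear_combination (-this)
  have hmax := hconv.le_max_of_mem_Icc (x := q) (y := p) (z := t)
    ⟨hq.1, by linarith [hq.2, hp.1, hp.2]⟩ ⟨by linarith [hq.2, hq.1, hp.1], hp.2⟩ ht
  have hN' : (0:ℝ) < 2 / N := by positivity
  have hl : ∀ x, V x ≤ N / 2 * UU N z x + Real.log 2 := by
    intro x
    rw [hU x]
    have := K_lower (x - z i)
    have hNN : (N:ℝ) ≠ 0 := by positivity
    field_simp
    linarith
  have hmul : ∀ x, V x ≤ N / 2 * UU N z x + Real.log 2 → UU N z x ≤ max (UU N z q) (UU N z p) →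
      2 / N * V x ≤ max (UU N z q) (UU N z p) + 2 / N * Real.log 2 := by
    intro x hx hx2
    have := mul_le_mul_of_nonneg_left hx hN'.le
    rw [mul_add, ← mul_assoc] at this
    have e : (2 / N * (N / 2) : ℝ) = 1 := by
      have hNN : (N:ℝ) ≠ 0 := by positivity
      field_simp
    rw [e] at this
    linarith
  rw [hU t]
  have hVt : 2 / N * V t ≤ max (UU N z q) (UU N z p) + 2 / N * Real.log 2 := by
    rcases le_max_iff.1 hmax with h1 | h1
    · exact (mul_le_mul_of_nonneg_left h1 hN'.le).trans (hmul q (hl q) (le_max_left _ _))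
    · exact (mul_le_mul_of_nonneg_left h1 hN'.le).trans (hmul p (hl p) (le_max_right _ _))
  linarith

lemma Kt_ge (A x : ℝ) : K x + Real.log 2 ≤ A + Kt A x := by
  have := le_max_left (K x + Real.log 2 - A) 0
  unfold Kt; linarith

lemma Good.upper {N : ℕ} (hN : 0 < N) {φ : ℝ → ℝ} {z : ℤ → ℝ} {κ : ℝ} (h : Good N φ z κ)
    {ω : ℝ} (hω : ∀ j : ℤ, |φ (2 * π * (j + 1 : ℤ) / N) - φ (2 * π * j / N)| ≤ ω) (A : ℝ)
    {j : ℤ} {t : ℝ} (ht : t ∈ Set.Ioo (z j) (z (j + 1))) :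
    UU N z t ≤ κ + φ (2 * π * j / N) + ω
      + 2 / N * (A + ∑ k ∈ Finset.Ioc (0:ℤ) N, Kt A (t - z k)) := by
  have hN' : (0:ℝ) < 2 / N := by positivity
  have hK : ∀ i : ℤ, K (t - z i) + Real.log 2 ≤ A + ∑ k ∈ Finset.Ioc (0:ℤ) N, Kt A (t - z k) := by
    intro i
    obtain ⟨r, hr, m, hm⟩ := exists_rep hN i
    rw [hm, h.cfg.K_rep]
    have : Kt A (t - z r) ≤ ∑ k ∈ Finset.Ioc (0:ℤ) N, Kt A (t - z k) :=
      Finset.single_le_sum (f := fun k => Kt A (t - z k)) (fun k _ => le_max_right _ _) hr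
    have := Kt_ge A (t - z r)
    linarith
  have hω0 : 0 ≤ ω := (abs_nonneg _).trans (hω 0)
  obtain ⟨p, hp, hpU⟩ := h.touch j
  rcases le_total t p with htp | htp
  · obtain ⟨q, hq, hqU⟩ := h.touch (j - 1)
    rw [sub_add_cancel] at hq
    have := h.cfg.upper hN (i := j) hq hp ⟨by linarith [hq.2, ht.1], htp⟩
    have h2 := mul_le_mul_of_nonneg_left (hK j) hN'.le
    have h3 := abs_le.1 (hω (j - 1))
    rw [sub_add_cancel] at h3
    have h4 : max (UU N z q) (UU N z p) ≤ κ + φ (2 * π * j / N) + ω :=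
      max_le (by rw [hqU]; linarith [h3.1]) (by rw [hpU]; linarith)
    linarith
  · obtain ⟨q, hq, hqU⟩ := h.touch (j + 1)
    have := h.cfg.upper hN (i := j + 1) (q := p) (p := q) (by rwa [add_sub_cancel_right]) hq
      ⟨htp, by linarith [hq.1, ht.2]⟩
    have h2 := mul_le_mul_of_nonneg_left (hK (j + 1)) hN'.le
    have h3 := abs_le.1 (hω j)
    have h4 : max (UU N z p) (UU N z q) ≤ κ + φ (2 * π * j / N) + ω :=
      max_le (by rw [hpU]; linarith) (by rw [hqU]; linarith [h3.2])
    linarith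

end JW

namespace JW
open MeasureTheory

variable {N : ℕ} {φ : ℝ → ℝ} {z : ℤ → ℝ} {κ : ℝ}

lemma Good.strict (h : Good N φ z κ) : StrictMono z := strictMono_int_of_lt_succ h.lt

lemma Good.zN (h : Good N φ z κ) : z N = 2 * π := by
  have := h.cfg.per 0
  rw [h.zero, zero_add, zero_add] at this; exact this

lemma Good.nn_eq (h : Good N φ z κ) {j : ℤ} (hj0 : 0 ≤ j) (hjN : j ≤ N) {t : ℝ} (h1 : z j ≤ t)
    (h2 : t < z (j + 1)) : (nn N z t : ℝ) = j := by
  have : (Finset.Ioc (0:ℤ) N).filter (fun k => z k ≤ t) = Finset.Ioc 0 j := by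
    ext k
    simp only [Finset.mem_filter, Finset.mem_Ioc]
    constructor
    · rintro ⟨⟨a, b⟩, c⟩
      refine ⟨a, ?_⟩
      by_contra! hk
      have := h.cfg.mono (show j + 1 ≤ k by omega); linarith
    · rintro ⟨a, b⟩
      exact ⟨⟨a, by omega⟩, (h.cfg.mono b).trans h1⟩
  unfold nn
  rw [this, Int.card_Ioc, sub_zero]
  have := Int.toNat_of_nonneg hj0
  exact_mod_cast this

lemma Good.hs_eq (h : Good N φ z κ) {j : ℤ} (hj0 : 0 ≤ j) (hjN : j ≤ N) {t : ℝ} (h1 : z j ≤ t)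
    (h2 : t < z (j + 1)) : hs N z t = 2 * π * j / N := by
  unfold hs; rw [h.nn_eq hj0 hjN h1 h2]; ring

lemma Good.hs_zero (h : Good N φ z κ) : hs N z 0 = 0 := by
  have h1 := h.lt 0
  rw [h.zero] at h1
  have := h.hs_eq le_rfl (by omega) (t := 0) h.zero.le h1
  simpa using this

lemma Good.hs_end (hN : 0 < N) (h : Good N φ z κ) : hs N z (2 * π) = 2 * π := by
  have h1 := h.lt N
  rw [h.zN] at h1
  rw [h.hs_eq (j := N) (by omega) le_rfl h.zN.le h1]
  have : (N:ℝ) ≠ 0 := by positivity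
  push_cast; field_simp

lemma nn_mono (N : ℕ) (z : ℤ → ℝ) : Monotone (nn N z) := by
  intro s t hst
  unfold nn
  exact Finset.card_le_card fun k hk => by
    simp only [Finset.mem_filter] at hk ⊢
    exact ⟨hk.1, hk.2.trans hst⟩

lemma hs_mono (N : ℕ) (z : ℤ → ℝ) : Monotone (hs N z) := by
  intro s t hst
  have := nn_mono N z hst
  unfold hs
  have h2 : (nn N z s : ℝ) ≤ nn N z t := by exact_mod_cast this
  have := Real.pi_pos
  exact mul_le_mul_of_nonneg_left h2 (by positivity)

lemma Good.find (hN : 0 < N) (h : Good N φ z κ) {t : ℝ} (h0 : 0 ≤ t) (h1 : t < 2 * π) :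
    ∃ j : ℤ, 0 ≤ j ∧ j < N ∧ z j ≤ t ∧ t < z (j + 1) := by
  obtain ⟨j, ⟨hj1, hj2⟩, hj3⟩ := Int.exists_greatest_of_bdd (P := fun k : ℤ => z k ≤ t ∧ 0 ≤ k)
    ⟨N, fun k hk => by
      by_contra! hc
      have := h.cfg.mono hc.le
      rw [h.zN] at this; linarith [hk.1]⟩ ⟨0, by rw [h.zero]; exact h0, le_rfl⟩
  refine ⟨j, hj2, ?_, hj1, ?_⟩
  · by_contra! hc
    have := h.cfg.mono hc
    rw [h.zN] at this; linarith
  · by_contra! hc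
    have := hj3 (j + 1) ⟨hc, by omega⟩
    omega

lemma Good.ae_find (hN : 0 < N) (h : Good N φ z κ) :
    ∀ᵐ t ∂(volume.restrict (Set.Icc 0 (2 * π))), 
      ∃ j : ℤ, 0 ≤ j ∧ j < N ∧ t ∈ Set.Ioo (z j) (z (j + 1)) := by
  rw [ae_restrict_iff' measurableSet_Icc]
  have hc : (Set.range z).Countable := Set.countable_range z
  filter_upwards [hc.ae_notMem volume] with t ht hI
  have hlt : t < 2 * π := lt_of_le_of_ne hI.2 fun he => ht ⟨N, by rw [h.zN, he]⟩
  obtain ⟨j, a, b, c, d⟩ := h.find hN hI.1 hlt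
  exact ⟨j, a, b, lt_of_le_of_ne c fun he => ht ⟨j, he⟩, d⟩

lemma phi_hs_integrable (hφ : Continuous φ) {M : ℝ} (hM : ∀ x, |φ x| ≤ M) (N : ℕ) (z : ℤ → ℝ)
    (a b : ℝ) : IntervalIntegrable (fun t => φ (hs N z t)) volume a b := by
  have hm : Measurable (fun t => φ (hs N z t)) := hφ.measurable.comp (hs_mono N z).measurable
  refine (intervalIntegrable_const (c := M)).mono_fun hm.aestronglyMeasurable ?_
  refine Filter.Eventually.of_forall fun t => ?_
  change |φ (hs N z t)| ≤ ‖M‖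
  rw [Real.norm_eq_abs]
  exact (hM _).trans (le_abs_self M)

lemma integral_translate {g : ℝ → ℝ} (hg : Function.Periodic g (2 * π)) (c : ℝ) :
    ∫ t in (0:ℝ)..(2 * π), g (t - c) = ∫ t in (0:ℝ)..(2 * π), g t := by
  rw [intervalIntegral.integral_comp_sub_right]
  have := hg.intervalIntegral_add_eq (0 - c) 0
  rw [show 0 - c + 2 * π = 2 * π - c by ring, zero_add] at this
  exact this

lemma translate_integrable {g : ℝ → ℝ} (hg : ∀ a b, IntervalIntegrable g volume a b) (c a b : ℝ) :
    IntervalIntegrable (fun t => g (t - c)) volume a b := by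
  have := (hg (a - c) (b - c)).comp_sub_right c
  simpa using this

lemma integral_UU (hN : 0 < N) (z : ℤ → ℝ) :
    ∫ t in (0:ℝ)..(2 * π), UU N z t = 2 * ∫ t in (0:ℝ)..(2 * π), K t := by
  unfold UU
  rw [intervalIntegral.integral_const_mul, intervalIntegral.integral_finsetSum]
  · simp only [integral_translate K_periodic]
    rw [Finset.sum_const, Int.card_Ioc]
    have : (N:ℝ) ≠ 0 := by positivity
    simp; field_simp
  · intro k _; exact translate_integrable K_integrable _ _ _

lemma Good.kappa_le (hN : 0 < N) (h : Good N φ z κ) {M : ℝ} (hM : ∀ x, |φ x| ≤ M) :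
    κ ≤ M + (∫ t in (0:ℝ)..(2 * π), K t) / π := by
  have hpi := Real.pi_pos
  have h1 : ∫ t in (0:ℝ)..(2 * π), (κ - M) ≤ ∫ t in (0:ℝ)..(2 * π), UU N z t := by
    refine intervalIntegral.integral_mono_ae_restrict (by positivity) intervalIntegrable_const
      (UU_integrable N z _ _) ?_
    filter_upwards [h.ae_find hN] with t ⟨j, _, _, hj⟩
    have := h.lower j t hj
    have := abs_le.1 (hM (2 * π * j / N))
    linarith
  rw [integral_UU hN, intervalIntegral.integral_const, smul_eq_mul] at h1
  have : κ - M ≤ (∫ t in (0:ℝ)..(2 * π), K t) / π := by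
    rw [le_div_iff₀ hpi]; linarith
  linarith

/-- the error function -/
noncomputable def EE (N : ℕ) (φ : ℝ → ℝ) (z : ℤ → ℝ) (κ : ℝ) (t : ℝ) : ℝ :=
  UU N z t - κ - φ (hs N z t)

lemma EE_integrable (hφ : Continuous φ) {M : ℝ} (hM : ∀ x, |φ x| ≤ M) (a b : ℝ) :
    IntervalIntegrable (EE N φ z κ) volume a b :=
  ((UU_integrable N z a b).sub intervalIntegrable_const).sub (phi_hs_integrable hφ hM N z a b)

lemma Good.EE_L1 (hN : 0 < N) (h : Good N φ z κ) (hφ : Continuous φ) {M : ℝ} (hM : ∀ x, |φ x| ≤ M)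
    {ω : ℝ} (hω : ∀ j : ℤ, |φ (2 * π * (j + 1 : ℤ) / N) - φ (2 * π * j / N)| ≤ ω) (A : ℝ) :
    ∫ t in (0:ℝ)..(2 * π), |EE N φ z κ t| ≤
      2 * π * ω + 4 * π * A / N + 2 * ∫ t in (0:ℝ)..(2 * π), Kt A t := by
  have hpi := Real.pi_pos
  have hN' : (N:ℝ) ≠ 0 := by positivity
  have hsumint : IntervalIntegrable (fun t => ∑ k ∈ Finset.Ioc (0:ℤ) N, Kt A (t - z k)) volume 0 (2 * π) := by
    have : (fun t => ∑ k ∈ Finset.Ioc (0:ℤ) N, Kt A (t - z k))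
        = ∑ k ∈ Finset.Ioc (0:ℤ) N, fun t => Kt A (t - z k) := by
      funext t; simp
    rw [this]
    exact IntervalIntegrable.sum _ fun k _ => translate_integrable (Kt_integrable A) _ _ _
  have h1 : ∫ t in (0:ℝ)..(2 * π), |EE N φ z κ t| ≤ ∫ t in (0:ℝ)..(2 * π), 
      ((ω + 2 / N * A) + 2 / N * ∑ k ∈ Finset.Ioc (0:ℤ) N, Kt A (t - z k)) := by
    refine intervalIntegral.integral_mono_ae_restrict (by positivity) (EE_integrable hφ hM _ _).abs
      (intervalIntegrable_const.add (hsumint.const_mul _)) ?_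
    filter_upwards [h.ae_find hN] with t ⟨j, hj0, hjN, hj⟩
    have a1 := h.lower j t hj
    have a2 := h.upper hN hω A hj
    unfold EE
    rw [h.hs_eq hj0 hjN.le hj.1.le hj.2, abs_of_nonneg (by linarith)]
    linarith
  refine h1.trans (le_of_eq ?_)
  rw [intervalIntegral.integral_add intervalIntegrable_const (hsumint.const_mul _),
    intervalIntegral.integral_const_mul, intervalIntegral.integral_finsetSum
      (fun k _ => translate_integrable (Kt_integrable A) _ _ _)]
  simp only [integral_translate (Kt_periodic A)]
  rw [Finset.sum_const, Int.card_Ioc, intervalIntegral.integral_const]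
  simp; field_simp; ring

lemma nn_sub (N : ℕ) (z : ℤ → ℝ) {s t : ℝ} (hst : s ≤ t) :
    (nn N z t : ℝ) - nn N z s =
      ((Finset.Ioc (0:ℤ) N).filter (fun k => s < z k ∧ z k ≤ t)).card := by
  have : nn N z t = nn N z s +
      ((Finset.Ioc (0:ℤ) N).filter (fun k => s < z k ∧ z k ≤ t)).card := by
    unfold nn
    rw [← Finset.card_union_of_disjoint]
    · congr 1
      ext k
      simp only [Finset.mem_filter, Finset.mem_union]
      constructor
      · rintro ⟨a, b⟩
        rcases le_or_gt (z k) s with hc | hc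
        · exact Or.inl ⟨a, hc⟩
        · exact Or.inr ⟨a, hc, b⟩
      · rintro (⟨a, b⟩ | ⟨a, _, b⟩)
        · exact ⟨a, b.trans hst⟩
        · exact ⟨a, b⟩
    · rw [Finset.disjoint_filter]
      intro k _ hk; simp; intro hc; linarith
  rw [this]; push_cast; ring

lemma Good.modulus (hN : 0 < N) (h : Good N φ z κ) {M : ℝ} (hM : ∀ x, |φ x| ≤ M) {s t d : ℝ}
    (hst : s ≤ t) (hd : t - s ≤ d) (hdpi : d ≤ π) (hK : 0 < K d + Real.log 2) :
    hs N z t - hs N z s ≤ 2 * π / N ∨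
    hs N z t - hs N z s ≤
      π * (2 * M + (∫ t in (0:ℝ)..(2 * π), K t) / π + 2 * Real.log 2) / (K d + Real.log 2) := by
  have hpi := Real.pi_pos
  have hN' : (0:ℝ) < N := by positivity
  have e : hs N z t - hs N z s = 2 * π / N * (nn N z t - nn N z s) := by unfold hs; ring
  rw [e, nn_sub N z hst]
  set B := (Finset.Ioc (0:ℤ) N).filter (fun k => s < z k ∧ z k ≤ t) with hB
  rcases le_or_gt B.card 1 with hc | hc
  · left
    have : (B.card : ℝ) ≤ 1 := by exact_mod_cast hc
    calc 2 * π / N * (B.card : ℝ) ≤ 2 * π / N * 1 := mul_le_mul_of_nonneg_left this (by positivity)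
      _ = _ := by ring
  · right
    have hne : B.Nonempty := Finset.card_pos.1 (by omega)
    set i := B.min' hne with hi
    obtain ⟨k', hk', hk'i⟩ := Finset.exists_mem_ne hc i
    have hik : i + 1 ≤ k' := by
      have := Finset.min'_le B k' hk'
      have h3 : i ≤ k' := this
      omega
    have hiB : i ∈ B := Finset.min'_mem B hne
    simp only [hB, Finset.mem_filter] at hiB hk'
    obtain ⟨p, hp, hpU⟩ := h.touch i
    have hpt : p < t := by linarith [hp.2, h.cfg.mono hik, hk'.2.2]
    have hps : s < p := by linarith [hp.1, hiB.2.1]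
    have hsum : (B.card : ℝ) * (K d + Real.log 2) ≤
        ∑ k ∈ Finset.Ioc (0:ℤ) N, (K (p - z k) + Real.log 2) := by
      calc (B.card : ℝ) * (K d + Real.log 2) = ∑ k ∈ B, (K d + Real.log 2) := by
            rw [Finset.sum_const, nsmul_eq_mul]
        _ ≤ ∑ k ∈ B, (K (p - z k) + Real.log 2) := by
            refine Finset.sum_le_sum fun k hk => ?_
            simp only [hB, Finset.mem_filter] at hk
            have hne : p - z k ≠ 0 := by
              intro h0
              have h0 : p = z k := by linarith
              rcases le_or_gt k i with hki | hki
              · have := h.cfg.mono hki; linarith [hp.1]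
              · have := h.cfg.mono (show i + 1 ≤ k by omega); linarith [hp.2]
            have := K_near hne (d := d) (abs_le.2 ⟨by linarith [hk.2.2], by linarith [hk.2.1]⟩) hdpi
            linarith
        _ ≤ _ := by
            refine Finset.sum_le_sum_of_subset_of_nonneg (Finset.filter_subset _ _) fun k _ _ => ?_
            linarith [K_lower (p - z k)]
    rw [Finset.sum_add_distrib, Finset.sum_const, Int.card_Ioc] at hsum
    have hU : 2 / N * ∑ k ∈ Finset.Ioc (0:ℤ) N, K (p - z k) = φ (2 * π * i / N) + κ := hpU
    have h1 := h.kappa_le hN hM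
    have h2 := (abs_le.1 (hM (2 * π * i / N))).2
    simp only [sub_zero, Int.toNat_natCast, nsmul_eq_mul] at hsum
    rw [le_div_iff₀ hK]
    have h3 := mul_le_mul_of_nonneg_left hsum (show 0 ≤ 2 * π / N by positivity)
    calc 2 * π / N * (B.card : ℝ) * (K d + Real.log 2) 
        ≤ 2 * π / N * (∑ k ∈ Finset.Ioc (0:ℤ) N, K (p - z k) + N * Real.log 2) := by linarith
      _ = π * (2 / N * ∑ k ∈ Finset.Ioc (0:ℤ) N, K (p - z k) + 2 * Real.log 2) := by
          field_simp
      _ ≤ _ := by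
          rw [hU]
          refine mul_le_mul_of_nonneg_left ?_ hpi.le
          linarith

end JW

namespace JW
open MeasureTheory

variable {N : ℕ} {φ : ℝ → ℝ} {z : ℤ → ℝ} {κ : ℝ}

noncomputable def DD (a b s : ℝ) (g : ℝ → ℝ) : ℝ :=
  ∫ t in (a + s)..(b - s), (g (t + s) + g (t - s) - 2 * g t)

noncomputable def C1 : ℝ := ∫ t in (0:ℝ)..(2 * π), |K t|

lemma C1_nonneg : 0 ≤ C1 :=
  intervalIntegral.integral_nonneg (by positivity) fun _ _ => abs_nonneg _

lemma absK_int_le {u v : ℝ} (huv : u ≤ v) (hv : v ≤ u + 2 * π) : ∫ t in u..v, |K t| ≤ C1 := by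
  have hp : Function.Periodic (fun t => |K t|) (2 * π) := fun t => by
    show |K (t + 2 * π)| = |K t|
    rw [K_periodic t]
  have h1 := hp.intervalIntegral_add_eq u 0
  rw [zero_add] at h1
  unfold C1
  rw [← h1, ← intervalIntegral.integral_add_adjacent_intervals (a := u) (b := v) (c := u + 2 * π)
    (K_integrable u v).abs (K_integrable v _).abs]
  have : 0 ≤ ∫ t in v..(u + 2 * π), |K t| :=
    intervalIntegral.integral_nonneg hv fun _ _ => abs_nonneg _
  linarith

lemma absK_int_le' {u v : ℝ} (c : ℝ) (huv : u ≤ v) (hv : v ≤ u + 2 * π) :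
    |∫ t in u..v, K (t + c)| ≤ C1 := by
  rw [intervalIntegral.integral_comp_add_right]
  refine (intervalIntegral.abs_integral_le_integral_abs (by linarith)).trans ?_
  exact absK_int_le (by linarith) (by linarith)

lemma add_integrable {g : ℝ → ℝ} (hg : ∀ a b, IntervalIntegrable g volume a b) (c a b : ℝ) :
    IntervalIntegrable (fun t => g (t + c)) volume a b := by
  have := translate_integrable hg (-c) a b
  simpa using this

lemma DD_split {g : ℝ → ℝ} (hg : ∀ a b, IntervalIntegrable g volume a b) (a b s : ℝ) :
    DD a b s g = (∫ t in (a + s)..(b - s), g (t + s)) + (∫ t in (a + s)..(b - s), g (t - s))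
      - 2 * ∫ t in (a + s)..(b - s), g t := by
  unfold DD
  rw [intervalIntegral.integral_sub, intervalIntegral.integral_add,
    intervalIntegral.integral_const_mul]
  · exact add_integrable hg s _ _
  · exact translate_integrable hg s _ _
  · exact (add_integrable hg s _ _).add (translate_integrable hg s _ _)
  · exact (hg _ _).const_mul 2

lemma DD_K_bad {a b s ζ : ℝ} (hs : 0 < s) (hb : b - a = 4 * s) (h2 : b - a ≤ 2 * π) :
    -(4 * C1) ≤ DD a b s (fun t => K (t - ζ)) := by
  rw [DD_split (translate_integrable K_integrable ζ)]
  have h1 := absK_int_le' (u := a + s) (v := b - s) (s - ζ) (by linarith) (by linarith)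
  have h2 := absK_int_le' (u := a + s) (v := b - s) (-s - ζ) (by linarith) (by linarith)
  have h3 := absK_int_le' (u := a + s) (v := b - s) (- ζ) (by linarith) (by linarith)
  have e1 : ∀ t, K (t + s - ζ) = K (t + (s - ζ)) := fun t => by congr 1; ring
  have e2 : ∀ t, K (t - s - ζ) = K (t + (-s - ζ)) := fun t => by congr 1; ring
  have e3 : ∀ t, K (t - ζ) = K (t + (- ζ)) := fun t => by congr 1
  simp only [e1, e2, e3]
  have := (abs_le.1 h1).1
  have := (abs_le.1 h2).1
  have := (abs_le.1 h3).2
  linarith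

lemma DD_K_good {a b s ζ : ℝ} (hs : 0 < s) (ha : 0 ≤ a) (hb : b - a = 4 * s) (h2 : b ≤ 2 * π)
    (hz0 : 0 ≤ ζ) (hz1 : ζ ≤ 2 * π) (hz : ζ ≤ a ∨ b ≤ ζ) :
    2 * s * (-Real.log (1 - Real.sin (s / 2) ^ 2)) ≤ DD a b s (fun t => K (t - ζ)) := by
  have hi : IntervalIntegrable (fun t => K (t + s - ζ) + K (t - s - ζ) - 2 * K (t - ζ)) volume
      (a + s) (b - s) :=
    ((add_integrable (translate_integrable K_integrable ζ) s _ _).add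
      (translate_integrable (translate_integrable K_integrable ζ) s _ _)).sub
      ((translate_integrable K_integrable ζ _ _).const_mul 2)
  have := intervalIntegral.integral_mono_on_of_le_Ioo (a := a + s) (b := b - s) (by linarith)
    (intervalIntegrable_const (c := (-Real.log (1 - Real.sin (s / 2) ^ 2)))) hi (by
      intro t ht
      rcases hz with hz | hz
      · have := second_diff (x := t - ζ) hs (by linarith [ht.1]) (by linarith [ht.2])
        convert this using 4 <;> ring
      · have := second_diff (x := t - ζ + 2 * π) hs (by linarith [ht.1]) (by linarith [ht.2])
        have e1 : K (t - ζ + 2 * π + s) = K (t + s - ζ) := by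
          rw [← K_periodic (t + s - ζ)]; congr 1; ring
        have e2 : K (t - ζ + 2 * π - s) = K (t - s - ζ) := by
          rw [← K_periodic (t - s - ζ)]; congr 1; ring
        rw [e1, e2, K_periodic] at this
        exact this)
  rw [intervalIntegral.integral_const] at this
  unfold DD
  refine le_trans (le_of_eq ?_) this
  rw [smul_eq_mul]
  rw [show b - s - (a + s) = 2 * s by linarith]

lemma DD_UU (hN : 0 < N) (h : Good N φ z κ) {a b s : ℝ} (hs : 0 < s) (ha : 0 ≤ a)
    (hb : b - a = 4 * s) (h2 : b ≤ 2 * π) :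
    4 * s * (-Real.log (1 - Real.sin (s / 2) ^ 2)) - (JW.hs N z b - JW.hs N z a) / (2 * π) *
      (4 * s * (-Real.log (1 - Real.sin (s / 2) ^ 2)) + 8 * C1) ≤ DD a b s (UU N z) := by
  have hN' : (0:ℝ) < N := by exact_mod_cast hN
  have hpi := Real.pi_pos
  set γ := (-Real.log (1 - Real.sin (s / 2) ^ 2))
  have hKi := fun k => translate_integrable K_integrable (z k)
  have e : DD a b s (UU N z) = 2 / N * ∑ k ∈ Finset.Ioc (0:ℤ) N, DD a b s (fun t => K (t - z k)) := by
    unfold DD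
    rw [← intervalIntegral.integral_finsetSum, ← intervalIntegral.integral_const_mul]
    · congr 1
      funext t
      unfold UU
      rw [Finset.sum_sub_distrib, Finset.sum_add_distrib, ← Finset.mul_sum]
      ring
    · intro k _
      exact ((add_integrable (hKi k) s _ _).add (translate_integrable (hKi k) s _ _)).sub
        ((hKi k _ _).const_mul 2)
  have hn := nn_sub N z (show a ≤ b by linarith)
  set n := ((Finset.Ioc (0:ℤ) N).filter (fun k => a < z k ∧ z k ≤ b)).card with hndef
  have hd : JW.hs N z b - JW.hs N z a = 2 * π / N * n := by
    rw [← hn]; unfold JW.hs; ring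
  have hsum : ∑ k ∈ Finset.Ioc (0:ℤ) N, (if a < z k ∧ z k ≤ b then -(4 * C1) - 2 * s * γ else 0) +
      N * (2 * s * γ) ≤ ∑ k ∈ Finset.Ioc (0:ℤ) N, DD a b s (fun t => K (t - z k)) := by
    have : (N:ℝ) * (2 * s * γ) = ∑ k ∈ Finset.Ioc (0:ℤ) N, 2 * s * γ := by
      rw [Finset.sum_const, Int.card_Ioc]; simp
    rw [this, ← Finset.sum_add_distrib]
    refine Finset.sum_le_sum fun k hk => ?_
    rw [Finset.mem_Ioc] at hk
    split_ifs with hc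
    · have := DD_K_bad (a := a) (b := b) (ζ := z k) hs hb (by linarith)
      linarith
    · rw [zero_add]
      refine DD_K_good hs ha hb h2 ?_ ?_ ?_
      · rw [← h.zero]; exact h.strict.monotone hk.1.le
      · rw [← h.zN]; exact h.strict.monotone hk.2
      · by_contra hcon
        push Not at hcon
        exact hc ⟨hcon.1, hcon.2.le⟩
  rw [← Finset.sum_filter, Finset.sum_const, ← hndef, nsmul_eq_mul] at hsum
  rw [e, hd]
  refine le_trans (le_of_eq ?_) (mul_le_mul_of_nonneg_left hsum (by positivity))
  field_simp
  ring

lemma exp_period (k : ℕ) (t : ℝ) : Complex.exp (-(k:ℂ) * Complex.I * ((t + 2 * π : ℝ) : ℂ))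
    = Complex.exp (-(k:ℂ) * Complex.I * t) := by
  have : -(k:ℂ) * Complex.I * ((t + 2 * π : ℝ) : ℂ) = -(k:ℂ) * Complex.I * t
      + ((-k : ℤ) : ℂ) * (2 * π * Complex.I) := by push_cast; ring
  rw [this, Complex.exp_add, Complex.exp_int_mul_two_pi_mul_I, mul_one]

lemma exp_cont (k : ℕ) : Continuous fun t : ℝ => Complex.exp (-(k:ℂ) * Complex.I * t) := by
  fun_prop

lemma ofReal_integrable {g : ℝ → ℝ} {a b : ℝ} (hg : IntervalIntegrable g volume a b) :
    IntervalIntegrable (fun t => (g t : ℂ)) volume a b := ⟨hg.1.ofReal, hg.2.ofReal⟩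

lemma K_fourier_shift (k : ℕ) (hk : 0 < k) (ζ : ℝ) :
    ∫ t in (0:ℝ)..(2 * π), (K (t - ζ) : ℂ) * Complex.exp (-(k:ℂ) * Complex.I * t)
      = Complex.exp (-(k:ℂ) * Complex.I * ζ) * (π / k) := by
  rw [← K_fourier k hk, ← intervalIntegral.integral_const_mul]
  have hp : Function.Periodic (fun t : ℝ => Complex.exp (-(k:ℂ) * Complex.I * ζ) *
      ((K t : ℂ) * Complex.exp (-(k:ℂ) * Complex.I * t))) (2 * π) := fun t => by
    beta_reduce
    rw [exp_period, K_periodic]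
  have h2 := hp.intervalIntegral_add_eq (0 - ζ) 0
  rw [show 0 - ζ + 2 * π = 2 * π - ζ by ring, zero_add] at h2
  rw [← h2, ← intervalIntegral.integral_comp_sub_right]
  congr 1
  funext t
  have : Complex.exp (-(k:ℂ) * Complex.I * t) = Complex.exp (-(k:ℂ) * Complex.I * ζ) *
    Complex.exp (-(k:ℂ) * Complex.I * ((t - ζ : ℝ) : ℂ)) := by
    rw [← Complex.exp_add]; congr 1; push_cast; ring
  rw [this]; ring

lemma step_integrable (ζ a b : ℝ) :
    IntervalIntegrable (fun t => (if ζ ≤ t then (2 * π) else 0 : ℝ)) volume a b := by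
  refine Monotone.intervalIntegrable fun x y hxy => ?_
  split_ifs with h1 h2
  · exact le_rfl
  · exact absurd (h1.trans hxy) h2
  · positivity
  · exact le_rfl

lemma step_fourier (k : ℕ) (hk : 0 < k) {ζ : ℝ} (h0 : 0 ≤ ζ) (h1 : ζ ≤ 2 * π) :
    ∫ t in (0:ℝ)..(2 * π), (((if ζ ≤ t then (2 * π) else 0) - t : ℝ) : ℂ)
        * Complex.exp (-(k:ℂ) * Complex.I * t)
      = -Complex.I * (2 * (Complex.exp (-(k:ℂ) * Complex.I * ζ) * (π / k))) := by
  have hk' : (k:ℂ) ≠ 0 := by exact_mod_cast hk.ne'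
  set c : ℂ := -(k:ℂ) * Complex.I with hc
  have hc0 : c ≠ 0 := by simp [hc, hk']
  have hE : Continuous fun t : ℝ => Complex.exp (c * t) := by fun_prop
  have he2 : Complex.exp (c * (2 * π : ℝ)) = 1 := by
    have := exp_period k 0
    rw [zero_add] at this
    rw [hc, this]; simp
  have A : ∫ t in (0:ℝ)..(2 * π), (t:ℂ) * Complex.exp (c * t) = 2 * π / c := by
    have hd : ∀ x : ℝ, HasDerivAt (fun t : ℝ => (t:ℂ) * Complex.exp (c * t) / c
        - Complex.exp (c * t) / c ^ 2) ((x:ℂ) * Complex.exp (c * x)) x := by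
      intro x
      have h1 : HasDerivAt (fun t : ℝ => (t:ℂ)) 1 x := Complex.ofRealCLM.hasDerivAt
      have h2 : HasDerivAt (fun t : ℝ => Complex.exp (c * t)) (Complex.exp (c * x) * (c * 1)) x :=
        (h1.const_mul c).cexp
      have := ((h1.mul h2).div_const c).sub (h2.div_const (c ^ 2))
      have e : (x:ℂ) * Complex.exp (c * x) = (1 * Complex.exp (c * x) + (x:ℂ) * (Complex.exp (c * x) * (c * 1))) / c
          - Complex.exp (c * x) * (c * 1) / c ^ 2 := by
        field_simp
        ring
      rw [e]
      exact this
    rw [intervalIntegral.integral_eq_sub_of_hasDerivAt (fun x _ => hd x)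
      ((by fun_prop : Continuous fun t : ℝ => (t:ℂ) * Complex.exp (c * t)).intervalIntegrable _ _),
      he2]
    simp
  have B : ∫ t in (0:ℝ)..(2 * π), ((if ζ ≤ t then (2 * π) else 0 : ℝ) : ℂ) * Complex.exp (c * t)
      = 2 * π * ((1 - Complex.exp (c * ζ)) / c) := by
    have hi : ∀ a b, IntervalIntegrable (fun t => ((if ζ ≤ t then (2 * π) else 0 : ℝ) : ℂ)
        * Complex.exp (c * t)) volume a b := fun a b =>
      (ofReal_integrable (step_integrable ζ a b)).mul_continuousOn hE.continuousOn
    rw [← intervalIntegral.integral_add_adjacent_intervals (hi 0 ζ) (hi ζ _)]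
    rw [intervalIntegral.integral_congr_Ioo_of_le (g := fun _ => 0) h0,
      intervalIntegral.integral_congr_Ioo_of_le (g := fun t => 2 * π * Complex.exp (c * t)) h1]
    · rw [intervalIntegral.integral_const_mul, integral_exp_mul_complex hc0, he2]
      simp
    · intro t ht
      simp [ht.1.le]
    · intro t ht
      simp [ht.2]
  have hsplit : ∀ t : ℝ, (((if ζ ≤ t then (2 * π) else 0) - t : ℝ) : ℂ) * Complex.exp (c * t)
    = ((if ζ ≤ t then (2 * π) else 0 : ℝ) : ℂ) * Complex.exp (c * t) - (t:ℂ) * Complex.exp (c * t) := by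
    intro t; rw [Complex.ofReal_sub]; ring
  simp only [hsplit]
  rw [intervalIntegral.integral_sub, A, B]
  · rw [hc]
    field_simp
    simp
  · exact (ofReal_integrable (step_integrable ζ _ _)).mul_continuousOn hE.continuousOn
  · exact (by fun_prop : Continuous fun t : ℝ => (t:ℂ) * Complex.exp (c * t)).intervalIntegrable _ _

lemma Good.fourier (hN : 0 < N) (h : Good N φ z κ) (k : ℕ) (hk : 0 < k) :
    ∫ t in (0:ℝ)..(2 * π), ((hs N z t - t : ℝ) : ℂ) * Complex.exp (-(k:ℂ) * Complex.I * t)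
      = -Complex.I * ∫ t in (0:ℝ)..(2 * π), (UU N z t : ℂ) * Complex.exp (-(k:ℂ) * Complex.I * t) := by
  have hN' : (N:ℂ) ≠ 0 := by exact_mod_cast hN.ne'
  have hNr : (N:ℝ) ≠ 0 := by exact_mod_cast hN.ne'
  have e1 : ∀ t : ℝ, ((hs N z t - t : ℝ) : ℂ) * Complex.exp (-(k:ℂ) * Complex.I * t)
      = (1 / N : ℂ) * ∑ j ∈ Finset.Ioc (0:ℤ) N, (((if z j ≤ t then (2 * π) else 0) - t : ℝ) : ℂ)
        * Complex.exp (-(k:ℂ) * Complex.I * t) := by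
    intro t
    rw [← Finset.sum_mul, ← mul_assoc, ← Complex.ofReal_sum]
    congr 1
    rw [Finset.sum_sub_distrib, ← Finset.sum_filter, Finset.sum_const, Finset.sum_const,
      Int.card_Ioc]
    have : hs N z t - t = (1 / N) * ((nn N z t : ℝ) * (2 * π) - N * t) := by
      unfold hs; field_simp
    rw [this]
    unfold nn
    push_cast
    simp
  have e2 : ∀ t : ℝ, (UU N z t : ℂ) * Complex.exp (-(k:ℂ) * Complex.I * t)
      = (2 / N : ℂ) * ∑ j ∈ Finset.Ioc (0:ℤ) N, (K (t - z j) : ℂ)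
        * Complex.exp (-(k:ℂ) * Complex.I * t) := by
    intro t
    unfold UU
    rw [← Finset.sum_mul]; push_cast; ring
  simp only [e1, e2]
  rw [intervalIntegral.integral_const_mul, intervalIntegral.integral_const_mul,
    intervalIntegral.integral_finsetSum, intervalIntegral.integral_finsetSum]
  · have : ∀ j ∈ Finset.Ioc (0:ℤ) N, ∫ t in (0:ℝ)..(2 * π),
        (((if z j ≤ t then (2 * π) else 0) - t : ℝ) : ℂ) * Complex.exp (-(k:ℂ) * Complex.I * t)
        = -Complex.I * (2 * ∫ t in (0:ℝ)..(2 * π), (K (t - z j) : ℂ)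
        * Complex.exp (-(k:ℂ) * Complex.I * t)) := by
      intro j hj
      rw [Finset.mem_Ioc] at hj
      rw [K_fourier_shift k hk, step_fourier k hk]
      · rw [← h.zero]; exact h.strict.monotone hj.1.le
      · rw [← h.zN]; exact h.strict.monotone hj.2
    rw [Finset.sum_congr rfl this, ← Finset.mul_sum, ← Finset.mul_sum]
    ring
  · intro j _
    exact (ofReal_integrable (translate_integrable K_integrable _ _ _)).mul_continuousOn
      (exp_cont k).continuousOn
  · intro j _
    exact (ofReal_integrable ((step_integrable _ _ _).sub
      (continuous_id.intervalIntegrable _ _))).mul_continuousOn (exp_cont k).continuousOn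

end JW

namespace JW
open MeasureTheory

variable {N : ℕ} {φ : ℝ → ℝ} {z : ℤ → ℝ} {κ : ℝ}

open Filter Topology in
lemma seq_limit (H : ℕ → ℝ → ℝ) (hm : ∀ n, Monotone (H n)) {L : ℝ}
    (hr : ∀ n t, H n t ∈ Set.Icc 0 L)
    (heq : ∀ ε > 0, ∃ δ > 0, ∀ᶠ n in atTop, ∀ s t, s ≤ t → t - s ≤ δ → H n t - H n s ≤ ε) :
    ∃ h : ℝ → ℝ, Monotone h ∧ Continuous h ∧
      (∀ t, Tendsto (fun n => H n t) (hyperfilter ℕ : Filter ℕ) (𝓝 (h t))) ∧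
      ∀ ε > 0, ∀ᶠ n in (hyperfilter ℕ : Filter ℕ), ∀ t ∈ Set.Icc 0 L, |H n t - h t| ≤ ε := by
  have hle : (hyperfilter ℕ : Filter ℕ) ≤ atTop := Nat.hyperfilter_le_atTop
  have hex : ∀ t, ∃ y, Tendsto (fun n => H n t) (hyperfilter ℕ : Filter ℕ) (𝓝 y) := by
    intro t
    obtain ⟨y, _, hy⟩ := (isCompact_Icc (a := (0:ℝ)) (b := L)).ultrafilter_le_nhds
      ((hyperfilter ℕ).map (fun n => H n t)) (by
        rw [Ultrafilter.coe_map, le_principal_iff, mem_map]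
        exact univ_mem' fun n => hr n t)
    exact ⟨y, hy⟩
  choose h hh using hex
  have hmono : Monotone h := fun s t hst =>
    le_of_tendsto_of_tendsto' (hh s) (hh t) fun n => hm n hst
  have hmod : ∀ ε > 0, ∃ δ > 0, (∀ᶠ n in atTop, ∀ s t, s ≤ t → t - s ≤ δ → H n t - H n s ≤ ε) ∧
      ∀ s t, s ≤ t → t - s ≤ δ → h t - h s ≤ ε := by
    intro ε hε
    obtain ⟨δ, hδ, he⟩ := heq ε hε
    refine ⟨δ, hδ, he, fun s t hst hd => ?_⟩
    refine le_of_tendsto ((hh t).sub (hh s)) ?_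
    filter_upwards [hle he] with n hn
    exact hn s t hst hd
  refine ⟨h, hmono, ?_, hh, ?_⟩
  · rw [Metric.continuous_iff]
    intro b ε hε
    obtain ⟨δ, hδ, -, h2⟩ := hmod (ε / 2) (by positivity)
    refine ⟨δ, hδ, fun a ha => ?_⟩
    rw [Real.dist_eq, abs_lt] at *
    rcases le_total a b with hab | hab
    · have := h2 a b hab (by linarith)
      have := hmono hab
      constructor <;> linarith
    · have := h2 b a hab (by linarith)
      have := hmono hab
      constructor <;> linarith
  · intro ε hε
    obtain ⟨δ, hδ, h1, h2⟩ := hmod (ε / 3) (by positivity)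
    have hgrid : ∀ᶠ n in (hyperfilter ℕ : Filter ℕ), ∀ i ∈ Finset.range (⌊L / δ⌋₊ + 1),
        |H n (i * δ) - h (i * δ)| < ε / 3 := by
      rw [Filter.eventually_all_finset]
      intro i _
      have := (hh (i * δ)).eventually (Metric.ball_mem_nhds _ (show 0 < ε / 3 by positivity))
      filter_upwards [this] with n hn
      rwa [← Real.dist_eq]
    filter_upwards [hgrid, hle h1] with n hn hn1 t ht
    set i := ⌊t / δ⌋₊ with hi
    have hi1 : (i:ℝ) * δ ≤ t := by
      have := Nat.floor_le (show 0 ≤ t / δ from div_nonneg ht.1 hδ.le)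
      rwa [le_div_iff₀ hδ] at this
    have hi2 : t - i * δ ≤ δ := by
      have := Nat.lt_floor_add_one (t / δ)
      rw [div_lt_iff₀ hδ] at this
      rw [← hi] at this
      linarith
    have hmem : i ∈ Finset.range (⌊L / δ⌋₊ + 1) := by
      rw [Finset.mem_range, Nat.lt_succ_iff]
      exact Nat.floor_le_floor (div_le_div_of_nonneg_right ht.2 hδ.le)
    have a1 := abs_lt.1 (hn i hmem)
    have a2 := hn1 _ _ hi1 hi2
    have a3 := h2 _ _ hi1 hi2
    have a4 := hm n hi1
    have a5 := hmono hi1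
    rw [abs_le]
    constructor <;> linarith [a1.1, a1.2]

lemma hs_mem (hN : 0 < N) (z : ℤ → ℝ) (t : ℝ) : hs N z t ∈ Set.Icc 0 (2 * π) := by
  have hpi := Real.pi_pos
  have hN' : (0:ℝ) < N := by exact_mod_cast hN
  have h : (nn N z t : ℝ) ≤ N := by
    have : nn N z t ≤ N := by
      unfold nn
      refine (Finset.card_filter_le _ _).trans ?_
      simp
    exact_mod_cast this
  unfold hs
  constructor
  · positivity
  · calc 2 * π / N * (nn N z t : ℝ) ≤ 2 * π / N * N := by gcongr
      _ = 2 * π := by field_simp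

open Filter Topology in
lemma exists_limit (hφ : UniformContinuous φ) (hp : Function.Periodic φ (2 * π)) {M : ℝ}
    (hM : ∀ x, |φ x| ≤ M) :
    ∃ h : ℝ → ℝ, Monotone h ∧ Continuous h ∧ h 0 = 0 ∧ h (2 * π) = 2 * π ∧
      ∀ ε > 0, ∃ N : ℕ, 0 < N ∧ ∃ z κ, Good N φ z κ ∧
        (∀ t ∈ Set.Icc 0 (2 * π), |hs N z t - h t| ≤ ε ∧ |φ (hs N z t) - φ (h t)| ≤ ε) ∧
        ∫ t in (0:ℝ)..(2 * π), |EE N φ z κ t| ≤ ε := by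
  have hpi := Real.pi_pos
  choose Z κs hG using fun n : ℕ => exists_good (Nat.succ_pos n) φ hp
  have hdiv : ∀ C : ℝ, ∀ ε > 0, ∀ᶠ n : ℕ in atTop, C / ((n + 1 : ℕ) : ℝ) < ε := by
    intro C ε hε
    have h1 : Tendsto (fun n : ℕ => C / ((n + 1 : ℕ) : ℝ)) atTop (𝓝 0) :=
      (tendsto_const_div_atTop_nhds_zero_nat C).comp (tendsto_add_atTop_nat 1)
    exact h1.eventually_lt_const hε
  obtain ⟨h, h1, h2, h3, h4⟩ := seq_limit (fun n => hs (n + 1) (Z n)) (fun n => hs_mono _ _)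
    (L := 2 * π) (fun n t => hs_mem (Nat.succ_pos n) _ t) (by
      intro ε hε
      set C := π * (2 * M + (∫ t in (0:ℝ)..(2 * π), K t) / π + 2 * Real.log 2)
      have hK : Tendsto (fun d => K d + Real.log 2) (𝓝[>] 0) atTop :=
        tendsto_atTop_add_const_right _ _ K_tendsto
      have ev : ∀ᶠ d in 𝓝[>] (0:ℝ), 0 < d ∧ d < π ∧ 0 < K d + Real.log 2 ∧
          C / (K d + Real.log 2) < ε := by
        filter_upwards [self_mem_nhdsWithin, nhdsWithin_le_nhds (Iio_mem_nhds hpi),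
          hK.eventually_gt_atTop 0, (hK.const_div_atTop C).eventually_lt_const hε]
          with d a b c e using ⟨a, b, c, e⟩
      obtain ⟨d, hd0, hd1, hd2, hd3⟩ := ev.exists
      refine ⟨d, hd0, ?_⟩
      filter_upwards [hdiv (2 * π) ε hε] with n hn s t hst hd
      rcases (hG n).modulus (Nat.succ_pos n) hM hst hd hd1.le hd2 with hc | hc
      · exact hc.trans hn.le
      · exact hc.trans hd3.le)
  have hle : (hyperfilter ℕ : Filter ℕ) ≤ atTop := Nat.hyperfilter_le_atTop
  refine ⟨h, h1, h2, ?_, ?_, ?_⟩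
  · refine tendsto_nhds_unique (h3 0) ?_
    simp only [fun n => (hG n).hs_zero]
    exact tendsto_const_nhds
  · refine tendsto_nhds_unique (h3 (2 * π)) ?_
    simp only [fun n => (hG n).hs_end (Nat.succ_pos n)]
    exact tendsto_const_nhds
  · intro ε hε
    obtain ⟨δ, hδ, hu⟩ := Metric.uniformContinuous_iff.1 hφ ε hε
    obtain ⟨δ', hδ', hu'⟩ := Metric.uniformContinuous_iff.1 hφ (ε / (6 * π)) (by positivity)
    obtain ⟨A, hA⟩ := (Kt_tendsto.eventually_lt_const (show 0 < ε / 6 by positivity)).exists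
    have ev := (((h4 _ (lt_min hε (half_pos hδ))).and
      (hle (hdiv (2 * π) δ' hδ'))).and (hle (hdiv (4 * π * A) (ε / 3) (by positivity))))
    obtain ⟨n, ⟨⟨a1, a2⟩, a3⟩⟩ := ev.exists
    refine ⟨n + 1, Nat.succ_pos n, Z n, κs n, hG n, fun t ht => ⟨?_, ?_⟩, ?_⟩
    · exact (a1 t ht).trans (min_le_left _ _)
    · have := (a1 t ht).trans (min_le_right _ _)
      refine le_of_lt (hu ?_)
      rw [Real.dist_eq]
      linarith
    · refine ((hG n).EE_L1 (Nat.succ_pos n) hφ.continuous hM (ω := ε / (6 * π)) ?_ A).trans ?_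
      · intro j
        refine le_of_lt (hu' ?_)
        rw [Real.dist_eq]
        have : 2 * π * ((j + 1 : ℤ) : ℝ) / ((n + 1 : ℕ) : ℝ) - 2 * π * j / ((n + 1 : ℕ) : ℝ)
          = 2 * π / ((n + 1 : ℕ) : ℝ) := by push_cast; ring
        rw [this, abs_of_nonneg (by positivity)]
        exact a2
      · have : 2 * π * (ε / (6 * π)) = ε / 3 := by field_simp; norm_num
        linarith

lemma DD_E_le {E : ℝ → ℝ} (hE : ∀ a b, IntervalIntegrable E volume a b) {a b s c ε : ℝ}
    (hs : 0 < s) (ha : 0 ≤ a) (hb : b - a = 4 * s) (h2 : b ≤ 2 * π) (hc : |c| ≤ s)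
    (hint : ∫ t in (0:ℝ)..(2 * π), |E t| ≤ ε) :
    ∫ t in (a + s)..(b - s), |E (t + c)| ≤ ε := by
  rw [intervalIntegral.integral_comp_add_right (fun t => |E t|)]
  have := abs_le.1 hc
  refine le_trans ?_ hint
  refine intervalIntegral.integral_mono_interval (by linarith) (by linarith) (by linarith)
    (Filter.Eventually.of_forall fun _ => abs_nonneg _) (hE _ _).abs

lemma strict_of_limit (hφ : Continuous φ) {M : ℝ} (hM : ∀ x, |φ x| ≤ M) {h : ℝ → ℝ}
    (hm : Monotone h)
    (hl : ∀ ε > 0, ∃ N : ℕ, 0 < N ∧ ∃ z κ, Good N φ z κ ∧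
        (∀ t ∈ Set.Icc 0 (2 * π), |hs N z t - h t| ≤ ε ∧ |φ (hs N z t) - φ (h t)| ≤ ε) ∧
        ∫ t in (0:ℝ)..(2 * π), |EE N φ z κ t| ≤ ε) :
    StrictMonoOn h (Set.Icc 0 (2 * π)) := by
  have hpi := Real.pi_pos
  intro a ha b hb hab
  refine lt_of_le_of_ne (hm hab.le) fun heq => ?_
  set s := (b - a) / 4 with hs
  have hs0 : 0 < s := by rw [hs]; linarith
  have hba : b - a = 4 * s := by rw [hs]; ring
  have hγ := second_diff_pos (s := s) hs0 (by linarith [ha.1, hb.2])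
  set γ := (-Real.log (1 - Real.sin (s / 2) ^ 2)) with hγd
  have hC1 := C1_nonneg
  set C := 4 + 8 * s + (4 * s * γ + 8 * C1) / π with hC
  have hCpos : 0 < C := by positivity
  obtain ⟨N, hN, z, κ, hG, hu, hE⟩ := hl (2 * s * γ / C) (by positivity)
  set ε := 2 * s * γ / C with hε
  have hεpos : 0 < ε := by positivity
  have hεC : ε * C = 2 * s * γ := by rw [hε]; field_simp
  have key := DD_UU hN hG hs0 ha.1 hba hb.2
  rw [← hγd] at key
  have hd : JW.hs N z b - JW.hs N z a ≤ 2 * ε := by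
    have h1 := abs_le.1 (hu a ha).1
    have h2 := abs_le.1 (hu b hb).1
    linarith [h1.1, h1.2, h2.1, h2.2]
  have hEi := fun a b => EE_integrable (N := N) (z := z) (κ := κ) hφ hM a b
  have hUi := UU_integrable N z
  have up : DD a b s (UU N z) ≤ 4 * ε + 2 * s * (4 * ε) := by
    have hi1 : IntervalIntegrable (fun t => |EE N φ z κ (t + s)|) volume (a + s) (b - s) :=
      (add_integrable hEi s _ _).abs
    have hi2 : IntervalIntegrable (fun t => |EE N φ z κ (t + -s)|) volume (a + s) (b - s) :=
      (add_integrable hEi (-s) _ _).abs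
    have hi3 : IntervalIntegrable (fun t => |EE N φ z κ (t + 0)|) volume (a + s) (b - s) :=
      (add_integrable hEi 0 _ _).abs
    have e1 := DD_E_le hEi (c := s) hs0 ha.1 hba hb.2 (by rw [abs_of_pos hs0]) hE
    have e2 := DD_E_le hEi (c := -s) hs0 ha.1 hba hb.2 (by rw [abs_neg, abs_of_pos hs0]) hE
    have e3 := DD_E_le hEi (c := 0) hs0 ha.1 hba hb.2 (by simpa using hs0.le) hE
    have : DD a b s (UU N z) ≤ ∫ t in (a + s)..(b - s), (|EE N φ z κ (t + s)| +
        |EE N φ z κ (t + -s)| + 2 * |EE N φ z κ (t + 0)| + 4 * ε) := by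
      unfold DD
      refine intervalIntegral.integral_mono_on (by linarith) ?_ ?_ ?_
      · exact ((add_integrable hUi s _ _).add (translate_integrable hUi s _ _)).sub
          ((hUi _ _).const_mul 2)
      · exact ((hi1.add hi2).add (hi3.const_mul 2)).add intervalIntegrable_const
      · intro t ht
        have hconst : ∀ x ∈ Set.Icc a b, |φ (JW.hs N z x) - φ (h a)| ≤ ε := by
          intro x hx
          have : h x = h a := le_antisymm (heq ▸ hm hx.2) (hm hx.1)
          rw [← this]
          exact (hu x ⟨ha.1.trans hx.1, hx.2.trans hb.2⟩).2
        have c1 := abs_le.1 (hconst (t + s) ⟨by linarith [ht.1], by linarith [ht.2]⟩)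
        have c2 := abs_le.1 (hconst (t - s) ⟨by linarith [ht.1], by linarith [ht.2]⟩)
        have c3 := abs_le.1 (hconst t ⟨by linarith [ht.1], by linarith [ht.2]⟩)
        have d1 := le_abs_self (EE N φ z κ (t + s))
        have d2 := le_abs_self (EE N φ z κ (t - s))
        have d3 := neg_abs_le (EE N φ z κ t)
        rw [← sub_eq_add_neg, add_zero]
        have f : ∀ x, UU N z x = EE N φ z κ x + κ + φ (JW.hs N z x) := fun x => by
          unfold EE; ring
        rw [f (t + s), f (t - s), f t]
        linarith [c1.2, c2.2, c3.1]
    refine this.trans ?_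
    rw [intervalIntegral.integral_add ((hi1.add hi2).add (hi3.const_mul 2))
      intervalIntegrable_const, intervalIntegral.integral_add (hi1.add hi2) (hi3.const_mul 2),
      intervalIntegral.integral_add hi1 hi2, intervalIntegral.integral_const_mul,
      intervalIntegral.integral_const, smul_eq_mul]
    have : b - s - (a + s) = 2 * s := by linarith
    rw [this]
    linarith
  have h3 : (JW.hs N z b - JW.hs N z a) / (2 * π) * (4 * s * γ + 8 * C1)
      ≤ ε * ((4 * s * γ + 8 * C1) / π) := by
    calc (JW.hs N z b - JW.hs N z a) / (2 * π) * (4 * s * γ + 8 * C1)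
        ≤ (2 * ε) / (2 * π) * (4 * s * γ + 8 * C1) := by gcongr
      _ = ε * ((4 * s * γ + 8 * C1) / π) := by field_simp
  have h4 : ε * C = 4 * ε + 2 * s * (4 * ε) + ε * ((4 * s * γ + 8 * C1) / π) := by
    rw [hC]; ring
  have : 0 < s * γ := by positivity
  linarith

lemma exp_norm (k : ℕ) (t : ℝ) : ‖Complex.exp (-(k:ℂ) * Complex.I * t)‖ = 1 := by
  rw [show -(k:ℂ) * Complex.I * t = ((-(k:ℝ) * t : ℝ) : ℂ) * Complex.I by push_cast; ring]
  exact Complex.norm_exp_ofReal_mul_I _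

lemma int_small {g : ℝ → ℝ} {k : ℕ} {ε : ℝ} (hg : ∀ t ∈ Set.Icc 0 (2 * π), |g t| ≤ ε) :
    ‖∫ t in (0:ℝ)..(2 * π), (g t : ℂ) * Complex.exp (-(k:ℂ) * Complex.I * t)‖ ≤ 2 * π * ε := by
  have hpi := Real.pi_pos
  have := intervalIntegral.norm_integral_le_of_norm_le_const (a := 0) (b := 2 * π) (C := ε)
    (f := fun t : ℝ => (g t : ℂ) * Complex.exp (-(k:ℂ) * Complex.I * t)) (by
      intro t ht
      rw [Set.uIoc_of_le (by positivity)] at ht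
      rw [norm_mul, exp_norm, mul_one, Complex.norm_real]
      exact hg t ⟨ht.1.le, ht.2⟩)
  rw [sub_zero, abs_of_pos (by positivity)] at this
  linarith

lemma int_small_L1 {g : ℝ → ℝ} {k : ℕ} {ε : ℝ} (hg : ∫ t in (0:ℝ)..(2 * π), |g t| ≤ ε) :
    ‖∫ t in (0:ℝ)..(2 * π), (g t : ℂ) * Complex.exp (-(k:ℂ) * Complex.I * t)‖ ≤ ε := by
  refine (intervalIntegral.norm_integral_le_integral_norm (by positivity)).trans ?_
  simp only [norm_mul, exp_norm, mul_one, Complex.norm_real]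
  exact hg

lemma fourier_of_limit (hφ : Continuous φ) {M : ℝ} (hM : ∀ x, |φ x| ≤ M) {h : ℝ → ℝ}
    (hc : Continuous h)
    (hl : ∀ ε > 0, ∃ N : ℕ, 0 < N ∧ ∃ z κ, Good N φ z κ ∧
        (∀ t ∈ Set.Icc 0 (2 * π), |hs N z t - h t| ≤ ε ∧ |φ (hs N z t) - φ (h t)| ≤ ε) ∧
        ∫ t in (0:ℝ)..(2 * π), |EE N φ z κ t| ≤ ε) (k : ℕ) (hk : 0 < k) :
    ∫ t in (0:ℝ)..(2 * π), ((h t - t : ℝ) : ℂ) * Complex.exp (-(k:ℂ) * Complex.I * t)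
      = -Complex.I * ∫ t in (0:ℝ)..(2 * π), (φ (h t) : ℂ) * Complex.exp (-(k:ℂ) * Complex.I * t) := by
  have hpi := Real.pi_pos
  rw [← sub_eq_zero, ← norm_eq_zero]
  refine le_antisymm (le_of_forall_pos_le_add fun ε' hε' => ?_) (norm_nonneg _)
  rw [zero_add]
  obtain ⟨N, hN, z, κ, hG, hu, hE⟩ := hl (ε' / (4 * π + 1)) (by positivity)
  set ε := ε' / (4 * π + 1) with hε
  have hεe : 2 * π * ε + 2 * π * ε + ε = ε' := by rw [hε]; field_simp; ring
  set e : ℝ → ℂ := fun t => Complex.exp (-(k:ℂ) * Complex.I * t) with he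
  have hec : Continuous e := exp_cont k
  have hI : ∀ {g : ℝ → ℝ}, IntervalIntegrable g volume 0 (2 * π) →
    IntervalIntegrable (fun t => (g t : ℂ) * e t) volume 0 (2 * π) := fun hg =>
    (ofReal_integrable hg).mul_continuousOn hec.continuousOn
  have hHi : IntervalIntegrable (hs N z) volume 0 (2 * π) := (hs_mono N z).intervalIntegrable
  have hid : IntervalIntegrable (fun t : ℝ => t) volume 0 (2 * π) :=
    continuous_id.intervalIntegrable _ _
  have hhi : IntervalIntegrable h volume 0 (2 * π) := hc.intervalIntegrable _ _
  have hphi : IntervalIntegrable (fun t => φ (h t)) volume 0 (2 * π) :=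
    (hφ.comp hc).intervalIntegrable _ _
  have hpHi := phi_hs_integrable hφ hM N z 0 (2 * π)
  have hEi := EE_integrable (N := N) (z := z) (κ := κ) hφ hM 0 (2 * π)
  have F := hG.fourier hN k hk
  have s1 : ∫ t in (0:ℝ)..(2 * π), (UU N z t : ℂ) * e t
      = (∫ t in (0:ℝ)..(2 * π), (EE N φ z κ t : ℂ) * e t)
        + ∫ t in (0:ℝ)..(2 * π), (φ (hs N z t) : ℂ) * e t := by
    have h0 : ∫ t in (0:ℝ)..(2 * π), (κ : ℂ) * e t = 0 := by
      rw [intervalIntegral.integral_const_mul, he, integral_exp, if_neg hk.ne']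
      simp
    rw [← add_zero (∫ t in (0:ℝ)..(2 * π), (EE N φ z κ t : ℂ) * e t), ← h0,
      ← intervalIntegral.integral_add (hI hEi) (hI (g := fun _ => κ) intervalIntegrable_const),
      ← intervalIntegral.integral_add ((hI hEi).add
        (hI (g := fun _ => κ) intervalIntegrable_const)) (hI hpHi)]
    congr 1
    funext t
    unfold EE
    push_cast
    ring
  have s2 : (∫ t in (0:ℝ)..(2 * π), ((h t - t : ℝ) : ℂ) * e t)
      = (∫ t in (0:ℝ)..(2 * π), ((hs N z t - t : ℝ) : ℂ) * e t)
        - ∫ t in (0:ℝ)..(2 * π), ((hs N z t - h t : ℝ) : ℂ) * e t := by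
    rw [← intervalIntegral.integral_sub (hI (hHi.sub hid)) (hI (hHi.sub hhi))]
    congr 1
    funext t
    push_cast
    ring
  have s3 : (∫ t in (0:ℝ)..(2 * π), (φ (h t) : ℂ) * e t)
      = (∫ t in (0:ℝ)..(2 * π), (φ (hs N z t) : ℂ) * e t)
        - ∫ t in (0:ℝ)..(2 * π), ((φ (hs N z t) - φ (h t) : ℝ) : ℂ) * e t := by
    rw [← intervalIntegral.integral_sub (hI hpHi) (hI (hpHi.sub hphi))]
    congr 1
    funext t
    push_cast
    ring
  have b1 := int_small (k := k) (fun t ht => (hu t ht).1)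
  have b2 := int_small (k := k) (fun t ht => (hu t ht).2)
  have b3 := int_small_L1 (k := k) hE
  change ‖(∫ t in (0:ℝ)..(2 * π), ((h t - t : ℝ) : ℂ) * e t) -
    -Complex.I * ∫ t in (0:ℝ)..(2 * π), (φ (h t) : ℂ) * e t‖ ≤ ε'
  change (∫ t in (0:ℝ)..(2 * π), ((hs N z t - t : ℝ) : ℂ) * e t) = 
    -Complex.I * ∫ t in (0:ℝ)..(2 * π), (UU N z t : ℂ) * e t at F
  change ‖∫ t in (0:ℝ)..(2 * π), ((hs N z t - h t : ℝ) : ℂ) * e t‖ ≤ _ at b1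
  change ‖∫ t in (0:ℝ)..(2 * π), ((φ (hs N z t) - φ (h t) : ℝ) : ℂ) * e t‖ ≤ _ at b2
  change ‖∫ t in (0:ℝ)..(2 * π), (EE N φ z κ t : ℂ) * e t‖ ≤ _ at b3
  rw [s2, s3, F, s1]
  set I1 := ∫ t in (0:ℝ)..(2 * π), ((hs N z t - h t : ℝ) : ℂ) * e t
  set I2 := ∫ t in (0:ℝ)..(2 * π), ((φ (hs N z t) - φ (h t) : ℝ) : ℂ) * e t
  set I3 := ∫ t in (0:ℝ)..(2 * π), (EE N φ z κ t : ℂ) * e t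
  set I4 := ∫ t in (0:ℝ)..(2 * π), (φ (hs N z t) : ℂ) * e t
  have : -Complex.I * (I3 + I4) - I1 - -Complex.I * (I4 - I2) = -(Complex.I * I3) + (-I1) +
      (-(Complex.I * I2)) := by ring
  rw [this]
  refine (norm_add₃_le).trans ?_
  simp only [norm_neg, norm_mul, Complex.norm_I, one_mul]
  linarith

end JW

namespace JW
open MeasureTheory

lemma coeff_eq [inst : Fact ((0 : ℝ) < 2 * π)] (g : ℝ → ℝ) (k : ℤ) :
    fourierCoeff (AddCircle.liftIco (2 * π) 0 (fun t : ℝ => ((g t : ℝ) : ℂ))) k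
      = ((1 / (2 * π) : ℝ) : ℂ) * 
        ∫ t in (0:ℝ)..(2 * π), (g t : ℂ) * Complex.exp (-(k:ℂ) * Complex.I * t) := by
  have hpi := Real.pi_pos
  rw [fourierCoeff_liftIco_eq, fourierCoeffOn_eq_integral, zero_add, sub_zero, Complex.real_smul]
  congr 2
  funext t
  rw [fourier_coe_apply, smul_eq_mul, mul_comm]
  congr 2
  push_cast
  have : (π:ℂ) ≠ 0 := by exact_mod_cast hpi.ne'
  field_simp

lemma J_conj (g : ℝ → ℝ) (k : ℕ) :
    ∫ t in (0:ℝ)..(2 * π), (g t : ℂ) * Complex.exp (-((-(k:ℤ) : ℤ):ℂ) * Complex.I * t)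
      = (starRingEnd ℂ) (∫ t in (0:ℝ)..(2 * π), (g t : ℂ) * Complex.exp (-(k:ℂ) * Complex.I * t)) := by
  have hpi := Real.pi_pos
  rw [intervalIntegral.integral_of_le (by positivity), intervalIntegral.integral_of_le (by positivity),
    ← integral_conj]
  congr 1
  funext t
  rw [map_mul, Complex.conj_ofReal, ← Complex.exp_conj]
  simp

theorem main [inst : Fact ((0 : ℝ) < 2 * π)]
    (f : AddCircle (2 * π) → ℝ) (hf : Continuous f) :
    ∃ (h : ℝ → ℝ) (c : ℝ),
      StrictMonoOn h (Set.Icc 0 (2 * π)) ∧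
      ContinuousOn h (Set.Icc 0 (2 * π)) ∧
      h '' Set.Icc 0 (2 * π) = Set.Icc 0 (2 * π) ∧
      h 0 = 0 ∧ h (2 * π) = 2 * π ∧
      (∀ k : ℤ,
        fourierCoeff
            (AddCircle.liftIco (2 * π) 0 (fun t : ℝ => ((h t - t + c : ℝ) : ℂ))) k =
          -Complex.I * (k.sign : ℂ) *
            fourierCoeff
              (AddCircle.liftIco (2 * π) 0 (fun t : ℝ => ((f (h t : ℝ) : ℝ) : ℂ))) k) := by
  have hpi := Real.pi_pos
  set φ : ℝ → ℝ := fun x => f (x : AddCircle (2 * π)) with hφd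
  have hφ : UniformContinuous φ := by
    have h1 : UniformContinuous f := CompactSpace.uniformContinuous_of_continuous hf
    have h2 : UniformContinuous (fun x : ℝ => (x : AddCircle (2 * π))) :=
      uniformContinuous_addMonoidHom_of_continuous
        (f := QuotientAddGroup.mk' (AddSubgroup.zmultiples (2 * π))) (AddCircle.continuous_mk' _)
    exact h1.comp h2
  have hp : Function.Periodic φ (2 * π) := fun x => by
    simp [hφd, AddCircle.coe_add_period]
  obtain ⟨M, hM⟩ : ∃ M, ∀ x, |φ x| ≤ M := by
    obtain ⟨M, hM⟩ := isCompact_univ.exists_bound_of_continuousOn hf.continuousOn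
    exact ⟨M, fun x => hM _ (Set.mem_univ _)⟩
  obtain ⟨h, hm, hc, h0, h1, hl⟩ := exists_limit hφ hp hM
  have hstrict := strict_of_limit hφ.continuous hM hm hl
  have hF := fourier_of_limit hφ.continuous hM hc hl
  set c : ℝ := -(∫ t in (0:ℝ)..(2 * π), (h t - t)) / (2 * π) with hcd
  have hcc : Continuous fun t => h t - t := hc.sub continuous_id
  have hpos : ∀ k : ℕ, 0 < k →
      ∫ t in (0:ℝ)..(2 * π), ((h t - t + c : ℝ) : ℂ) * Complex.exp (-(k:ℂ) * Complex.I * t)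
      = -Complex.I * ∫ t in (0:ℝ)..(2 * π), (φ (h t) : ℂ) * Complex.exp (-(k:ℂ) * Complex.I * t) := by
    intro k hk
    rw [← hF k hk]
    have e : ∀ t : ℝ, ((h t - t + c : ℝ) : ℂ) * Complex.exp (-(k:ℂ) * Complex.I * t)
      = ((h t - t : ℝ) : ℂ) * Complex.exp (-(k:ℂ) * Complex.I * t)
        + (c:ℂ) * Complex.exp (-(k:ℂ) * Complex.I * t) := fun t => by push_cast; ring
    simp only [e]
    rw [intervalIntegral.integral_add, intervalIntegral.integral_const_mul, integral_exp,
      if_neg hk.ne']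
    · simp
    · exact ((Complex.continuous_ofReal.comp hcc).mul (exp_cont k)).intervalIntegrable _ _
    · exact (continuous_const.mul (exp_cont k)).intervalIntegrable _ _
  refine ⟨h, c, hstrict, hc.continuousOn, ?_, h0, h1, ?_⟩
  · refine Set.Subset.antisymm ?_ ?_
    · rintro _ ⟨t, ht, rfl⟩
      exact ⟨h0 ▸ hm ht.1, h1 ▸ hm ht.2⟩
    · have := intermediate_value_Icc (show (0:ℝ) ≤ 2 * π by positivity) hc.continuousOn
      rwa [h0, h1] at this
  · intro k
    rw [coeff_eq (fun t => h t - t + c), coeff_eq (fun t => f (h t : ℝ))]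
    obtain ⟨n, rfl | rfl⟩ := k.eq_nat_or_neg
    · rcases Nat.eq_zero_or_pos n with rfl | hn
      · have : ∫ t in (0:ℝ)..(2 * π), (h t - t + c) = 0 := by
          rw [intervalIntegral.integral_add (hcc.intervalIntegrable _ _) intervalIntegrable_const,
            intervalIntegral.integral_const, smul_eq_mul, hcd]
          field_simp
          ring
        simp only [Nat.cast_zero, Int.cast_zero, neg_zero, zero_mul, Complex.exp_zero, mul_one,
          Int.sign_zero, mul_zero]
        rw [intervalIntegral.integral_ofReal, this]
        simp
      · have := hpos n hn
        rw [Int.sign_natCast_of_ne_zero hn.ne']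
        push_cast at this ⊢
        rw [this]
        ring
    · rcases Nat.eq_zero_or_pos n with rfl | hn
      · have : ∫ t in (0:ℝ)..(2 * π), (h t - t + c) = 0 := by
          rw [intervalIntegral.integral_add (hcc.intervalIntegrable _ _) intervalIntegrable_const,
            intervalIntegral.integral_const, smul_eq_mul, hcd]
          field_simp
          ring
        simp only [Nat.cast_zero, Int.cast_zero, neg_zero, zero_mul, Complex.exp_zero, mul_one,
          Int.sign_zero, mul_zero]
        rw [intervalIntegral.integral_ofReal, this]
        simp
      · rw [J_conj (fun t => h t - t + c), J_conj (fun t => f (h t : ℝ)), hpos n hn, Int.sign_neg,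
          Int.sign_natCast_of_ne_zero hn.ne', map_mul]
        simp only [map_neg, Complex.conj_I, hφd]
        push_cast
        ring

end JW

/-- Explicit form of the Jurkat–Waterman theorem: there is a strictly increasing
homeomorphism `h` of `[0, 2π]` onto itself fixing the endpoints, and a constant `c`, such that
the conjugate of the (periodization of) `f ∘ h` is exactly `t ↦ h t - t + c`. -/
theorem jurkat_waterman_explicit_conjugate
    [inst : Fact ((0 : ℝ) < 2 * π)]
    (f : AddCircle (2 * π) → ℝ) (hf : Continuous f) :
    ∃ (h : ℝ → ℝ) (c : ℝ),
      StrictMonoOn h (Set.Icc 0 (2 * π)) ∧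
      ContinuousOn h (Set.Icc 0 (2 * π)) ∧
      h '' Set.Icc 0 (2 * π) = Set.Icc 0 (2 * π) ∧
      h 0 = 0 ∧ h (2 * π) = 2 * π ∧
      (∀ k : ℤ,
        fourierCoeff
            (AddCircle.liftIco (2 * π) 0 (fun t : ℝ => ((h t - t + c : ℝ) : ℂ))) k =
          -Complex.I * (k.sign : ℂ) *
            fourierCoeff
              (AddCircle.liftIco (2 * π) 0 (fun t : ℝ => ((f (h t : ℝ) : ℝ) : ℂ))) k) :=
  JW.main f hf
end

section
/- Let f : 𝕋 → ℝ be a continuous real-valued function on the circle 𝕋 = ℝ/2πℤ. Then there exist a homeomorphism h of 𝕋 onto itself and a constant C > 0 such that the Fourier coefficients of the superposition satisfy |(f∘h)^(k)| ≤ C/|k| for every nonzero k ∈ ℤ. -/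
open scoped Real

section Part1x

open Set Metric Filter Topology

lemma tlu_of_pointwise {α β ι : Type*} [PseudoMetricSpace α] [PseudoMetricSpace β]
    {F : ι → α → β} {f : α → β} {l : Filter ι} [l.NeBot]
    {U : Set α} (hp : ∀ z ∈ U, Tendsto (fun n => F n z) l (𝓝 (f z)))
    (hL : ∀ z ∈ U, ∀ ε > 0, ∃ δ > 0, ∀ w ∈ U, dist w z < δ → ∀ n, dist (F n w) (F n z) ≤ ε) :
    TendstoLocallyUniformlyOn F f l U := by
  rw [Metric.tendstoLocallyUniformlyOn_iff]
  intro ε hε z hz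
  obtain ⟨δ, hδ, h⟩ := hL z hz (ε / 4) (by positivity)
  refine ⟨U ∩ ball z δ, inter_mem_nhdsWithin _ (ball_mem_nhds _ hδ), ?_⟩
  have h1 : ∀ᶠ n in l, dist (F n z) (f z) < ε / 4 :=
    (hp z hz).eventually (ball_mem_nhds _ (by positivity))
  filter_upwards [h1] with n hn y hy
  have h2 : dist (f y) (f z) ≤ ε / 4 :=
    le_of_tendsto ((hp y hy.1).dist (hp z hz)) (Eventually.of_forall fun n => h y hy.1 hy.2 n)
  have h3 := h y hy.1 hy.2 n
  calc dist (f y) (F n y) ≤ dist (f y) (f z) + dist (f z) (F n z) + dist (F n z) (F n y) :=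
        dist_triangle4 _ _ _ _
    _ < ε := by rw [dist_comm (f z), dist_comm (F n z) (F n y)]; linarith

lemma hurwitz_zero {ι : Type*} {l : Filter ι} [l.NeBot] {F : ι → ℂ → ℂ} {f : ℂ → ℂ} {U : Set ℂ}
    (hU : IsOpen U) (hUc : IsPreconnected U) (ht : TendstoLocallyUniformlyOn F f l U)
    (hF : ∀ n, DifferentiableOn ℂ (F n) U) (h0 : ∀ n, ∀ z ∈ U, F n z ≠ 0)
    {a : ℂ} (ha : a ∈ U) (hfa : f a = 0) : ∀ z ∈ U, f z = 0 := by
  have hfd : DifferentiableOn ℂ f U := ht.differentiableOn (Eventually.of_forall hF) hU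
  have hfa' : AnalyticOnNhd ℂ f U := hfd.analyticOnNhd hU
  rcases (hfa' a ha).eventually_eq_zero_or_eventually_ne_zero with h | h
  · exact hfa'.eqOn_zero_of_preconnected_of_eventuallyEq_zero hUc ha h
  exfalso
  rw [eventually_nhdsWithin_iff] at h
  obtain ⟨r, hr, hrs⟩ := Metric.nhds_basis_closedBall.mem_iff.1 (h.and (hU.mem_nhds ha))
  have hcb : closedBall a r ⊆ U := fun z hz => (hrs hz).2
  obtain ⟨x, hx, hmin⟩ := (isCompact_sphere a r).exists_isMinOn
    (NormedSpace.sphere_nonempty.2 hr.le)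
    ((hfd.continuousOn.mono (sphere_subset_closedBall.trans hcb)).norm)
  have hm : 0 < ‖f x‖ := norm_pos_iff.2 ((hrs (sphere_subset_closedBall hx)).1 (by
    rintro rfl; simp at hx; exact hr.ne hx))
  set m := ‖f x‖
  have htu := (tendstoLocallyUniformlyOn_iff_forall_isCompact hU).1 ht _ hcb
    (isCompact_closedBall a r)
  rw [Metric.tendstoUniformlyOn_iff] at htu
  obtain ⟨n, hn⟩ := (htu (m / 3) (by positivity)).exists
  have hb : ∀ z ∈ frontier (ball a r), ‖(F n z)⁻¹‖ ≤ (2 * m / 3)⁻¹ := by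
    intro z hz
    rw [frontier_ball a hr.ne'] at hz
    rw [norm_inv]
    have h1 : m ≤ ‖f z‖ := hmin hz
    have h2 := hn z (sphere_subset_closedBall hz)
    rw [dist_eq_norm] at h2
    have h3 := norm_sub_norm_le (f z) (F n z)
    gcongr
    linarith
  have hd : DiffContOnCl ℂ (fun z => (F n z)⁻¹) (ball a r) := by
    apply DifferentiableOn.diffContOnCl
    rw [closure_ball a hr.ne']
    exact ((hF n).mono hcb).inv fun z hz => h0 n z (hcb hz)
  have h4 := Complex.norm_le_of_forall_mem_frontier_norm_le isBounded_ball hd hb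
    (subset_closure (mem_ball_self hr))
  have h5 := hn a (mem_closedBall_self hr.le)
  rw [hfa, dist_zero_left] at h5
  rw [norm_inv] at h4
  have h6 := (inv_le_inv₀ (norm_pos_iff.2 (h0 n a ha)) (by positivity)).1 h4
  linarith

structure RFam (D : Set ℂ) (g : ℂ → ℂ) : Prop where
  diff : DifferentiableOn ℂ g D
  maps : MapsTo g D (ball 0 1)
  inj : InjOn g D
  zero : g 0 = 0
  deriv_ne : ∀ z ∈ D, deriv g z ≠ 0

lemma exists_extremal {D : Set ℂ} (hD : IsOpen D) (hDc : IsPreconnected D)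
    (h0 : (0 : ℂ) ∈ D) (hb : Bornology.IsBounded D) :
    ∃ g, RFam D g ∧ ∀ φ, RFam D φ → ‖deriv φ 0‖ ≤ ‖deriv g 0‖ := by
  obtain ⟨B, hB0, hB⟩ : ∃ B > 0, ∀ z ∈ D, ‖z‖ < B := by
    obtain ⟨B, hB⟩ := hb.subset_ball (0 : ℂ)
    refine ⟨max B 1, by positivity, fun z hz => ?_⟩
    have := hB hz
    simp at this
    exact lt_max_of_lt_left this
  obtain ⟨r, hr, hrD⟩ := Metric.isOpen_iff.1 hD 0 h0
  set S : Set ℝ := {x | ∃ g, RFam D g ∧ ‖deriv g 0‖ = x} with hS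
  have hSb : BddAbove S := by
    refine ⟨1 / r, ?_⟩
    rintro _ ⟨g, hg, rfl⟩
    refine Complex.norm_deriv_le_div_of_mapsTo_ball (hg.diff.mono hrD) ?_ hr
    rw [hg.zero]
    exact fun z hz => ball_subset_closedBall (hg.maps (hrD hz))
  have hid : RFam D (fun z => z / B) := by
    refine ⟨by fun_prop, fun z hz => ?_, ?_, by simp, ?_⟩
    · simp [abs_of_pos hB0, div_lt_one hB0, hB z hz]
    · intro z _ w _ h
      have : (B : ℂ) ≠ 0 := by exact_mod_cast hB0.ne'
      simpa [this] using h
    · intro z _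
      simp [hB0.ne']
  have hSn : S.Nonempty := ⟨_, _, hid, rfl⟩
  have hSpos : 0 < sSup S := by
    refine lt_of_lt_of_le ?_ (le_csSup hSb ⟨_, hid, rfl⟩)
    exact norm_pos_iff.2 (hid.deriv_ne 0 h0)
  obtain ⟨u, -, hu, huS⟩ := exists_seq_tendsto_sSup hSn hSb
  choose g hg hgu using huS
  let l : Filter ℕ := (hyperfilter ℕ : Filter ℕ)
  have hlim : ∀ z, ∃ y, z ∈ D → Tendsto (fun n => g n z) l (𝓝 y) := by
    intro z
    by_cases hz : z ∈ D
    · have := (isCompact_closedBall (0 : ℂ) 1).ultrafilter_le_nhds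
        ((hyperfilter ℕ).map (fun n => g n z)) (by
          rw [le_principal_iff]
          exact Ultrafilter.mem_map.2 (Filter.univ_mem' fun n =>
            ball_subset_closedBall ((hg n).maps hz)))
      obtain ⟨y, -, hy⟩ := this
      exact ⟨y, fun _ => hy⟩
    · exact ⟨0, fun h => absurd h hz⟩
  choose G hG using hlim
  have htlu : TendstoLocallyUniformlyOn g G l D := by
    refine tlu_of_pointwise hG fun z hz ε hε => ?_
    obtain ⟨s, hs, hsD⟩ := Metric.isOpen_iff.1 hD z hz
    refine ⟨min s (s * ε / 2), by positivity, fun w hw hwz n => ?_⟩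
    have h1 := Complex.dist_le_div_mul_dist_of_mapsTo_ball (f := g n) (c := z) (R₁ := s) (R₂ := 2)
      (z := w) ((hg n).diff.mono hsD) (fun x hx => by
        have h1 := (hg n).maps (hsD hx)
        have h2 := (hg n).maps hz
        simp at h1 h2
        rw [mem_closedBall, dist_eq_norm]
        exact (norm_sub_le _ _).trans (by linarith)) (lt_of_lt_of_le hwz (min_le_left _ _))
    refine h1.trans ?_
    have h2 := (hwz.trans_le (min_le_right _ _)).le
    calc 2 / s * dist w z ≤ 2 / s * (s * ε / 2) := by gcongr
      _ = ε := by field_simp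
  have hgd := fun n => (hg n).diff
  have hGd : DifferentiableOn ℂ G D := htlu.differentiableOn (Eventually.of_forall hgd) hD
  have hder := htlu.deriv (Eventually.of_forall hgd) hD
  have hG0 : G 0 = 0 := tendsto_nhds_unique (hG 0 h0) (by
    simp only [(hg _).zero]; exact tendsto_const_nhds)
  have hGder : ‖deriv G 0‖ = sSup S := by
    refine tendsto_nhds_unique ((hder.tendsto_at h0).norm) ?_
    refine (hu.mono_left (Nat.hyperfilter_le_atTop)).congr fun n => ?_
    simp [← hgu n]
  have hGder0 : deriv G 0 ≠ 0 := by
    rw [← norm_pos_iff, hGder]; exact hSpos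
  have hnc : ∀ a ∈ D, ∀ c, ¬ (∀ᶠ z in 𝓝 a, G z = c) := by
    intro a ha c hc
    have h1 : EqOn G (fun _ => c) D :=
      (hGd.analyticOnNhd hD).eqOn_of_preconnected_of_eventuallyEq
        (analyticOnNhd_const) hDc ha hc
    apply hGder0
    have h2 : G =ᶠ[𝓝 0] fun _ => c := by
      filter_upwards [hD.mem_nhds h0] with z hz using h1 hz
    rw [h2.deriv_eq]; simp
  have hGcl : ∀ z ∈ D, ‖G z‖ ≤ 1 := fun z hz =>
    le_of_tendsto (hG z hz).norm (Eventually.of_forall fun n => by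
      have := (hg n).maps hz
      simp at this
      exact this.le)
  refine ⟨G, ⟨hGd, ?_, ?_, hG0, ?_⟩, ?_⟩
  · intro z hz
    rw [mem_ball_zero_iff]
    refine lt_of_le_of_ne (hGcl z hz) fun h => ?_
    have h1 : EqOn (norm ∘ G) (Function.const ℂ ‖G z‖) D :=
      Complex.norm_eqOn_of_isPreconnected_of_isMaxOn hDc hD hGd hz
        (fun w hw => by simp only [mem_ofPred_eq, Function.comp]; rw [h]; exact hGcl w hw)
    have := h1 h0
    simp [hG0, h] at this
  · intro a ha b hb' hab
    by_contra hne
    obtain ⟨s, hs, hsD⟩ := Metric.isOpen_iff.1 hD a ha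
    set V := ball a (min s (dist a b)) with hV
    have hpos : 0 < min s (dist a b) := lt_min hs (dist_pos.2 hne)
    have hVD : V ⊆ D := (ball_subset_ball (min_le_left _ _)).trans hsD
    have hbV : b ∉ V := by
      rw [hV, mem_ball, dist_comm]; exact not_lt.2 (min_le_right _ _)
    have ht2 : TendstoLocallyUniformlyOn (fun n z => g n z - g n b) (fun z => G z - G b) l V := by
      refine (htlu.mono hVD).sub ?_
      exact (((hG b hb')).tendstoUniformlyOn_const _).tendstoLocallyUniformlyOn
    have h3 := hurwitz_zero isOpen_ball (convex_ball _ _).isPreconnected ht2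
      (fun n => (((hg n).diff.mono hVD)).sub_const _)
      (fun n z hz h => by
        have h4 := (hg n).inj (hVD hz) hb' (sub_eq_zero.1 h)
        exact hbV (h4 ▸ hz)) (mem_ball_self hpos) (by simp [hab])
    refine hnc a ha (G b) ?_
    filter_upwards [ball_mem_nhds a hpos] with z hz using sub_eq_zero.1 (h3 z hz)
  · intro z hz hz0
    exact hGder0 (hurwitz_zero hD hDc hder (fun n => (hgd n).deriv hD)
      (fun n w hw => (hg n).deriv_ne w hw) hz hz0 0 h0)
  · intro φ hφ
    rw [hGder]
    exact le_csSup hSb ⟨φ, hφ, rfl⟩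

end Part1x

section Part2x

open Set Metric Filter Topology ComplexConjugate

noncomputable def mob (a z : ℂ) : ℂ := (z - a) / (1 - conj a * z)

lemma mob_den {a z : ℂ} (ha : ‖a‖ < 1) (hz : ‖z‖ < 1) : 1 - conj a * z ≠ 0 := by
  intro h
  have h1 : conj a * z = 1 := (sub_eq_zero.1 h).symm
  have h2 : ‖a‖ * ‖z‖ = 1 := by
    rw [← RCLike.norm_conj a, ← norm_mul, h1, norm_one]
  nlinarith [norm_nonneg a, norm_nonneg z]

lemma mob_norm {a z : ℂ} (ha : ‖a‖ < 1) (hz : ‖z‖ < 1) : ‖mob a z‖ < 1 := by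
  rw [mob, norm_div, div_lt_one (norm_pos_iff.2 (mob_den ha hz))]
  apply lt_of_pow_lt_pow_left₀ 2 (norm_nonneg _)
  have ha2 : ‖a‖ ^ 2 < 1 := by nlinarith [norm_nonneg a]
  have hz2 : ‖z‖ ^ 2 < 1 := by nlinarith [norm_nonneg z]
  rw [Complex.sq_norm, Complex.normSq_apply] at *
  rw [Complex.sq_norm, Complex.normSq_apply] at *
  simp only [Complex.sub_re, Complex.sub_im, Complex.mul_re, Complex.mul_im, Complex.conj_re,
    Complex.conj_im, Complex.one_re, Complex.one_im]
  nlinarith [mul_pos (sub_pos.2 ha2) (sub_pos.2 hz2)]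

lemma mob_deriv {a z : ℂ} (ha : ‖a‖ < 1) (hz : ‖z‖ < 1) :
    HasDerivAt (mob a) ((1 - conj a * a) / (1 - conj a * z) ^ 2) z := by
  have h := ((hasDerivAt_id z).sub_const a).div
    (((hasDerivAt_id z).const_mul (conj a)).const_sub 1) (mob_den ha hz)
  convert! h using 1
  simp
  ring

lemma mob_self {a : ℂ} : mob a a = 0 := by simp [mob]

lemma mob_sub_ne {a : ℂ} (ha : ‖a‖ < 1) : 1 - conj a * a ≠ 0 := mob_den ha ha

lemma mob_inj {a z w : ℂ} (ha : ‖a‖ < 1) (hz : ‖z‖ < 1) (hw : ‖w‖ < 1)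
    (h : mob a z = mob a w) : z = w := by
  rw [mob, mob, div_eq_div_iff (mob_den ha hz) (mob_den ha hw)] at h
  have h2 : (1 - conj a * a) * (z - w) = 0 := by linear_combination h
  rcases mul_eq_zero.1 h2 with h3 | h3
  · exact absurd h3 (mob_sub_ne ha)
  · exact sub_eq_zero.1 h3

lemma hasDerivAt_sqrt_branch {k q : ℂ → ℂ} {q' z : ℂ} (hk : ContinuousAt k z)
    (hkq : ∀ x, k x ^ 2 = q x) (hq : HasDerivAt q q' z) (h0 : k z ≠ 0) :
    HasDerivAt k (q' / (2 * k z)) z := by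
  rw [hasDerivAt_iff_tendsto_slope] at hq ⊢
  have h1 : Tendsto (fun w => k w + k z) (𝓝[≠] z) (𝓝 (2 * k z)) := by
    rw [two_mul]
    exact (hk.tendsto.mono_left nhdsWithin_le_nhds).add tendsto_const_nhds
  have h2 : 2 * k z ≠ 0 := by simp [h0]
  refine (hq.div h1 h2).congr' ?_
  filter_upwards [h1.eventually_ne h2] with w hw
  simp only [Pi.div_apply, slope_def_field, ← hkq]
  rw [div_right_comm]
  congr 1
  rw [div_eq_iff hw]; ring

lemma extremal_onto {D : Set ℂ} (hD : IsOpen D) (hDc : IsSimplyConnected D)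
    (h0 : (0 : ℂ) ∈ D) {g : ℂ → ℂ} (hg : RFam D g)
    (hext : ∀ φ, RFam D φ → ‖deriv φ 0‖ ≤ ‖deriv g 0‖) {a : ℂ} (ha : ‖a‖ < 1) :
    ∃ z ∈ D, g z = a := by
  by_contra! hcon
  have hgn : ∀ z ∈ D, ‖g z‖ < 1 := fun z hz => by simpa using hg.maps hz
  have hgd : ∀ z ∈ D, HasDerivAt g (deriv g z) z := fun z hz =>
    ((hg.diff z hz).differentiableAt (hD.mem_nhds hz)).hasDerivAt
  have hqd : ∀ z ∈ D, HasDerivAt (fun z => mob a (g z))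
      ((1 - conj a * a) / (1 - conj a * g z) ^ 2 * deriv g z) z := fun z hz =>
    (mob_deriv ha (hgn z hz)).comp z (hgd z hz)
  have hq0 : ∀ z ∈ D, mob a (g z) ≠ 0 := fun z hz h => by
    rw [← mob_self (a := a)] at h
    exact hcon z hz (mob_inj ha (hgn z hz) ha h)
  obtain ⟨k, hkc, hk⟩ := Complex.exists_continuousOn_pow_eq hDc hD
    (g := fun z => mob a (g z)) (fun z hz => (hqd z hz).continuousAt.continuousWithinAt)
    (by rintro ⟨z, hz, h⟩; exact hq0 z hz h) two_ne_zero
  have hk0 : ∀ z ∈ D, k z ≠ 0 := fun z hz h => hq0 z hz (by rw [← hk, h]; simp)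
  have hkd := fun z hz => hasDerivAt_sqrt_branch (hkc.continuousAt (hD.mem_nhds hz)) hk
    (hqd z hz) (hk0 z hz)
  have hkn : ∀ z ∈ D, ‖k z‖ < 1 := fun z hz => by
    have h1 := mob_norm ha (hgn z hz)
    rw [← hk, norm_pow] at h1
    by_contra! h2
    nlinarith
  set b := k 0 with hb
  have hbn : ‖b‖ < 1 := hkn 0 h0
  have hφd := fun z hz => (mob_deriv hbn (hkn z hz)).comp z (hkd z hz)
  have hφ : RFam D (mob b ∘ k) := by
    refine ⟨fun z hz => (hφd z hz).differentiableAt.differentiableWithinAt,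
      fun z hz => by simpa using mob_norm hbn (hkn z hz), ?_, mob_self, ?_⟩
    · intro z hz w hw h
      have h1 := mob_inj hbn (hkn z hz) (hkn w hw) h
      have h2 : mob a (g z) = mob a (g w) := by rw [← hk, ← hk, h1]
      exact hg.inj hz hw (mob_inj ha (hgn z hz) (hgn w hw) h2)
    · intro z hz
      rw [(hφd z hz).deriv]
      exact mul_ne_zero (div_ne_zero (mob_sub_ne hbn) (pow_ne_zero _ (mob_den hbn (hkn z hz))))
        (div_ne_zero (mul_ne_zero (div_ne_zero (mob_sub_ne ha)
          (pow_ne_zero _ (mob_den ha (hgn z hz)))) (hg.deriv_ne z hz))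
          (mul_ne_zero two_ne_zero (hk0 z hz)))
  have h1 := hext _ hφ
  rw [(hφd 0 h0).deriv] at h1
  have hgz : 0 < ‖deriv g 0‖ := norm_pos_iff.2 (hg.deriv_ne 0 h0)
  have hb2 : ‖b‖ ^ 2 = ‖a‖ := by
    rw [← norm_pow, hb, hk, hg.zero]; simp [mob]
  have hbp : 0 < ‖b‖ := norm_pos_iff.2 (hk0 0 h0)
  have hcc : ∀ c : ℂ, ‖c‖ < 1 → ‖1 - conj c * c‖ = 1 - ‖c‖ ^ 2 := by
    intro c hc
    rw [Complex.conj_mul']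
    have : (1 : ℂ) - (‖c‖ : ℂ) ^ 2 = ((1 - ‖c‖ ^ 2 : ℝ) : ℂ) := by push_cast; ring
    rw [this, Complex.norm_real, Real.norm_of_nonneg]
    nlinarith [norm_nonneg c]
  rw [norm_mul, norm_div, norm_pow, ← hb, hcc b hbn, norm_div, norm_mul, norm_div, hcc a ha,
    hg.zero, norm_mul] at h1
  simp only [mul_zero, sub_zero, norm_one, one_pow, div_one, ← hb2, RCLike.norm_ofNat] at h1
  have h3 : 0 < 1 - ‖b‖ ^ 2 := by nlinarith
  have h4 : (1 - ‖b‖ ^ 2) / (1 - ‖b‖ ^ 2) ^ 2 * ((1 - (‖b‖ ^ 2) ^ 2) * ‖deriv g 0‖ / (2 * ‖b‖))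
      = (1 + ‖b‖ ^ 2) / (2 * ‖b‖) * ‖deriv g 0‖ := by
    field_simp; ring
  rw [h4] at h1
  have h5 : 1 < (1 + ‖b‖ ^ 2) / (2 * ‖b‖) := by
    rw [one_lt_div (by positivity)]
    nlinarith [sq_pos_of_pos (sub_pos.2 hbn)]
  nlinarith

theorem riemann_star {D : Set ℂ} (hD : IsOpen D) (hs : StarConvex ℝ 0 D)
    (h0 : (0 : ℂ) ∈ D) (hb : Bornology.IsBounded D) :
    ∃ F G : ℂ → ℂ, DifferentiableOn ℂ F (ball 0 1) ∧ MapsTo F (ball 0 1) D ∧ F 0 = 0 ∧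
      DifferentiableOn ℂ G D ∧ MapsTo G D (ball 0 1) ∧ G 0 = 0 ∧
      (∀ z ∈ ball (0 : ℂ) 1, G (F z) = z) ∧ (∀ z ∈ D, F (G z) = z) := by
  have hsc : IsSimplyConnected D := by
    have := hs.contractibleSpace ⟨0, h0⟩
    exact SimplyConnectedSpace.ofContractible D
  obtain ⟨g, hg, hext⟩ := exists_extremal hD hsc.isPathConnected.isConnected.isPreconnected h0 hb
  have honto : ∀ a ∈ ball (0 : ℂ) 1, ∃ z ∈ D, g z = a := fun a ha =>
    extremal_onto hD hsc h0 hg hext (by simpa using ha)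
  have hFG : ∀ z ∈ D, Function.invFunOn g D (g z) = z := fun z hz =>
    hg.inj.leftInvOn_invFunOn hz
  refine ⟨Function.invFunOn g D, g, ?_, ?_, ?_, hg.diff, hg.maps, hg.zero, ?_, hFG⟩
  · intro a ha
    obtain ⟨z, hz, rfl⟩ := honto a ha
    have hst : HasStrictDerivAt g (deriv g z) z :=
      ((hg.diff.analyticOnNhd hD) z hz).hasStrictDerivAt
    have hmap := hst.map_nhds_eq (hg.deriv_ne z hz)
    have hc : ContinuousAt (Function.invFunOn g D) (g z) := by
      rw [ContinuousAt, hFG z hz, ← hmap, tendsto_map'_iff]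
      refine tendsto_id.congr' ?_
      filter_upwards [hD.mem_nhds hz] with w hw using (hFG w hw).symm
    refine (HasDerivAt.of_local_left_inverse (f := g) (f' := deriv g z) hc ?_
      (hg.deriv_ne z hz) ?_).differentiableAt.differentiableWithinAt
    · rw [hFG z hz]; exact hst.hasDerivAt
    · rw [← hmap, eventually_map]
      filter_upwards [hD.mem_nhds hz] with w hw
      rw [hFG w hw]
  · intro a ha
    obtain ⟨z, hz, rfl⟩ := honto a ha
    rw [hFG z hz]; exact hz
  · have := hFG 0 h0
    rwa [hg.zero] at this
  · intro a ha
    obtain ⟨z, hz, rfl⟩ := honto a ha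
    rw [hFG z hz]

end Part2x

section Part3x

open Set Metric Filter Topology ComplexConjugate

theorem exists_starlike_log {D : Set ℂ} (hD : IsOpen D) (hs : StarConvex ℝ 0 D) {m M : ℝ}
    (hm : 0 < m) (hmD : ball 0 m ⊆ D) (hDM : D ⊆ ball 0 M) :
    ∃ H : ℂ → ℂ, DifferentiableOn ℂ H (ball 0 1) ∧
      (∀ z ∈ ball (0 : ℂ) 1, z * Complex.exp (H z) ∈ D) ∧
      (∀ z ∈ ball (0 : ℂ) 1, 0 ≤ (1 + z * deriv H z).re) ∧
      (∀ z ∈ ball (0 : ℂ) 1, Real.log m ≤ (H z).re ∧ (H z).re ≤ Real.log M) ∧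
      (∀ K ⊆ D, IsCompact K → ∃ R < 1, ∀ z ∈ ball (0 : ℂ) 1, R < ‖z‖ →
        z * Complex.exp (H z) ∉ K) := by
  have h0 : (0 : ℂ) ∈ D := hmD (mem_ball_self hm)
  obtain ⟨F, G, hFd, hFm, hF0, hGd, hGm, hG0, hGF, hFG⟩ :=
    riemann_star hD hs h0 (isBounded_ball.subset hDM)
  have hM : 0 < M := by
    have := hDM h0
    simpa using this
  have h01 : (0 : ℂ) ∈ ball (0 : ℂ) 1 := by simp
  have hdF : ∀ z ∈ ball (0 : ℂ) 1, HasDerivAt F (deriv F z) z := fun z hz =>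
    ((hFd z hz).differentiableAt (isOpen_ball.mem_nhds hz)).hasDerivAt
  have hdG : ∀ z ∈ D, HasDerivAt G (deriv G z) z := fun z hz =>
    ((hGd z hz).differentiableAt (hD.mem_nhds hz)).hasDerivAt
  have hGF' : ∀ z ∈ ball (0 : ℂ) 1, deriv G (F z) * deriv F z = 1 := by
    intro z hz
    have h1 := (hdG _ (hFm hz)).comp z (hdF z hz)
    have h2 : HasDerivAt (G ∘ F) 1 z := by
      refine (hasDerivAt_id z).congr_of_eventuallyEq ?_
      filter_upwards [isOpen_ball.mem_nhds hz] with w hw using hGF w hw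
    exact h1.unique h2
  set q := dslope F 0 with hq
  have hqd : DifferentiableOn ℂ q (ball 0 1) :=
    (Complex.differentiableOn_dslope (isOpen_ball.mem_nhds h01)).2 hFd
  have hFq : ∀ z, F z = z * q z := fun z => by
    have := sub_smul_dslope F 0 z
    simpa [hF0] using this.symm
  have hqM : ∀ z ∈ ball (0 : ℂ) 1, ‖q z‖ ≤ M := fun z hz => by
    have := Complex.norm_dslope_le_div_of_mapsTo_ball (R₂ := M) hFd (by
      rw [hF0]; exact fun w hw => ball_subset_closedBall (hDM (hFm hw))) hz
    simpa using this
  have hGmap : MapsTo G (ball 0 m) (closedBall (G 0) 1) := by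
    rw [hG0]; exact fun w hw => ball_subset_closedBall (hGm (hmD hw))
  have hqm : ∀ z ∈ ball (0 : ℂ) 1, m ≤ ‖q z‖ := by
    intro z hz
    have hz1 : ‖z‖ < 1 := by simpa using hz
    rcases eq_or_ne z 0 with rfl | hz0
    · have h1 := Complex.norm_deriv_le_div_of_mapsTo_ball (hGd.mono hmD) hGmap hm
      have h2 := hGF' 0 h01
      rw [hF0] at h2
      have h3 : ‖deriv G 0‖ * ‖deriv F 0‖ = 1 := by rw [← norm_mul, h2, norm_one]
      rw [hq, dslope_same]
      rw [le_div_iff₀ hm] at h1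
      by_contra! h4
      have h5 : 0 < ‖deriv G 0‖ := by
        rcases (norm_nonneg (deriv G 0)).eq_or_lt with h | h
        · rw [← h] at h3; simp at h3
        · exact h
      nlinarith
    · have hzp : 0 < ‖z‖ := norm_pos_iff.2 hz0
      have h1 : m * ‖z‖ ≤ ‖F z‖ := by
        by_cases hc : ‖F z‖ < m
        · have := Complex.dist_le_div_mul_dist_of_mapsTo_ball (z := F z) (hGd.mono hmD) hGmap
            (by simpa using hc)
          rw [hGF z hz, hG0] at this
          simp only [dist_zero_right] at this
          rw [div_mul_eq_mul_div, one_mul, le_div_iff₀ hm] at this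
          linarith
        · push Not at hc
          nlinarith
      rw [hFq, norm_mul] at h1
      nlinarith
  have hq0 : ∀ z ∈ ball (0 : ℂ) 1, q z ≠ 0 := fun z hz h => by
    have := hqm z hz
    rw [h, norm_zero] at this
    linarith
  have hqd' : ∀ z ∈ ball (0 : ℂ) 1, HasDerivAt q (deriv q z) z := fun z hz =>
    ((hqd z hz).differentiableAt (isOpen_ball.mem_nhds hz)).hasDerivAt
  obtain ⟨H, hH0, hH⟩ := (DifferentiableOn.isExactOn_ball
    (f := fun z => deriv q z / q z) ((hqd.deriv isOpen_ball).div hqd hq0)).with_val_at 0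
      (Complex.log (q 0))
  have hexp : ∀ z ∈ ball (0 : ℂ) 1, q z = Complex.exp (H z) := by
    have hc : ∀ z ∈ ball (0 : ℂ) 1,
        HasDerivAt (fun z => q z * Complex.exp (-H z)) 0 z := fun z hz => by
      convert! (hqd' z hz).mul ((hH z hz).neg.cexp) using 1
      have := hq0 z hz
      field_simp
      ring
    intro z hz
    have h1 := (convex_ball (0 : ℂ) 1).is_const_of_fderivWithin_eq_zero (𝕜 := ℂ)
      (f := fun z => q z * Complex.exp (-H z))
      (fun w hw => (hc w hw).differentiableAt.differentiableWithinAt)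
      (fun w hw => by
        rw [fderivWithin_of_isOpen isOpen_ball hw]
        have := (hc w hw).hasFDerivAt.fderiv
        rw [this]; ext; simp) hz h01
    simp only [hH0, Complex.exp_neg, Complex.exp_log (hq0 0 h01), mul_inv_cancel₀ (hq0 0 h01)] at h1
    exact (mul_inv_eq_one₀ (Complex.exp_ne_zero _)).1 h1
  have hFH : ∀ z ∈ ball (0 : ℂ) 1, z * Complex.exp (H z) = F z := fun z hz => by
    rw [hFq, hexp z hz]
  have hre : ∀ z ∈ ball (0 : ℂ) 1, (H z).re = Real.log ‖q z‖ := fun z hz => by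
    rw [hexp z hz, Complex.norm_exp, Real.log_exp]
  refine ⟨H, fun z hz => (hH z hz).differentiableAt.differentiableWithinAt,
    fun z hz => by rw [hFH z hz]; exact hFm hz, ?_, ?_, ?_⟩
  · intro z hz
    rcases eq_or_ne z 0 with rfl | hz0
    · simp
    set P := 1 + z * deriv H z with hP
    have hFP : z * deriv F z = F z * P := by
      have h1 : HasDerivAt F (q z + z * deriv q z) z := by
        have h2 := (hasDerivAt_id z).mul (hqd' z hz)
        simp only [one_mul, id] at h2
        refine h2.congr_of_eventuallyEq (Eventually.of_forall fun w => hFq w)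
      rw [h1.deriv, hFq, hP, (hH z hz).deriv]
      have := hq0 z hz
      field_simp
    set w := deriv G (F z) * F z with hw
    have hwP : w * P = z := by
      rw [hw, mul_assoc, ← hFP, mul_left_comm, hGF' z hz, mul_one]
    have hγ : HasDerivAt (fun τ : ℝ => G (τ * F z)) w 1 := by
      have h1 : HasDerivAt (fun τ : ℝ => (τ : ℂ) * F z) (F z) 1 := by
        have := (Complex.ofRealCLM.hasDerivAt (x := (1 : ℝ))).mul_const (F z)
        simpa using this
      have h2 : HasDerivAt G (deriv G (F z)) (((1 : ℝ) : ℂ) * F z) := by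
        simpa using hdG _ (hFm hz)
      exact h2.comp (1 : ℝ) h1
    have hn := hγ.norm_sq
    have hle : ∀ τ ∈ Ioo (0 : ℝ) 1, ‖G (τ * F z)‖ ≤ ‖z‖ := by
      intro τ hτ
      have hτD : ∀ v ∈ ball (0 : ℂ) 1, (τ : ℂ) * F v ∈ D := fun v hv => by
        have := hs.smul_mem (hFm hv) hτ.1.le hτ.2.le
        simpa using this
      refine Complex.norm_le_norm_of_mapsTo_ball (f := fun v => G (τ * F v)) (R := 1) ?_ ?_ ?_
        (by simpa using hz)
      · exact hGd.comp (hFd.const_mul _) hτD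
      · exact fun v hv => ball_subset_closedBall (hGm (hτD v hv))
      · simp [hF0, hG0]
    have hnn : 0 ≤ 2 * inner ℝ (G ((1 : ℝ) * F z)) w := by
      rw [hasDerivAt_iff_tendsto_slope] at hn
      have hn2 := hn.mono_left (nhdsWithin_mono (1 : ℝ) (s := Iio 1) fun x hx => ne_of_lt hx)
      refine ge_of_tendsto hn2 ?_
      filter_upwards [Ioo_mem_nhdsLT (zero_lt_one' ℝ)] with τ hτ
      rw [slope_def_field]
      apply div_nonneg_of_nonpos
      · have h1 := hle τ hτ
        simp only [Complex.ofReal_one, one_mul, hGF z hz]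
        have := norm_nonneg (G (τ * F z))
        nlinarith
      · linarith [hτ.2]
    simp only [Complex.ofReal_one, one_mul, hGF z hz] at hnn
    rw [Complex.inner, ← hwP, map_mul] at hnn
    have hw0 : w ≠ 0 := fun h => hz0 (by rw [← hwP, h, zero_mul])
    have h3 : (conj w * conj P * w).re = Complex.normSq w * P.re := by
      simp [Complex.normSq_apply]; ring
    first
      | rw [h3] at hnn
      | rw [show w * (conj w * conj P) = conj w * conj P * w by ring, h3] at hnn
    have h4 := Complex.normSq_pos.2 hw0
    by_contra! h5
    nlinarith
  · intro z hz
    rw [hre z hz]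
    exact ⟨Real.log_le_log hm (hqm z hz), Real.log_le_log (hm.trans_le (hqm z hz)) (hqM z hz)⟩
  · intro K hK hKc
    rcases K.eq_empty_or_nonempty with rfl | hne
    · exact ⟨0, by simp, fun z _ _ => by simp⟩
    obtain ⟨x, hx, hmax⟩ := hKc.exists_isMaxOn hne ((hGd.continuousOn.mono hK).norm)
    refine ⟨‖G x‖, by simpa using hGm (hK hx), fun z hz hlt hmem => ?_⟩
    rw [hFH z hz] at hmem
    have : ‖G (F z)‖ ≤ ‖G x‖ := hmax hmem
    rw [hGF z hz] at this
    linarith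

end Part3x

section Part4x

open Set Metric Filter Topology
open scoped ComplexConjugate Real

noncomputable def thet (H : ℂ → ℂ) (R t : ℝ) : ℝ := t + (H (circleMap 0 R t)).im

noncomputable def pre (H : ℂ → ℂ) (z : ℂ) : ℝ := (1 + z * deriv H z).re

theorem circ_mem {R : ℝ} (h0 : 0 ≤ R) (h1 : R < 1) (t : ℝ) : circleMap 0 R t ∈ ball (0 : ℂ) 1 := by
  simp [abs_of_nonneg h0, h1]

theorem thet_deriv {H : ℂ → ℂ} (hH : DifferentiableOn ℂ H (ball 0 1)) {R : ℝ} (h0 : 0 ≤ R)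
    (h1 : R < 1) (t : ℝ) : HasDerivAt (thet H R) (pre H (circleMap 0 R t)) t := by
  have hz := circ_mem h0 h1 t
  have h := (hH.differentiableAt (isOpen_ball.mem_nhds hz)).hasDerivAt
  have h2 := (h.comp t (hasDerivAt_circleMap 0 R t))
  have h3 := (Complex.imCLM.hasFDerivAt.comp_hasDerivAt t h2)
  have h4 := (hasDerivAt_id t).add h3
  refine h4.congr_deriv ?_
  simp [pre, Complex.mul_im, Complex.mul_re]
  ring

theorem thet_add {H : ℂ → ℂ} (R t : ℝ) : thet H R (t + 2 * π) = thet H R t + 2 * π := by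
  simp only [thet, (periodic_circleMap 0 R) t]; ring

theorem pre_cont {H : ℂ → ℂ} (hH : DifferentiableOn ℂ H (ball 0 1)) :
    ContinuousOn (pre H) (ball 0 1) := by
  have := (hH.deriv isOpen_ball).continuousOn
  unfold pre
  fun_prop

theorem pre_circ_cont {H : ℂ → ℂ} (hH : DifferentiableOn ℂ H (ball 0 1)) {R : ℝ} (h0 : 0 ≤ R)
    (h1 : R < 1) : Continuous (fun t => pre H (circleMap 0 R t)) :=
  (pre_cont hH).comp_continuous (continuous_circleMap 0 R) (circ_mem h0 h1)

theorem thet_sub {H : ℂ → ℂ} (hH : DifferentiableOn ℂ H (ball 0 1)) {R : ℝ} (h0 : 0 ≤ R)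
    (h1 : R < 1) (a b : ℝ) :
    ∫ t in a..b, pre H (circleMap 0 R t) = thet H R b - thet H R a :=
  intervalIntegral.integral_eq_sub_of_hasDerivAt (fun t _ => thet_deriv hH h0 h1 t)
    ((pre_circ_cont hH h0 h1).intervalIntegrable _ _)

theorem thet_mono {H : ℂ → ℂ} (hH : DifferentiableOn ℂ H (ball 0 1))
    (hP : ∀ z ∈ ball (0 : ℂ) 1, 0 ≤ pre H z) {R : ℝ} (h0 : 0 ≤ R)
    (h1 : R < 1) : Monotone (thet H R) := by
  apply monotone_of_deriv_nonneg
  · exact fun t => (thet_deriv hH h0 h1 t).differentiableAt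
  · intro t
    rw [(thet_deriv hH h0 h1 t).deriv]
    exact hP _ (circ_mem h0 h1 t)

theorem poisson_pre {H : ℂ → ℂ} (hH : DifferentiableOn ℂ H (ball 0 1)) {R ρ a : ℝ} (h0 : 0 ≤ ρ)
    (h01 : ρ < R) (h1 : R < 1) :
    pre H (circleMap 0 ρ a) = (2 * π)⁻¹ * ∫ θ in 0..2*π,
      ((R ^ 2 - ρ ^ 2) / ‖circleMap 0 R (θ + a) - circleMap 0 ρ a‖ ^ 2) *
        pre H (circleMap 0 R (θ + a)) := by
  have hR : 0 < R := h0.trans_lt h01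
  have hd : DifferentiableOn ℂ (fun z => 1 + z * deriv H z) (ball 0 1) := by
    have := (hH.deriv isOpen_ball)
    fun_prop
  have hdc : DiffContOnCl ℂ (fun z => 1 + z * deriv H z) (ball 0 R) := by
    refine DifferentiableOn.diffContOnCl (hd.mono ?_)
    rw [closure_ball _ hR.ne']
    exact closedBall_subset_ball h1
  have hw : circleMap 0 ρ a ∈ ball (0 : ℂ) R := by simp [abs_of_nonneg h0, h01]
  have := hdc.circleAverage_poissonKernel_smul' hw
  rw [Real.circleAverage_eq_integral_add a] at this
  unfold pre
  rw [← this, Complex.smul_re, smul_eq_mul]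
  congr 1
  have hint : IntervalIntegrable (fun θ => ((‖circleMap 0 R (θ + a) - 0‖ ^ 2 - ‖circleMap 0 ρ a - 0‖ ^ 2) /
            ‖circleMap 0 R (θ + a) - 0 - (circleMap 0 ρ a - 0)‖ ^ 2) •
          (1 + circleMap 0 R (θ + a) * deriv H (circleMap 0 R (θ + a)))) MeasureTheory.volume 0 (2 * π) := by
    apply Continuous.intervalIntegrable
    have c1 : Continuous (fun θ : ℝ => circleMap 0 R (θ + a)) := by fun_prop
    have c2 : Continuous (fun θ : ℝ => deriv H (circleMap 0 R (θ + a))) :=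
      (hH.deriv isOpen_ball).continuousOn.comp_continuous c1 (fun t => circ_mem hR.le h1 _)
    have c3 : Continuous (fun θ : ℝ => (1 + circleMap 0 R (θ + a) * deriv H (circleMap 0 R (θ + a)))) :=
      continuous_const.add (c1.mul c2)
    suffices c4 : Continuous (fun θ : ℝ => ((‖circleMap 0 R (θ + a) - 0‖ ^ 2 - ‖circleMap 0 ρ a - 0‖ ^ 2) /
            ‖circleMap 0 R (θ + a) - 0 - (circleMap 0 ρ a - 0)‖ ^ 2)) from c4.smul c3
    refine Continuous.div (by fun_prop) (by fun_prop) ?_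
    intro x hx
    have : circleMap 0 R (x + a) = circleMap 0 ρ a := by
      simpa [sub_eq_zero] using hx
    have := congrArg norm this
    simp [abs_of_nonneg h0, abs_of_pos hR] at this
    linarith
  have := Complex.reCLM.intervalIntegral_comp_comm hint
  simp only [Complex.reCLM_apply] at this
  rw [← this]
  congr 1
  ext θ
  rw [Complex.smul_re, smul_eq_mul]
  simp [abs_of_nonneg h0, abs_of_pos hR, -Complex.add_re]

theorem pre_lower {H : ℂ → ℂ} (hH : DifferentiableOn ℂ H (ball 0 1))
    (hP : ∀ z ∈ ball (0 : ℂ) 1, 0 ≤ pre H z) {R ρ a s : ℝ} (h0 : 0 ≤ ρ)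
    (h1 : R < 1) (hs : 0 < s) (hs2 : s ≤ 2 * π) (hsR : ρ ≤ R - s) :
    R / (8 * π * (R - ρ)) * (thet H R (a + s) - thet H R a) ≤ pre H (circleMap 0 ρ a) := by
  have h01 : ρ < R := by linarith
  have hR : 0 < R := h0.trans_lt h01
  rw [poisson_pre hH h0 h01 h1]
  set q : ℝ → ℝ := fun θ => ((R ^ 2 - ρ ^ 2) / ‖circleMap 0 R (θ + a) - circleMap 0 ρ a‖ ^ 2) *
        pre H (circleMap 0 R (θ + a)) with hq
  have hne : ∀ x, circleMap 0 R (x + a) - circleMap 0 ρ a ≠ 0 := by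
    intro x hx
    have := congrArg norm (sub_eq_zero.1 hx)
    simp [abs_of_nonneg h0, abs_of_pos hR] at this
    linarith
  have c0 : Continuous (fun θ => pre H (circleMap 0 R (θ + a))) :=
    (pre_circ_cont hH hR.le h1).comp (continuous_add_const a)
  have hqc : Continuous q := by
    refine Continuous.mul (Continuous.div (by fun_prop) (by fun_prop) ?_) c0
    intro x hx
    exact hne x (by simpa using hx)
  have hq0 : ∀ θ, 0 ≤ q θ := by
    intro θ
    have : 0 ≤ R ^ 2 - ρ ^ 2 := by nlinarith
    exact mul_nonneg (by positivity) (hP _ (circ_mem hR.le h1 _))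
  have e1 : ∫ θ in (0:ℝ)..s, q θ ≤ ∫ θ in (0:ℝ)..2*π, q θ := by
    apply intervalIntegral.integral_mono_interval le_rfl hs.le hs2
    · exact Eventually.of_forall hq0
    · exact hqc.intervalIntegrable _ _
  have e2 : ∫ θ in (0:ℝ)..s, R / (4 * (R - ρ)) * pre H (circleMap 0 R (θ + a))
      ≤ ∫ θ in (0:ℝ)..s, q θ := by
    apply intervalIntegral.integral_mono_on hs.le
    · exact (continuous_const.mul c0).intervalIntegrable _ _
    · exact hqc.intervalIntegrable _ _
    · intro θ hθ
      refine mul_le_mul_of_nonneg_right ?_ (hP _ (circ_mem hR.le h1 _))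
      have hn : ‖circleMap 0 R (θ + a) - circleMap 0 ρ a‖ ≤ 2 * (R - ρ) := by
        have t1 : ‖circleMap 0 R (θ + a) - circleMap 0 R a‖ ≤ R * θ := by
          have : circleMap 0 R (θ + a) - circleMap 0 R a
            = (R : ℂ) * Complex.exp (a * Complex.I) * (Complex.exp (Complex.I * θ) - 1) := by
            simp only [circleMap, zero_add]
            push_cast
            rw [add_mul, Complex.exp_add]; ring_nf
          rw [this, norm_mul, norm_mul, Complex.norm_exp_ofReal_mul_I]
          have := Real.norm_exp_I_mul_ofReal_sub_one_le (x := θ)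
          rw [Real.norm_of_nonneg hθ.1] at this
          simp only [Complex.norm_real, Real.norm_of_nonneg hR.le, mul_one]
          gcongr
        have t2 : ‖circleMap 0 R a - circleMap 0 ρ a‖ = R - ρ := by
          have : circleMap 0 R a - circleMap 0 ρ a = ((R - ρ : ℝ) : ℂ) * Complex.exp (a * Complex.I) := by
            simp only [circleMap, zero_add]
            push_cast
            ring
          rw [this, norm_mul, Complex.norm_exp_ofReal_mul_I]
          simp [-Complex.ofReal_sub, abs_of_pos (sub_pos.2 h01)]
        have := norm_sub_le_norm_sub_add_norm_sub (circleMap 0 R (θ + a)) (circleMap 0 R a) (circleMap 0 ρ a)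
        have : R * θ ≤ s := by nlinarith [hθ.1, hθ.2]
        linarith
      have hpos : 0 < ‖circleMap 0 R (θ + a) - circleMap 0 ρ a‖ := norm_pos_iff.2 (hne θ)
      have hR' : 0 < R - ρ := by linarith
      rw [div_le_div_iff₀ (by positivity) (by positivity)]
      have : ‖circleMap 0 R (θ + a) - circleMap 0 ρ a‖ ^ 2 ≤ (2 * (R - ρ))^2 := by gcongr
      calc _ ≤ R * (2 * (R - ρ))^2 := by gcongr
        _ ≤ _ := by nlinarith [mul_nonneg h0 (sq_nonneg (R-ρ))]
  rw [intervalIntegral.integral_const_mul, intervalIntegral.integral_comp_add_right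
    (fun θ => pre H (circleMap 0 R θ)), thet_sub hH hR.le h1, zero_add, add_comm s a] at e2
  have : R / (8 * π * (R - ρ)) * (thet H R (a + s) - thet H R a) =
    (2 * π)⁻¹ * (R / (4 * (R - ρ)) * (thet H R (a + s) - thet H R a)) := by
    have : 0 < R - ρ := by linarith
    field_simp; ring
  rw [this]
  gcongr
  exact e2.trans e1

end Part4x

section Part5x

open Set Metric Filter Topology
open scoped ComplexConjugate Real

theorem radial_deriv {H : ℂ → ℂ} (hH : DifferentiableOn ℂ H (ball 0 1)) {r : ℝ} (a : ℝ) (h0 : 0 < r)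
    (h1 : r < 1) : HasDerivAt (fun r : ℝ => (H (circleMap 0 r a)).re)
      ((pre H (circleMap 0 r a) - 1) / r) r := by
  have hz := circ_mem h0.le h1 a
  have h := (hH.differentiableAt (isOpen_ball.mem_nhds hz)).hasDerivAt
  have hc : HasDerivAt (fun r : ℝ => circleMap 0 r a) (Complex.exp (a * Complex.I)) r := by
    have := ((Complex.ofRealCLM.hasDerivAt (x := r)).mul_const (Complex.exp (a * Complex.I)))
    simpa [circleMap] using this
  have h2 := (h.comp r hc)
  have h3 := (Complex.reCLM.hasFDerivAt.comp_hasDerivAt r h2)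
  refine h3.congr_deriv ?_
  have : pre H (circleMap 0 r a) - 1 = r * (deriv H (circleMap 0 r a) * Complex.exp (a * Complex.I)).re := by
    unfold pre
    rw [← Complex.re_ofReal_mul]
    simp only [Complex.add_re, Complex.one_re, add_sub_cancel_left]
    congr 1
    simp only [circleMap, zero_add]
    ring
  rw [this, mul_div_cancel_left₀ _ h0.ne']
  simp

theorem thet_mod {H : ℂ → ℂ} (hH : DifferentiableOn ℂ H (ball 0 1))
    (hP : ∀ z ∈ ball (0 : ℂ) 1, 0 ≤ pre H z) {A B : ℝ}
    (hAB : ∀ z ∈ ball (0 : ℂ) 1, A ≤ (H z).re ∧ (H z).re ≤ B) {R a s : ℝ} (h0 : 1 / 2 ≤ R)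
    (h1 : R < 1) (hs : 0 < s) (hs2 : s ≤ 1 / 4) :
    (thet H R (a + s) - thet H R a) * (Real.log (1/4) - Real.log s) ≤ 16 * π * (B - A + 1) := by
  set η := thet H R (a + s) - thet H R a with hη
  have hη0 : 0 ≤ η := sub_nonneg.2 (thet_mono hH hP (by linarith) h1 (by linarith))
  set K := R * η / (8 * π) with hK
  have hK0 : 0 ≤ K := by positivity
  have hpi := Real.pi_gt_three
  have hmono : MonotoneOn (fun r : ℝ => (H (circleMap 0 r a)).re + K * Real.log (R - r) + 2 / R * r)
      (Icc (R/2) (R - s)) := by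
    have hd : ∀ r ∈ Icc (R/2) (R - s), HasDerivAt (fun r : ℝ => (H (circleMap 0 r a)).re + K * Real.log (R - r) + 2 / R * r)
      ((pre H (circleMap 0 r a) - 1) / r + K * (-1 / (R - r)) + 2 / R * 1) r := by
      intro r hr
      have := hr.1
      have := hr.2
      have d1 := radial_deriv hH a (show 0 < r by linarith) (by linarith)
      have d2 : HasDerivAt (fun r : ℝ => Real.log (R - r)) (-1 / (R - r)) r :=
        ((hasDerivAt_id r).const_sub R).log (by simp; linarith)
      exact (d1.add (d2.const_mul K)).add ((hasDerivAt_id r).const_mul (2/R))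
    apply monotoneOn_of_deriv_nonneg (convex_Icc _ _)
    · exact fun r hr => (hd r hr).continuousAt.continuousWithinAt
    · exact fun r hr => (hd r (interior_subset hr)).differentiableAt.differentiableWithinAt
    · intro r hr
      have hr := interior_subset hr
      rw [(hd r hr).deriv]
      have i1 := hr.1
      have i2 := hr.2
      have hr0 : 0 < r := by linarith
      have hl := pre_lower hH hP (a := a) hr0.le h1 hs (by linarith) i2
      have e : R / (8 * π * (R - r)) * (thet H R (a + s) - thet H R a) = K / (R - r) := by
        rw [hK, ← hη]
        have : 0 < R - r := by linarith
        field_simp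
      rw [e] at hl
      have hKr : 0 ≤ K / (R - r) := div_nonneg hK0 (by linarith)
      have g1 : K / (R - r) ≤ pre H (circleMap 0 r a) / r := by
        rw [le_div_iff₀ hr0]
        nlinarith
      have g2 : 1 / r ≤ 2 / R := by
        rw [div_le_div_iff₀ hr0 (by linarith)]; linarith
      have : K * (-1 / (R - r)) = - (K / (R - r)) := by ring
      rw [this, sub_div]
      linarith
  have key := hmono (show R/2 ∈ Icc (R/2) (R - s) from ⟨le_rfl, by linarith⟩)
    (show R - s ∈ Icc (R/2) (R - s) from ⟨by linarith, le_rfl⟩) (by linarith)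
  simp only at key
  have hA := (hAB _ (circ_mem (R := R/2) (by linarith) (by linarith) a)).1
  have hB := (hAB _ (circ_mem (R := R - s) (by linarith) (by linarith) a)).2
  have q1 : 2 / R * (R / 2) = 1 := by field_simp
  have q2 : 2 / R * (R - s) ≤ 2 := by
    have : 2 / R * (R - s) = 2 - 2 / R * s := by field_simp
    rw [this]
    have : 0 ≤ 2 / R * s := by positivity
    linarith
  rw [q1, show R - R / 2 = R / 2 by ring, show R - (R - s) = s by ring] at key
  have hl1 : Real.log (1/4) ≤ Real.log (R/2) := Real.log_le_log (by norm_num) (by linarith)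
  have hl2 : Real.log s ≤ Real.log (1/4) := Real.log_le_log hs hs2
  have hK1 : η / (16 * π) ≤ K := by
    rw [hK, div_le_div_iff₀ (by positivity) (by positivity)]
    nlinarith [mul_nonneg hη0 Real.pi_pos.le]
  have k2 : K * (Real.log (1/4) - Real.log s) ≤ B - A + 1 := by
    have : K * (Real.log (1/4) - Real.log s) ≤ K * (Real.log (R/2) - Real.log s) := by gcongr
    linarith
  have k3 : η / (16 * π) * (Real.log (1/4) - Real.log s) ≤ B - A + 1 :=
    (mul_le_mul_of_nonneg_right hK1 (by linarith)).trans k2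
  calc _ = (16 * π) * (η / (16 * π) * (Real.log (1/4) - Real.log s)) := by field_simp
    _ ≤ _ := by gcongr

theorem thet_equi {H : ℂ → ℂ} (hH : DifferentiableOn ℂ H (ball 0 1))
    (hP : ∀ z ∈ ball (0 : ℂ) 1, 0 ≤ pre H z) {A B : ℝ}
    (hAB : ∀ z ∈ ball (0 : ℂ) 1, A ≤ (H z).re ∧ (H z).re ≤ B) {ε : ℝ} (hε : 0 < ε) :
    ∃ δ > 0, ∀ R : ℝ, 1 / 2 ≤ R → R < 1 → ∀ a b, |b - a| ≤ δ →
      |thet H R b - thet H R a| ≤ ε := by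
  have hAB0 := hAB 0 (by simp)
  set T := 16 * π * (B - A + 1) / ε with hT
  have hpi := Real.pi_pos
  have hT0 : 0 < T := by
    have : 0 < B - A + 1 := by linarith
    positivity
  set s := (1/4) * Real.exp (-T) with hs
  have hs0 : 0 < s := by positivity
  have hs4 : s ≤ 1 / 4 := by
    have : Real.exp (-T) ≤ 1 := Real.exp_le_one_iff.2 (by linarith)
    rw [hs]; linarith
  have hl : Real.log (1/4) - Real.log s = T := by
    rw [hs, Real.log_mul (by norm_num) (Real.exp_pos _).ne', Real.log_exp]; ring
  refine ⟨s, hs0, ?_⟩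
  intro R h0 h1
  have main : ∀ a, thet H R (a + s) - thet H R a ≤ ε := by
    intro a
    have := thet_mod hH hP hAB (a := a) h0 h1 hs0 hs4
    rw [hl, hT, ← mul_div_assoc, div_le_iff₀ hε] at this
    have h3 : 0 < 16 * π * (B - A + 1) := by
      have : 0 < B - A + 1 := by linarith
      positivity
    nlinarith
  have hm := thet_mono hH hP (by linarith) h1
  intro a b hab
  rw [abs_le] at hab ⊢
  rcases le_total a b with h | h
  · have := hm h
    have := main a
    have := hm (show b ≤ a + s by linarith)
    constructor <;> linarith
  · have := hm h
    have := main b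
    have := hm (show a ≤ b + s by linarith)
    constructor <;> linarith

end Part5x

section Part6x

open Set Metric Filter Topology
open scoped ComplexConjugate Real

theorem fourier_cauchy {H : ℂ → ℂ} (hH : DifferentiableOn ℂ H (ball 0 1)) {R : ℝ} (h0 : 0 < R)
    (h1 : R < 1) {n : ℕ} (hn : n ≠ 0) :
    ∫ t in 0..2*π, H (circleMap 0 R t) * Complex.exp (Complex.I * n * t) = 0 := by
  have hd : DiffContOnCl ℂ (fun z => H z * z ^ n) (ball 0 |R|) := by
    rw [abs_of_pos h0]
    refine DifferentiableOn.diffContOnCl ?_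
    rw [closure_ball _ h0.ne']
    have := hH.mono (closedBall_subset_ball h1)
    fun_prop
  have := hd.circleAverage
  simp only [ne_eq, hn, not_false_eq_true, zero_pow, mul_zero] at this
  rw [Real.circleAverage_def] at this
  have e : ∀ t : ℝ, H (circleMap 0 R t) * circleMap 0 R t ^ n
      = (R : ℂ) ^ n * (H (circleMap 0 R t) * Complex.exp (Complex.I * n * t)) := by
    intro t
    have : circleMap 0 R t ^ n = (R : ℂ) ^ n * Complex.exp (Complex.I * n * t) := by
      simp only [circleMap, zero_add, mul_pow, ← Complex.exp_nat_mul]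
      ring_nf
    rw [this]; ring
  simp only [e] at this
  rw [intervalIntegral.integral_const_mul] at this
  have hRn : (R : ℂ) ^ n ≠ 0 := by
    apply pow_ne_zero; exact_mod_cast h0.ne'
  simpa [Real.pi_ne_zero, hRn, h0.ne'] using this

theorem fourier_re_nat {H : ℂ → ℂ} (hH : DifferentiableOn ℂ H (ball 0 1))
    (hP : ∀ z ∈ ball (0 : ℂ) 1, 0 ≤ pre H z) {R : ℝ} (h0 : 0 < R)
    (h1 : R < 1) {n : ℕ} (hn : n ≠ 0) :
    ‖∫ t in 0..2*π, ((H (circleMap 0 R t)).re : ℂ) * Complex.exp (Complex.I * n * t)‖ ≤ 4 * π / n := by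
  have cH : Continuous (fun t : ℝ => H (circleMap 0 R t)) :=
    hH.continuousOn.comp_continuous (continuous_circleMap 0 R) (circ_mem h0.le h1)
  have cre : Continuous (fun t : ℝ => ((H (circleMap 0 R t)).re : ℂ)) :=
    Complex.continuous_ofReal.comp (Complex.continuous_re.comp cH)
  have cim : Continuous (fun t : ℝ => ((H (circleMap 0 R t)).im : ℂ)) :=
    Complex.continuous_ofReal.comp (Complex.continuous_im.comp cH)
  have cexp : Continuous (fun t : ℝ => Complex.exp (Complex.I * n * t)) := by fun_prop
  have hsum := fourier_cauchy hH h0 h1 hn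
  have e : ∀ t : ℝ, H (circleMap 0 R t) * Complex.exp (Complex.I * n * t) =
     ((H (circleMap 0 R t)).re : ℂ) * Complex.exp (Complex.I * n * t) +
      Complex.I * (((H (circleMap 0 R t)).im : ℂ) * Complex.exp (Complex.I * n * t)) := by
    intro t
    conv_lhs => rw [← Complex.re_add_im (H (circleMap 0 R t))]
    ring
  simp only [e] at hsum
  rw [intervalIntegral.integral_add (Continuous.intervalIntegrable (by fun_prop) _ _)
    (Continuous.intervalIntegrable (by fun_prop) _ _),
    intervalIntegral.integral_const_mul] at hsum
  rw [eq_neg_of_add_eq_zero_left hsum, norm_neg, norm_mul, Complex.norm_I, one_mul]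
  have hnC : (n : ℂ) ≠ 0 := by exact_mod_cast hn
  have hI : Complex.I * n ≠ 0 := mul_ne_zero Complex.I_ne_zero hnC
  have dv : ∀ t : ℝ, HasDerivAt (fun t : ℝ => ((H (circleMap 0 R t)).im : ℂ))
      ((pre H (circleMap 0 R t) - 1 : ℝ) : ℂ) t := by
    intro t
    have := ((thet_deriv hH h0.le h1 t).sub (hasDerivAt_id t)).ofReal_comp
    refine this.congr_of_eventuallyEq (Eventually.of_forall fun x => ?_)
    simp [thet]
  have de : ∀ t : ℝ, HasDerivAt (fun t : ℝ => Complex.exp (Complex.I * n * t) / (Complex.I * n))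
      (Complex.exp (Complex.I * n * t)) t := by
    intro t
    have h1 : HasDerivAt (fun t : ℝ => Complex.I * n * (t : ℂ)) (Complex.I * n * 1) t :=
      (Complex.ofRealCLM.hasDerivAt (x := t)).const_mul (Complex.I * n)
    have := h1.cexp.div_const (Complex.I * n)
    refine this.congr_deriv ?_
    field_simp
  have cp : Continuous (fun t : ℝ => ((pre H (circleMap 0 R t) - 1 : ℝ) : ℂ)) :=
    Complex.continuous_ofReal.comp ((pre_circ_cont hH h0.le h1).sub continuous_const)
  rw [intervalIntegral.integral_mul_deriv_eq_deriv_mul (fun t _ => dv t) (fun t _ => de t)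
    (cp.intervalIntegrable _ _) (cexp.intervalIntegrable _ _)]
  have hb : ((H (circleMap 0 R (2*π))).im : ℂ) * (Complex.exp (Complex.I * n * (2*π : ℝ)) / (Complex.I * n)) -
     ((H (circleMap 0 R 0)).im : ℂ) * (Complex.exp (Complex.I * n * (0 : ℝ)) / (Complex.I * n)) = 0 := by
    have e1 : circleMap 0 R (2*π) = circleMap 0 R 0 := by simpa using periodic_circleMap 0 R 0
    have e2 : Complex.exp (Complex.I * n * (2*π : ℝ)) = 1 := by
      rw [Complex.exp_eq_one_iff]
      exact ⟨n, by push_cast; ring⟩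
    rw [e1, e2]; simp
  rw [hb, zero_sub, norm_neg]
  calc _ ≤ ∫ t in (0:ℝ)..2*π, (pre H (circleMap 0 R t) + 1) / n := by
        refine intervalIntegral.norm_integral_le_of_norm_le Real.two_pi_pos.le
          (Eventually.of_forall fun t _ => ?_) ?_
        · rw [norm_mul, norm_div, norm_mul, Complex.norm_I, one_mul, Complex.norm_natCast,
            show Complex.I * n * t = ((n * t : ℝ) : ℂ) * Complex.I by push_cast; ring,
            Complex.norm_exp_ofReal_mul_I, mul_one_div, Complex.norm_real]
          gcongr
          have := hP _ (circ_mem h0.le h1 t)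
          rw [Real.norm_eq_abs, abs_le]
          constructor <;> linarith
        · exact (((pre_circ_cont hH h0.le h1).add continuous_const).div_const _).intervalIntegrable _ _
    _ = _ := by
        rw [intervalIntegral.integral_div, intervalIntegral.integral_add
          ((pre_circ_cont hH h0.le h1).intervalIntegrable _ _) (continuous_const.intervalIntegrable _ _),
          thet_sub hH h0.le h1]
        have := thet_add (H := H) R 0
        rw [zero_add] at this
        rw [this]
        simp
        ring

theorem fourier_re {H : ℂ → ℂ} (hH : DifferentiableOn ℂ H (ball 0 1))
    (hP : ∀ z ∈ ball (0 : ℂ) 1, 0 ≤ pre H z) {R : ℝ} (h0 : 0 < R)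
    (h1 : R < 1) {k : ℤ} (hk : k ≠ 0) :
    ‖∫ t in 0..2*π, Complex.exp (Complex.I * k * t) * ((H (circleMap 0 R t)).re : ℂ)‖ ≤ 4 * π / |(k : ℝ)| := by
  simp only [mul_comm (Complex.exp _)]
  obtain ⟨n, rfl | rfl⟩ := k.eq_nat_or_neg
  · have := fourier_re_nat hH hP h0 h1 (n := n) (by simpa using hk)
    simpa using this
  · have := fourier_re_nat hH hP h0 h1 (n := n) (by simpa using hk)
    rw [← Complex.norm_conj, ← intervalIntegral.intervalIntegral_conj] at this
    simp only [map_mul, Complex.conj_ofReal, ← Complex.exp_conj, Complex.conj_I, Complex.conj_natCast] at this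
    simpa using this

end Part6x

section Part7x

open Set Metric Filter Topology
open scoped ComplexConjugate Real

theorem limit_exists (θ : ℕ → ℝ → ℝ) (hm : ∀ n, Monotone (θ n))
    (hper : ∀ n t, θ n (t + 2 * π) = θ n t + 2 * π)
    (heq : ∀ ε > 0, ∃ δ > 0, ∀ n a b, |b - a| ≤ δ → |θ n b - θ n a| ≤ ε) :
    ∃ (Θ : ℝ → ℝ) (c : ℕ → ℤ) (l : Filter ℕ), l.NeBot ∧ l ≤ atTop ∧ Monotone Θ ∧ Continuous Θ ∧
      (∀ t, Θ (t + 2 * π) = Θ t + 2 * π) ∧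
      ∀ a b, ∀ ε > 0, ∀ᶠ n in l, ∀ t ∈ Icc a b, |θ n t - c n * (2 * π) - Θ t| < ε := by
  set c : ℕ → ℤ := fun n => ⌊θ n 0 / (2 * π)⌋ with hc
  set φ : ℕ → ℝ → ℝ := fun n t => θ n t - c n * (2 * π) with hφ
  have hpi := Real.two_pi_pos
  have hφ0 : ∀ n, 0 ≤ φ n 0 ∧ φ n 0 ≤ 2 * π := by
    intro n
    have h1 := Int.floor_le (θ n 0 / (2 * π))
    have h2 := Int.lt_floor_add_one (θ n 0 / (2 * π))
    rw [le_div_iff₀ hpi] at h1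
    rw [div_lt_iff₀ hpi] at h2
    simp only [hφ, hc]
    constructor <;> linarith
  have hφm : ∀ n, Monotone (φ n) := fun n a b h => sub_le_sub_right (hm n h) _
  have hφper : ∀ n t, φ n (t + 2 * π) = φ n t + 2 * π := by
    intro n t; simp only [hφ, hper]; ring
  have hφk : ∀ n (k : ℕ), φ n (k * (2 * π)) = φ n 0 + k * (2 * π) ∧
      φ n (- (k * (2 * π))) = φ n 0 - k * (2 * π) := by
    intro n k
    induction k with
    | zero => simp
    | succ k ih =>
      constructor
      · have := hφper n (k * (2 * π))
        push_cast
        rw [show ((k : ℝ) + 1) * (2 * π) = k * (2 * π) + 2 * π by ring, this, ih.1]; ring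
      · have := hφper n (-((k + 1) * (2 * π)))
        rw [show -(((k : ℝ) + 1) * (2 * π)) + 2 * π = -(k * (2 * π)) by ring, ih.2] at this
        push_cast
        linarith
  have hb : ∀ t, ∃ C, ∀ n, φ n t ∈ Icc (-C) C := by
    intro t
    obtain ⟨k, hk⟩ := exists_nat_ge (|t| / (2 * π))
    rw [div_le_iff₀ hpi, abs_le] at hk
    refine ⟨2 * π + k * (2 * π), fun n => ?_⟩
    have a1 := hφm n hk.1
    have a2 := hφm n hk.2
    rw [(hφk n k).2] at a1
    rw [(hφk n k).1] at a2
    have := hφ0 n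
    constructor <;> linarith
  choose C hC using hb
  have hlim : ∀ t, ∃ y, Tendsto (fun n => φ n t) (hyperfilter ℕ : Filter ℕ) (𝓝 y) := by
    intro t
    obtain ⟨y, -, hy⟩ := (isCompact_Icc (a := -(C t)) (b := C t)).ultrafilter_le_nhds
      ((hyperfilter ℕ).map (fun n => φ n t)) (by
        rw [le_principal_iff]; exact Ultrafilter.mem_map.2 (Filter.univ_mem' fun n => hC t n))
    exact ⟨y, hy⟩
  choose Θ hΘ using hlim
  have hdiff : ∀ n a b, φ n b - φ n a = θ n b - θ n a := by intro n a b; simp only [hφ]; ring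
  refine ⟨Θ, c, hyperfilter ℕ, inferInstance, ?_, ?_, ?_, ?_, ?_⟩
  · rw [← Nat.cofinite_eq_atTop]; exact hyperfilter_le_cofinite
  · intro a b h
    exact le_of_tendsto_of_tendsto (hΘ a) (hΘ b) (Eventually.of_forall fun n => hφm n h)
  · rw [Metric.continuous_iff]
    intro b ε hε
    obtain ⟨δ, hδ, h⟩ := heq (ε/2) (by positivity)
    refine ⟨δ, hδ, fun a ha => ?_⟩
    have : |Θ a - Θ b| ≤ ε / 2 := by
      refine le_of_tendsto ((hΘ a).sub (hΘ b)).abs (Eventually.of_forall fun n => ?_)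
      rw [hdiff]
      exact h n b a (by rw [Real.dist_eq] at ha; exact ha.le)
    rw [Real.dist_eq]; linarith
  · intro t
    refine tendsto_nhds_unique (hΘ _) ?_
    simp only [hφper]
    exact (hΘ t).add_const _
  · intro a b ε hε
    have := tlu_of_pointwise (F := φ) (f := Θ) (U := univ) (l := (hyperfilter ℕ : Filter ℕ))
      (fun t _ => hΘ t) (by
        intro z _ ε hε
        obtain ⟨δ, hδ, h⟩ := heq ε hε
        refine ⟨δ, hδ, fun w _ hw n => ?_⟩
        rw [Real.dist_eq, hdiff]
        exact h n z w (by rw [Real.dist_eq] at hw; exact hw.le))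
    have h2 := (tendstoLocallyUniformlyOn_iff_tendstoUniformlyOn_of_compact isCompact_Icc).1
      (this.mono (subset_univ (Icc a b)))
    rw [Metric.tendstoUniformlyOn_iff] at h2
    filter_upwards [h2 ε hε] with n hn t ht
    have := hn t ht
    rwa [dist_comm, Real.dist_eq] at this

/-- A holomorphic function on the disc cannot be nearly constant on an arc. -/
theorem arc_max {G : ℂ → ℂ} {R M ε β : ℝ} {N : ℕ} (hR : 0 < R) (hG : DifferentiableOn ℂ G (closedBall 0 R))
    (hM : ∀ z ∈ closedBall (0 : ℂ) R, ‖G z‖ ≤ M) {a b : ℝ} (hβ : 0 < β) (hβ2 : β ≤ b - a)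
    (hN : 2 * π ≤ N * β) (hε : ∀ t ∈ Icc a b, ‖G (circleMap 0 R t)‖ ≤ ε) :
    ‖G 0‖ ^ N ≤ ε * M ^ (N - 1) := by
  set Q : ℂ → ℂ := fun z => ∏ j ∈ Finset.range N, G (Complex.exp ((j * β : ℝ) * Complex.I) * z) with hQ
  have hM0 : 0 ≤ M := (norm_nonneg _).trans (hM 0 (by simp [hR.le]))
  have hε0 : 0 ≤ ε := (norm_nonneg _).trans (hε a ⟨le_rfl, by linarith⟩)
  have hmem : ∀ j : ℕ, ∀ z ∈ closedBall (0:ℂ) R, Complex.exp ((j * β : ℝ) * Complex.I) * z ∈ closedBall (0:ℂ) R := by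
    intro j z hz
    rw [mem_closedBall_zero_iff] at hz ⊢
    rwa [norm_mul, Complex.norm_exp_ofReal_mul_I, one_mul]
  have hd : DifferentiableOn ℂ Q (closedBall 0 R) := by
    apply DifferentiableOn.fun_finsetProd
    intro j _
    exact hG.comp (by fun_prop) (hmem j)
  have hdc : DiffContOnCl ℂ Q (ball 0 R) := by
    apply DifferentiableOn.diffContOnCl
    rwa [closure_ball _ hR.ne']
  have hN0 : 0 < N := by
    rcases Nat.eq_zero_or_pos N with h | h
    · subst h; simp at hN; linarith [Real.pi_pos]
    · exact h
  have hfr : ∀ z ∈ frontier (ball (0:ℂ) R), ‖Q z‖ ≤ ε * M ^ (N - 1) := by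
    intro z hz
    rw [frontier_ball _ hR.ne', mem_sphere_zero_iff_norm] at hz
    have hzc : z ∈ closedBall (0:ℂ) R := by simp [hz]
    obtain ⟨τ, hτ, hτz⟩ : ∃ τ ∈ Ioc (b - 2 * π) b, circleMap 0 R τ = z := by
      refine ⟨toIocMod Real.two_pi_pos (b - 2 * π) (Complex.arg z), ?_, ?_⟩
      · simpa using toIocMod_mem_Ioc Real.two_pi_pos (b - 2 * π) (Complex.arg z)
      · rw [toIocMod, (periodic_circleMap 0 R).sub_zsmul_eq, circleMap, ← hz, zero_add,
          Complex.norm_mul_exp_arg_mul_I]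
    set j := ⌈(a - τ) / β⌉₊ with hj
    have hj1 : a ≤ τ + j * β := by
      have := Nat.le_ceil ((a - τ) / β)
      rw [div_le_iff₀ hβ] at this
      linarith
    have hj2 : τ + j * β ≤ b ∧ j < N := by
      rcases le_total a τ with h | h
      · have : j = 0 := by
          rw [hj, Nat.ceil_eq_zero]
          exact div_nonpos_of_nonpos_of_nonneg (by linarith) hβ.le
        rw [this]
        exact ⟨by simpa using hτ.2, hN0⟩
      · have h1 := Nat.ceil_lt_add_one (div_nonneg (sub_nonneg.2 h) hβ.le)
        rw [← hj] at h1
        have h2 : j * β < a - τ + β := by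
          have := mul_lt_mul_of_pos_right h1 hβ
          rwa [add_mul, div_mul_cancel₀ _ hβ.ne', one_mul] at this
        refine ⟨by linarith, ?_⟩
        have : (j : ℝ) * β < N * β := by linarith [hτ.1]
        exact_mod_cast lt_of_mul_lt_mul_right this hβ.le
    rw [hQ]
    simp only [norm_prod]
    rw [← Finset.mul_prod_erase _ _ (Finset.mem_range.2 hj2.2)]
    have hcard : ((Finset.range N).erase j).card = N - 1 := by
      rw [Finset.card_erase_of_mem (Finset.mem_range.2 hj2.2), Finset.card_range]
    refine mul_le_mul ?_ ?_ (Finset.prod_nonneg fun _ _ => norm_nonneg _) hε0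
    · have := hε (τ + j * β) ⟨hj1, hj2.1⟩
      have e : circleMap 0 R (τ + j * β) = Complex.exp ((j * β : ℝ) * Complex.I) * z := by
        rw [← hτz]
        simp only [circleMap, zero_add]
        push_cast
        rw [add_mul, Complex.exp_add]; ring
      rwa [e] at this
    · rw [← hcard]
      rw [← Finset.prod_const]
      exact Finset.prod_le_prod (fun _ _ => norm_nonneg _) fun i _ => hM _ (hmem i z hzc)
  have := Complex.norm_le_of_forall_mem_frontier_norm_le isBounded_ball hdc hfr
    (subset_closure (mem_ball_self hR))
  simpa [hQ] using this

end Part7x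

section Part8x

open Set Metric Filter Topology
open scoped ComplexConjugate Real

theorem arg_exp_angle (z : ℂ) : ((Complex.arg (Complex.exp z) : ℝ) : Real.Angle) = (z.im : ℝ) := by
  have h := Complex.arg_mul_cos_add_sin_mul_I_coe_angle (Real.exp_pos z.re) (z.im : Real.Angle)
  rw [← h, Complex.exp_eq_exp_re_mul_sin_add_cos z, Real.Angle.cos_coe, Real.Angle.sin_coe]
  push_cast
  rfl

theorem exists_H [Fact ((0 : ℝ) < 2 * π)] (f : AddCircle (2 * π) → ℝ) (hf : Continuous f) :
    ∃ (H : ℂ → ℂ) (A B : ℝ), DifferentiableOn ℂ H (ball 0 1) ∧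
      (∀ z ∈ ball (0 : ℂ) 1, 0 ≤ pre H z) ∧
      (∀ z ∈ ball (0 : ℂ) 1, A ≤ (H z).re ∧ (H z).re ≤ B) ∧
      (∀ ε > 0, ∃ R₀ < 1, ∀ R, R₀ < R → R < 1 → ∀ t : ℝ,
        |(H (circleMap 0 R t)).re - f ((thet H R t : ℝ) : AddCircle (2 * π))| < ε) := by
  obtain ⟨x0, hx0⟩ : ∃ x, ∀ y, f x ≤ f y := by
    obtain ⟨x, -, hx⟩ := isCompact_univ.exists_isMinOn univ_nonempty hf.continuousOn
    exact ⟨x, fun y => hx (mem_univ y)⟩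
  obtain ⟨x1, hx1⟩ : ∃ x, ∀ y, f y ≤ f x := by
    obtain ⟨x, -, hx⟩ := isCompact_univ.exists_isMaxOn univ_nonempty hf.continuousOn
    exact ⟨x, fun y => hx (mem_univ y)⟩
  set ρ : ℂ → ℝ := fun w => Real.exp (f ((Complex.arg w : ℝ) : AddCircle (2 * π))) with hρ
  have hρc : ∀ w, w ≠ 0 → ContinuousAt ρ w := by
    intro w hw
    have h1 : ContinuousAt (fun w => ((Complex.arg w : ℝ) : AddCircle (2 * π))) w :=
      Complex.continuousAt_arg_coe_angle hw
    exact Real.continuous_exp.continuousAt.comp (hf.continuousAt.comp h1)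
  have hρ0 : ∀ w, 0 < ρ w := fun w => Real.exp_pos _
  have hρm : ∀ w, Real.exp (f x0) ≤ ρ w := fun w => Real.exp_le_exp.2 (hx0 _)
  have hρM : ∀ w, ρ w ≤ Real.exp (f x1) := fun w => Real.exp_le_exp.2 (hx1 _)
  set D : Set ℂ := {w | ‖w‖ < ρ w} with hDdef
  have hmD : ball 0 (Real.exp (f x0)) ⊆ D := by
    intro w hw
    rw [mem_ball_zero_iff] at hw
    exact hw.trans_le (hρm w)
  have hD : IsOpen D := by
    rw [isOpen_iff_mem_nhds]
    intro w hw
    rcases eq_or_ne w 0 with rfl | h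
    · exact mem_of_superset (ball_mem_nhds _ (Real.exp_pos _)) hmD
    · exact continuous_norm.continuousAt.eventually_lt (hρc w h) hw
  have hs : StarConvex ℝ 0 D := by
    rw [starConvex_zero_iff]
    intro w hw a ha0 ha1
    rcases ha0.eq_or_lt with rfl | ha
    · simp only [zero_smul]; exact hmD (mem_ball_self (Real.exp_pos _))
    · have : ρ (a • w) = ρ w := by
        simp only [hρ, Complex.real_smul, Complex.arg_real_mul _ ha]
      simp only [hDdef, mem_ofPred_eq] at hw ⊢
      rw [this, norm_smul, Real.norm_of_nonneg ha0]
      nlinarith [norm_nonneg w]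
  have hDM : D ⊆ ball 0 (Real.exp (f x1)) := by
    intro w hw
    rw [mem_ball_zero_iff]
    exact lt_of_lt_of_le hw (hρM w)
  obtain ⟨H, hH, hHD, hP, hAB, hK⟩ := exists_starlike_log hD hs (Real.exp_pos _) hmD hDM
  refine ⟨H, _, _, hH, hP, hAB, ?_⟩
  intro ε hε
  obtain ⟨R₁, hR1, h1⟩ := hK {w | ‖w‖ ≤ Real.exp (-ε) * ρ w} (by
      intro w hw
      have : Real.exp (-ε) < 1 := Real.exp_lt_one_iff.2 (by linarith)
      simp only [hDdef, mem_ofPred_eq] at hw ⊢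
      nlinarith [hρ0 w]) (by
      apply Metric.isCompact_of_isClosed_isBounded
      · rw [← isOpen_compl_iff, isOpen_iff_mem_nhds]
        intro w hw
        simp only [mem_compl_iff, mem_ofPred_eq, not_le] at hw
        have hw0 : w ≠ 0 := by
          rintro rfl
          have := mul_pos (Real.exp_pos (-ε)) (hρ0 0)
          simp at hw
          linarith
        have := ((hρc w hw0).const_mul (Real.exp (-ε))).eventually_lt continuous_norm.continuousAt hw
        filter_upwards [this] with x hx
        simpa using hx
      · refine isBounded_ball.subset (subset_trans ?_ hDM)
        intro w hw
        have : Real.exp (-ε) < 1 := Real.exp_lt_one_iff.2 (by linarith)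
        simp only [hDdef, mem_ofPred_eq] at hw ⊢
        nlinarith [hρ0 w])
  refine ⟨max R₁ (Real.exp (-ε)), max_lt hR1 (Real.exp_lt_one_iff.2 (by linarith)), ?_⟩
  intro R hR hRlt t
  have hRε := (le_max_right _ _).trans_lt hR
  have hR0 : 0 < R := (Real.exp_pos _).trans hRε
  have hz := circ_mem hR0.le hRlt t
  have hz1 : circleMap 0 R t * Complex.exp (H (circleMap 0 R t)) =
      Complex.exp (((Real.log R : ℝ) : ℂ) + t * Complex.I + H (circleMap 0 R t)) := by
    rw [Complex.exp_add, Complex.exp_add, ← Complex.ofReal_exp, Real.exp_log hR0]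
    simp [circleMap]
  have m1 := hHD _ hz
  have m2 := h1 _ hz (by simpa [abs_of_pos hR0] using (le_max_left _ _).trans_lt hR)
  rw [hz1] at m1 m2
  have hρv : ρ (Complex.exp (((Real.log R : ℝ) : ℂ) + t * Complex.I + H (circleMap 0 R t))) =
      Real.exp (f ((thet H R t : ℝ) : AddCircle (2 * π))) := by
    have := arg_exp_angle (((Real.log R : ℝ) : ℂ) + t * Complex.I + H (circleMap 0 R t))
    have h2 : (((Real.log R : ℝ) : ℂ) + t * Complex.I + H (circleMap 0 R t)).im = thet H R t := by
      simp [thet]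
    rw [h2] at this
    simp only [hρ]
    congr 2
  have hre : (((Real.log R : ℝ) : ℂ) + t * Complex.I + H (circleMap 0 R t)).re =
      Real.log R + (H (circleMap 0 R t)).re := by simp
  simp only [hDdef, mem_ofPred_eq, hρv, Complex.norm_exp, hre, not_le, ← Real.exp_add,
    Real.exp_lt_exp] at m1 m2
  have l1 : -ε < Real.log R := by
    rw [Real.lt_log_iff_exp_lt hR0]; exact hRε
  have l2 : Real.log R < 0 := Real.log_neg hR0 hRlt
  rw [abs_lt]
  constructor <;> linarith

theorem circle_homeo [Fact ((0 : ℝ) < 2 * π)] (Θ : ℝ → ℝ) (hm : StrictMono Θ) (hc : Continuous Θ)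
    (hper : ∀ t, Θ (t + 2 * π) = Θ t + 2 * π) :
    ∃ h : AddCircle (2 * π) ≃ₜ AddCircle (2 * π), ∀ t : ℝ, h (t : AddCircle (2 * π)) = (Θ t : ℝ) := by
  have hg : Function.Periodic (fun t => Θ t - t) (2 * π) := by
    intro t; simp only [hper]; ring
  have hk : ∀ (k : ℤ) t, Θ (t + k * (2 * π)) = Θ t + k * (2 * π) := by
    intro k t
    have := hg.int_mul k t
    linarith
  have hp : Function.Periodic (fun t => ((Θ t : ℝ) : AddCircle (2 * π))) (2 * π) := by
    intro t; simp only [hper]; exact AddCircle.coe_add_period _ _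
  set g : AddCircle (2 * π) → AddCircle (2 * π) := hp.lift with hgdef
  have hgv : ∀ t : ℝ, g (t : AddCircle (2 * π)) = (Θ t : ℝ) := fun t => hp.lift_coe t
  have hgc : Continuous g := by
    refine continuous_quot_lift _ ?_
    exact (AddCircle.continuous_mk' _).comp hc
  have hinj : Function.Injective g := by
    intro x y hxy
    induction x using QuotientAddGroup.induction_on with | H s => ?_
    induction y using QuotientAddGroup.induction_on with | H t => ?_
    have h1 : ((Θ s : ℝ) : AddCircle (2 * π)) = (Θ t : ℝ) := by rw [← hgv, ← hgv]; exact hxy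
    rw [← sub_eq_zero, ← AddCircle.coe_sub, AddCircle.coe_eq_zero_iff] at h1
    obtain ⟨n, hn⟩ := h1
    have h2 : Θ s = Θ (t + n * (2 * π)) := by
      rw [hk]; simp at hn; linarith
    have h3 := hm.injective h2
    show ((s : ℝ) : AddCircle (2 * π)) = (t : ℝ)
    rw [← sub_eq_zero, ← AddCircle.coe_sub, AddCircle.coe_eq_zero_iff]
    exact ⟨n, by simp; linarith⟩
  have hsurj : Function.Surjective g := by
    intro y
    induction y using QuotientAddGroup.induction_on with | H y => ?_
    obtain ⟨k, hk1⟩ := exists_nat_ge (|y - Θ 0| / (2 * π))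
    rw [div_le_iff₀ Real.two_pi_pos, abs_le] at hk1
    have e1 := hk k 0
    have e2 := hk (-k) 0
    push_cast at e1 e2
    have hle : (0 : ℝ) + -(k : ℝ) * (2 * π) ≤ 0 + k * (2 * π) := by
      have : (0 : ℝ) ≤ k * (2 * π) := by positivity
      linarith
    obtain ⟨t, -, ht⟩ := intermediate_value_Icc hle hc.continuousOn
      (show y ∈ _ by rw [e1, e2]; constructor <;> linarith)
    exact ⟨(t : ℝ), by rw [hgv, ht]⟩
  exact ⟨Continuous.homeoOfEquivCompactToT2 (f := Equiv.ofBijective g ⟨hinj, hsurj⟩) hgc, hgv⟩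

end Part8x

section Part9x

open Set Metric Filter Topology
open scoped ComplexConjugate Real

theorem coe_sub_period (x : ℝ) (c : ℤ) :
    ((x - c * (2 * π) : ℝ) : AddCircle (2 * π)) = (x : ℝ) := by
  rw [← sub_eq_zero, ← AddCircle.coe_sub, AddCircle.coe_eq_zero_iff]
  exact ⟨-c, by simp⟩

theorem strict_lim [Fact ((0 : ℝ) < 2 * π)] {f : AddCircle (2 * π) → ℝ} (hf : Continuous f)
    {H : ℂ → ℂ} {B : ℝ} (hH : DifferentiableOn ℂ H (ball 0 1))
    (hB : ∀ z ∈ ball (0 : ℂ) 1, (H z).re ≤ B) {R : ℕ → ℝ} (hR0 : ∀ n, 1 / 2 ≤ R n)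
    (hR1 : ∀ n, R n < 1) {l : Filter ℕ} [l.NeBot] (hRl : Tendsto R l (𝓝 1))
    (hclose : ∀ ε > 0, ∀ᶠ n in l, ∀ t : ℝ,
        |(H (circleMap 0 (R n) t)).re - f ((thet H (R n) t : ℝ) : AddCircle (2 * π))| < ε)
    {Θ : ℝ → ℝ} {c : ℕ → ℤ} (hm : Monotone Θ)
    (hlim : ∀ a b, ∀ ε > 0, ∀ᶠ n in l, ∀ t ∈ Icc a b,
      |thet H (R n) t - c n * (2 * π) - Θ t| < ε) : StrictMono Θ := by
  intro a b hab
  refine (hm hab.le).lt_of_ne fun hEq => ?_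
  have hconst : ∀ t ∈ Icc a b, Θ t = Θ a := fun t ht =>
    le_antisymm ((hm ht.2).trans hEq.ge) (hm ht.1)
  set Ψ : ℝ × ℝ × ℝ → ℂ := fun p => ((p.1 * Real.exp (p.2.1 + f ((p.2.2 : ℝ) : AddCircle (2 * π))) : ℝ) : ℂ)
    * Complex.exp (p.2.2 * Complex.I) with hΨ
  have hΨc : Continuous Ψ := by
    have h1 : Continuous (fun p : ℝ × ℝ × ℝ => f ((p.2.2 : ℝ) : AddCircle (2 * π))) :=
      hf.comp ((AddCircle.continuous_mk' _).comp (by fun_prop))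
    have h2 : Continuous (fun p : ℝ × ℝ × ℝ => (p.1 * Real.exp (p.2.1 + f ((p.2.2 : ℝ) : AddCircle (2 * π))) : ℝ)) := by
      fun_prop
    exact (Complex.continuous_ofReal.comp h2).mul (by fun_prop)
  set w : ℂ := Ψ (1, 0, Θ a) with hw
  have hw0 : 0 < ‖w‖ := by
    rw [norm_pos_iff, hw, hΨ]
    refine mul_ne_zero ?_ (Complex.exp_ne_zero _)
    have := (Real.exp_pos (0 + f ((Θ a : ℝ) : AddCircle (2 * π)))).ne'
    simpa using this
  obtain ⟨N, hN⟩ := exists_nat_ge (2 * π / (b - a))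
  rw [div_le_iff₀ (by linarith)] at hN
  set M := Real.exp B + ‖w‖ with hM
  have hM0 : 0 < M := by positivity
  have main : ∀ ε > 0, ‖w‖ ^ N ≤ ε * M ^ (N - 1) := by
    intro ε hε
    obtain ⟨δ, hδ, hδΨ⟩ := Metric.continuous_iff.1 hΨc (1, 0, Θ a) ε hε
    have e1 : ∀ᶠ n in l, dist (R n) 1 < δ := (Metric.tendsto_nhds.1 hRl) δ hδ
    obtain ⟨n, n1, n2, n3⟩ := (e1.and ((hclose δ hδ).and (hlim a b δ hδ))).exists
    have hRp : 0 < R n := by linarith [hR0 n]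
    have hsub : closedBall (0:ℂ) (R n) ⊆ ball 0 1 := closedBall_subset_ball (hR1 n)
    have := arc_max (G := fun z => z * Complex.exp (H z) - w) (R := R n) (M := M) (ε := ε)
      (β := b - a) (N := N) (a := a) (b := b) hRp
      (by have := hH.mono hsub; fun_prop)
      (by
        intro z hz
        refine (norm_sub_le _ _).trans ?_
        rw [hM]
        gcongr
        rw [norm_mul, Complex.norm_exp]
        have h1 : ‖z‖ ≤ 1 := by
          have := hsub hz
          rw [mem_ball_zero_iff] at this
          exact this.le
        have h2 : Real.exp (H z).re ≤ Real.exp B := Real.exp_le_exp.2 (hB z (hsub hz))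
        nlinarith [norm_nonneg z, Real.exp_pos (H z).re]) (by linarith) le_rfl hN
      (by
        intro t ht
        have hF : circleMap 0 (R n) t * Complex.exp (H (circleMap 0 (R n) t)) =
            Ψ (R n, (H (circleMap 0 (R n) t)).re - f ((thet H (R n) t : ℝ) : AddCircle (2 * π)),
              thet H (R n) t - c n * (2 * π)) := by
          simp only [hΨ, coe_sub_period, sub_add_cancel]
          have ex : Complex.exp (((thet H (R n) t - c n * (2 * π) : ℝ) : ℂ) * Complex.I) =
              Complex.exp ((thet H (R n) t : ℝ) * Complex.I) := by
            rw [Complex.exp_eq_exp_iff_exists_int]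
            exact ⟨-c n, by push_cast; ring⟩
          rw [ex]
          conv_lhs => rw [← Complex.re_add_im (H (circleMap 0 (R n) t))]
          simp only [thet, circleMap, zero_add]
          push_cast
          rw [add_mul, Complex.exp_add, Complex.exp_add]
          ring
        rw [hF, ← dist_eq_norm]
        refine (hδΨ _ ?_).le
        rw [Prod.dist_eq, Prod.dist_eq, max_lt_iff, max_lt_iff]
        refine ⟨n1, ?_, ?_⟩
        · have := n2 t
          rw [Real.dist_eq, sub_zero]
          exact this
        · have := n3 t ht
          rw [hconst t ht] at this
          rw [Real.dist_eq]
          exact this)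
    simpa using this
  have h1 := main (‖w‖ ^ N / (2 * M ^ (N - 1))) (by positivity)
  have h2 : ‖w‖ ^ N / (2 * M ^ (N - 1)) * M ^ (N - 1) = ‖w‖ ^ N / 2 := by field_simp
  rw [h2] at h1
  have : 0 < ‖w‖ ^ N := by positivity
  linarith

theorem main_thm [Fact ((0 : ℝ) < 2 * π)]
    (f : AddCircle (2 * π) → ℝ) (hf : Continuous f) :
    ∃ (h : AddCircle (2 * π) ≃ₜ AddCircle (2 * π)) (C : ℝ), 0 < C ∧
      ∀ k : ℤ, k ≠ 0 →
        ‖fourierCoeff (fun t => ((f (h t) : ℝ) : ℂ)) k‖ ≤ C / |(k : ℝ)| := by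
  obtain ⟨H, A, B, hH, hP, hAB, hcl⟩ := exists_H f hf
  set R : ℕ → ℝ := fun n => 1 - 1 / ((n : ℝ) + 1) / 2 with hRdef
  have hRn : ∀ n, 1 / 2 ≤ R n ∧ R n < 1 := by
    intro n
    have h1 : (0 : ℝ) < 1 / ((n : ℝ) + 1) := by positivity
    have h2 : 1 / ((n : ℝ) + 1) ≤ 1 := by
      rw [div_le_one (by positivity)]; linarith [n.cast_nonneg (α := ℝ)]
    simp only [hRdef]
    constructor <;> linarith
  have hRt : Tendsto R atTop (𝓝 1) := by
    have := (tendsto_one_div_add_atTop_nhds_zero_nat (𝕜 := ℝ)).div_const 2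
    have := this.const_sub 1
    simpa [hRdef] using this
  obtain ⟨Θ, c, l, hl, hla, hΘm, hΘc, hΘp, hlim⟩ := limit_exists (fun n => thet H (R n))
    (fun n => thet_mono hH hP (by linarith [(hRn n).1]) (hRn n).2) (fun n t => thet_add _ _)
    (by
      intro ε hε
      obtain ⟨δ, hδ, h⟩ := thet_equi hH hP hAB hε
      exact ⟨δ, hδ, fun n a b hab => h (R n) (hRn n).1 (hRn n).2 a b hab⟩)
  have hRl := hRt.mono_left hla
  have hclose : ∀ ε > 0, ∀ᶠ n in l, ∀ t : ℝ,
        |(H (circleMap 0 (R n) t)).re - f ((thet H (R n) t : ℝ) : AddCircle (2 * π))| < ε := by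
    intro ε hε
    obtain ⟨R₀, hR₀, h⟩ := hcl ε hε
    filter_upwards [hRl.eventually (lt_mem_nhds hR₀)] with n hn t
    exact h (R n) hn (hRn n).2 t
  have hsm := strict_lim hf hH (fun z hz => (hAB z hz).2) (fun n => (hRn n).1) (fun n => (hRn n).2) hRl
    hclose hΘm hlim
  obtain ⟨h, hh⟩ := circle_homeo Θ hsm hΘc hΘp
  refine ⟨h, 2, by norm_num, fun k hk => ?_⟩
  rw [fourierCoeff_eq_intervalIntegral _ _ 0, zero_add]
  have hfour : ∀ x : ℝ, (fourier (-k) (x : AddCircle (2 * π)) : ℂ) =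
      Complex.exp (Complex.I * ((-k : ℤ) : ℂ) * x) := by
    intro x
    rw [fourier_coe_apply]
    congr 1
    have : (π : ℂ) ≠ 0 := by exact_mod_cast Real.pi_ne_zero
    push_cast
    field_simp
  simp only [hfour, hh, smul_eq_mul]
  have hkR : 0 < |(k : ℝ)| := by simpa using hk
  suffices hs : ‖∫ x in (0:ℝ)..2 * π, Complex.exp (Complex.I * ((-k : ℤ) : ℂ) * x) *
      ((f ((Θ x : ℝ) : AddCircle (2 * π)) : ℝ) : ℂ)‖ ≤ 4 * π / |(k : ℝ)| by
    rw [norm_smul, Real.norm_of_nonneg (by positivity)]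
    calc _ ≤ 1 / (2 * π) * (4 * π / |(k : ℝ)|) := by gcongr
      _ = _ := by field_simp; norm_num
  refine le_of_forall_pos_le_add fun ε hε => ?_
  have hpi := Real.two_pi_pos
  set η := ε / (2 * π) / 2 with hη
  have hη0 : 0 < η := by positivity
  have huc : UniformContinuous f := CompactSpace.uniformContinuous_of_continuous hf
  obtain ⟨δ, hδ, hδf⟩ := Metric.uniformContinuous_iff.1 huc η hη0
  obtain ⟨n, n1, n2⟩ := ((hclose η hη0).and (hlim 0 (2 * π) δ hδ)).exists
  have hR0 : 0 < R n := by linarith [(hRn n).1]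
  have hb := fourier_re hH hP hR0 (hRn n).2 (k := -k) (by simpa using hk)
  have cH : Continuous (fun t : ℝ => H (circleMap 0 (R n) t)) :=
    hH.continuousOn.comp_continuous (continuous_circleMap 0 _) (circ_mem hR0.le (hRn n).2)
  have cre : Continuous (fun t : ℝ => ((H (circleMap 0 (R n) t)).re : ℂ)) :=
    Complex.continuous_ofReal.comp (Complex.continuous_re.comp cH)
  have cf : Continuous (fun x : ℝ => ((f ((Θ x : ℝ) : AddCircle (2 * π)) : ℝ) : ℂ)) :=
    Complex.continuous_ofReal.comp (hf.comp ((AddCircle.continuous_mk' _).comp hΘc))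
  have hd : ‖(∫ x in (0:ℝ)..2 * π, Complex.exp (Complex.I * ((-k : ℤ) : ℂ) * x) *
      ((f ((Θ x : ℝ) : AddCircle (2 * π)) : ℝ) : ℂ)) -
      ∫ x in (0:ℝ)..2 * π, Complex.exp (Complex.I * ((-k : ℤ) : ℂ) * x) *
        ((H (circleMap 0 (R n) x)).re : ℂ)‖ ≤ (2 * η) * |2 * π - 0| := by
    rw [← intervalIntegral.integral_sub (Continuous.intervalIntegrable (by fun_prop) _ _)
      (Continuous.intervalIntegrable (by fun_prop) _ _)]
    apply intervalIntegral.norm_integral_le_of_norm_le_const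
    intro x hx
    rw [uIoc_of_le hpi.le] at hx
    rw [← mul_sub, norm_mul, show Complex.I * ((-k : ℤ) : ℂ) * x = ((((-k : ℤ) : ℝ) * x : ℝ) : ℂ) * Complex.I by
      push_cast; ring, Complex.norm_exp_ofReal_mul_I, one_mul, ← Complex.ofReal_sub, Complex.norm_real,
      Real.norm_eq_abs]
    have h1 := n1 x
    have h2 := n2 x ⟨hx.1.le, hx.2⟩
    have h3 : |f ((Θ x : ℝ) : AddCircle (2 * π)) - f ((thet H (R n) x : ℝ) : AddCircle (2 * π))| < η := by
      rw [← coe_sub_period (thet H (R n) x) (c n), ← Real.dist_eq]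
      apply hδf
      rw [dist_eq_norm, ← AddCircle.coe_sub]
      refine lt_of_le_of_lt ?_ h2
      rw [abs_sub_comm]
      exact QuotientAddGroup.norm_mk_le_norm
    rw [abs_lt] at h1 h3
    rw [abs_le]
    constructor <;> linarith
  have hval : (2 * η) * |2 * π - 0| = ε := by
    rw [sub_zero, abs_of_pos hpi, hη]; field_simp
  rw [hval] at hd
  have hk' : |(((-k : ℤ)) : ℝ)| = |(k : ℝ)| := by push_cast; exact abs_neg _
  rw [hk'] at hb
  have := norm_le_norm_add_norm_sub' (∫ x in (0:ℝ)..2 * π, Complex.exp (Complex.I * ((-k : ℤ) : ℂ) * x) *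
      ((f ((Θ x : ℝ) : AddCircle (2 * π)) : ℝ) : ℂ))
      (∫ x in (0:ℝ)..2 * π, Complex.exp (Complex.I * ((-k : ℤ) : ℂ) * x) *
        ((H (circleMap 0 (R n) x)).re : ℂ))
  linarith

end Part9x


/-- For every continuous real-valued `f` on the circle there is a homeomorphism `h` such that
the Fourier coefficients of `f ∘ h` are `O(1/|k|)`. -/
theorem fourier_coeff_superposition_big_O_inv
    [inst : Fact ((0 : ℝ) < 2 * π)]
    (f : AddCircle (2 * π) → ℝ) (hf : Continuous f) :
    ∃ (h : AddCircle (2 * π) ≃ₜ AddCircle (2 * π)) (C : ℝ), 0 < C ∧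
      ∀ k : ℤ, k ≠ 0 →
        ‖fourierCoeff (fun t => ((f (h t) : ℝ) : ℂ)) k‖ ≤ C / |(k : ℝ)| := by
  exact main_thm f hf
end
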